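/- arXiv:math-ph/0108023 — 2 statements merged into one kernel-verified Lean document; each statement's English description precedes it below -/
import Mathlib

section
/- Let n be a positive integer. A smooth function Λ(t,x,u,u_x,u_xx) is a conservation-law multiplier for the generalized Korteweg–de Vries equation u_t + u^n u_x + u_xxx = 0 if and only if: for n = 1, Λ is a real linear combination of 1, u, u_xx + u²/2, and tu − x; for n = 2, Λ is a real linear combination of 1, u, u_xx + u³/3, and t(u_xx + u³/3) − xu/3; and for every n ≥ 3, Λ is a real linear combination of 1, u, and u_xx + u^{n+1}/(n+1). -/
/-!
Classification of all conservation-law multipliers Λ(t,x,u,u_x,u_xx) of the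
generalized Korteweg–de Vries equation u_t + uⁿ u_x + u_xxx = 0.
-/

noncomputable section

/-- Partial derivative with respect to the first variable (t). -/
def pdt (u : ℝ → ℝ → ℝ) : ℝ → ℝ → ℝ := fun t x => deriv (fun s => u s x) t

/-- Partial derivative with respect to the second variable (x). -/
def pdx (u : ℝ → ℝ → ℝ) : ℝ → ℝ → ℝ := fun t x => deriv (fun y => u t y) x

/-- Mixed partial derivative ∂_t^i ∂_x^j u. -/
def pd (i j : ℕ) (u : ℝ → ℝ → ℝ) : ℝ → ℝ → ℝ := pdt^[i] (pdx^[j] u)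

/-- Index set for the partial derivatives ∂_t^i ∂_x^j u of total order i + j ≤ n. -/
abbrev JetIdx (n : ℕ) := {p : Fin (n + 1) × Fin (n + 1) // (p.1 : ℕ) + (p.2 : ℕ) ≤ n}

/-- The collection of all partial derivatives of u of total order ≤ n at (t,x). -/
def jet (n : ℕ) (u : ℝ → ℝ → ℝ) (t x : ℝ) : JetIdx n → ℝ :=
  fun p => pd (p.1.1 : ℕ) (p.1.2 : ℕ) u t x

/-- Smoothness of a function of two real variables. -/
def Smooth2 (u : ℝ → ℝ → ℝ) : Prop :=
  ContDiff ℝ (⊤ : ℕ∞) (fun p : ℝ × ℝ => u p.1 p.2)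

/-- Smoothness of a function of five real variables. -/
def Smooth5 (Λ : ℝ → ℝ → ℝ → ℝ → ℝ → ℝ) : Prop :=
  ContDiff ℝ (⊤ : ℕ∞)
    (fun v : ℝ × ℝ × ℝ × ℝ × ℝ => Λ v.1 v.2.1 v.2.2.1 v.2.2.2.1 v.2.2.2.2)

/-- `Λ(t,x,u,u_x,u_xx)` is a conservation-law multiplier for the generalized
Korteweg–de Vries equation `u_t + uⁿ u_x + u_xxx = 0`:  there are smooth fluxes
`Φᵗ, Φˣ`, depending on `t`, `x` and the partial derivatives of `u` of total
order at most `4`, such that `(u_t + uⁿ u_x + u_xxx)·Λ = D_t Φᵗ + D_x Φˣ`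
holds pointwise for every smooth `u : ℝ² → ℝ`. -/
def IsMultiplierKdV (n : ℕ) (Λ : ℝ → ℝ → ℝ → ℝ → ℝ → ℝ) : Prop :=
  ∃ Φt Φx : ℝ × ℝ × (JetIdx 4 → ℝ) → ℝ,
    ContDiff ℝ (⊤ : ℕ∞) Φt ∧ ContDiff ℝ (⊤ : ℕ∞) Φx ∧
    ∀ u : ℝ → ℝ → ℝ, Smooth2 u → ∀ t x : ℝ,
      (pd 1 0 u t x + (u t x) ^ n * pd 0 1 u t x + pd 0 3 u t x) *
          Λ t x (u t x) (pd 0 1 u t x) (pd 0 2 u t x)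
        = deriv (fun s => Φt (s, x, jet 4 u s x)) t
          + deriv (fun y => Φx (t, y, jet 4 u t y)) x

open scoped ContDiff

section Basic

variable {V : Type*} [NormedAddCommGroup V] [NormedSpace ℝ V]

/-- The derivative of `F` in the direction `e`. -/
def dir (e : V) (F : V → ℝ) (v : V) : ℝ := fderiv ℝ F v e

lemma ContDiff.smooth_dir {F : V → ℝ} (hF : ContDiff ℝ (⊤ : ℕ∞) F) (e : V) :
    ContDiff ℝ (⊤ : ℕ∞) (dir e F) :=
  (hF.fderiv_right (m := (⊤ : ℕ∞)) (by simp)).clm_apply contDiff_const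

lemma ContDiff.hasFDerivAt_top {F : V → ℝ} (hF : ContDiff ℝ (⊤ : ℕ∞) F) (v : V) :
    HasFDerivAt F (fderiv ℝ F v) v :=
  (hF.differentiable (by simp) v).hasFDerivAt

lemma dir_dir {F : V → ℝ} (hF : ContDiff ℝ (⊤ : ℕ∞) F) (e f v : V) :
    dir e (dir f F) v = fderiv ℝ (fderiv ℝ F) v e f := by
  have h : Differentiable ℝ (fderiv ℝ F) :=
    (hF.fderiv_right (m := (⊤ : ℕ∞)) (by simp)).differentiable (by simp)
  have := ((h v).hasFDerivAt.clm_apply (hasFDerivAt_const f v)).fderiv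
  unfold dir
  rw [this]
  simp

lemma dir_comm {F : V → ℝ} (hF : ContDiff ℝ (⊤ : ℕ∞) F) (e f v : V) :
    dir e (dir f F) v = dir f (dir e F) v := by
  rw [dir_dir hF, dir_dir hF]
  exact hF.contDiffAt.isSymmSndFDerivAt
    (by simpa using WithTop.coe_le_coe.2 (le_top (a := (2 : ℕ∞)))) e f

lemma ContDiff.hasDerivAt_comp_dir {F : V → ℝ} (hF : ContDiff ℝ (⊤ : ℕ∞) F) {γ : ℝ → V} {γ' : V}
    {s : ℝ} (hγ : HasDerivAt γ γ' s) : HasDerivAt (fun r => F (γ r)) (dir γ' F (γ s)) s :=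
  (hF.hasFDerivAt_top (γ s)).comp_hasDerivAt s hγ

end Basic

section Plane

variable {u w : ℝ → ℝ → ℝ}

lemma Smooth2.hasDerivAt_dir_left (hu : Smooth2 u) (t x : ℝ) :
    HasDerivAt (fun s => u s x) (dir (1, 0) (fun p : ℝ × ℝ => u p.1 p.2) (t, x)) t :=
  hu.hasDerivAt_comp_dir (γ := fun s => (s, x)) ((hasDerivAt_id t).prodMk (hasDerivAt_const t x))

lemma Smooth2.hasDerivAt_dir_right (hu : Smooth2 u) (t x : ℝ) :
    HasDerivAt (fun y => u t y) (dir (0, 1) (fun p : ℝ × ℝ => u p.1 p.2) (t, x)) x :=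
  hu.hasDerivAt_comp_dir (γ := fun y => (t, y)) ((hasDerivAt_const x t).prodMk (hasDerivAt_id x))

lemma Smooth2.pdt_eq (hu : Smooth2 u) (t x : ℝ) :
    pdt u t x = dir (1, 0) (fun p : ℝ × ℝ => u p.1 p.2) (t, x) :=
  (hu.hasDerivAt_dir_left t x).deriv

lemma Smooth2.pdx_eq (hu : Smooth2 u) (t x : ℝ) :
    pdx u t x = dir (0, 1) (fun p : ℝ × ℝ => u p.1 p.2) (t, x) :=
  (hu.hasDerivAt_dir_right t x).deriv

lemma Smooth2.hasDerivAt_pdt (hu : Smooth2 u) (t x : ℝ) :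
    HasDerivAt (fun s => u s x) (pdt u t x) t :=
  hu.pdt_eq t x ▸ hu.hasDerivAt_dir_left t x

lemma Smooth2.hasDerivAt_pdx (hu : Smooth2 u) (t x : ℝ) :
    HasDerivAt (fun y => u t y) (pdx u t x) x :=
  hu.pdx_eq t x ▸ hu.hasDerivAt_dir_right t x

lemma Smooth2.pdt (hu : Smooth2 u) : Smooth2 (pdt u) := by
  have h : (fun p : ℝ × ℝ => _root_.pdt u p.1 p.2) = dir (1, 0) (fun p : ℝ × ℝ => u p.1 p.2) :=
    funext fun p => hu.pdt_eq p.1 p.2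
  unfold Smooth2
  rw [h]
  exact ContDiff.smooth_dir hu _

lemma Smooth2.pdx (hu : Smooth2 u) : Smooth2 (pdx u) := by
  have h : (fun p : ℝ × ℝ => _root_.pdx u p.1 p.2) = dir (0, 1) (fun p : ℝ × ℝ => u p.1 p.2) :=
    funext fun p => hu.pdx_eq p.1 p.2
  unfold Smooth2
  rw [h]
  exact ContDiff.smooth_dir hu _

lemma Smooth2.pdt_pdx (hu : Smooth2 u) (t x : ℝ) :
    _root_.pdt (_root_.pdx u) t x = _root_.pdx (_root_.pdt u) t x := by
  have h₁ : (fun p : ℝ × ℝ => _root_.pdx u p.1 p.2) = dir (0, 1) (fun p : ℝ × ℝ => u p.1 p.2) :=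
    funext fun p => hu.pdx_eq p.1 p.2
  have h₂ : (fun p : ℝ × ℝ => _root_.pdt u p.1 p.2) = dir (1, 0) (fun p : ℝ × ℝ => u p.1 p.2) :=
    funext fun p => hu.pdt_eq p.1 p.2
  rw [hu.pdx.pdt_eq, hu.pdt.pdx_eq, h₁, h₂]
  exact dir_comm hu _ _ _

lemma Smooth2.pd (hu : Smooth2 u) (i j : ℕ) : Smooth2 (pd i j u) := by
  have hx : Smooth2 (_root_.pdx^[j] u) := by
    induction j with
    | zero => exact hu
    | succ j ih => rw [Function.iterate_succ_apply']; exact ih.pdx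
  unfold _root_.pd
  induction i with
  | zero => exact hx
  | succ i ih => rw [Function.iterate_succ_apply']; exact ih.pdt

lemma Smooth2.jet (hu : Smooth2 u) (k : ℕ) :
    ContDiff ℝ (⊤ : ℕ∞) (fun p : ℝ × ℝ => jet k u p.1 p.2) :=
  contDiff_pi.2 fun q => hu.pd q.1.1 q.1.2

lemma Smooth2.add_mul (hu : Smooth2 u) (hw : Smooth2 w) (ε : ℝ) :
    Smooth2 (fun t x => u t x + ε * w t x) :=
  ContDiff.add hu (contDiff_const.mul hw)

lemma pdt_add_mul (hu : Smooth2 u) (hw : Smooth2 w) (ε : ℝ) :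
    pdt (fun t x => u t x + ε * w t x) = fun t x => pdt u t x + ε * pdt w t x :=
  funext₂ fun t x => ((hu.hasDerivAt_pdt t x).add ((hw.hasDerivAt_pdt t x).const_mul ε)).deriv

lemma pdx_add_mul (hu : Smooth2 u) (hw : Smooth2 w) (ε : ℝ) :
    pdx (fun t x => u t x + ε * w t x) = fun t x => pdx u t x + ε * pdx w t x :=
  funext₂ fun t x => ((hu.hasDerivAt_pdx t x).add ((hw.hasDerivAt_pdx t x).const_mul ε)).deriv

lemma pd_add_mul (hu : Smooth2 u) (hw : Smooth2 w) (ε : ℝ) (i j : ℕ) :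
    pd i j (fun t x => u t x + ε * w t x) = fun t x => pd i j u t x + ε * pd i j w t x := by
  have hx : pdx^[j] (fun t x => u t x + ε * w t x)
      = fun t x => pdx^[j] u t x + ε * pdx^[j] w t x := by
    induction j with
    | zero => rfl
    | succ j ih =>
      simp only [Function.iterate_succ_apply', ih]
      exact pdx_add_mul (hu.pd 0 j) (hw.pd 0 j) ε
  unfold pd
  rw [hx]
  induction i with
  | zero => rfl
  | succ i ih =>
    simp only [Function.iterate_succ_apply', ih]
    exact pdt_add_mul (hu.pd i j) (hw.pd i j) ε

lemma jet_add_mul (hu : Smooth2 u) (hw : Smooth2 w) (ε : ℝ) (k : ℕ) (t x : ℝ) :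
    jet k (fun t x => u t x + ε * w t x) t x = jet k u t x + ε • jet k w t x := by
  funext q
  simp [jet, pd_add_mul hu hw]

/-- `u` vanishes identically off `K`. -/
def VanishesOff (K : Set (ℝ × ℝ)) (u : ℝ → ℝ → ℝ) : Prop := ∀ t x, (t, x) ∉ K → u t x = 0

lemma VanishesOff.pdt {K : Set (ℝ × ℝ)} (hK : IsClosed K) (hu : VanishesOff K u) :
    VanishesOff K (pdt u) := fun t x h => by
  have hc : Filter.Tendsto (fun s : ℝ => (s, x)) (nhds t) (nhds (t, x)) :=
    (Continuous.prodMk_left x).tendsto t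
  have h0 : (fun s => u s x) =ᶠ[nhds t] fun _ => 0 :=
    (hc.eventually (hK.isOpen_compl.mem_nhds h)).mono fun s hs => hu s x hs
  exact h0.deriv_eq.trans (deriv_const t 0)

lemma VanishesOff.pdx {K : Set (ℝ × ℝ)} (hK : IsClosed K) (hu : VanishesOff K u) :
    VanishesOff K (pdx u) := fun t x h => by
  have hc : Filter.Tendsto (fun y : ℝ => (t, y)) (nhds x) (nhds (t, x)) :=
    (Continuous.prodMk_right t).tendsto x
  have h0 : (fun y => u t y) =ᶠ[nhds x] fun _ => 0 :=
    (hc.eventually (hK.isOpen_compl.mem_nhds h)).mono fun y hy => hu t y hy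
  exact h0.deriv_eq.trans (deriv_const x 0)

lemma VanishesOff.pd {K : Set (ℝ × ℝ)} (hK : IsClosed K) (hu : VanishesOff K u) (i j : ℕ) :
    VanishesOff K (pd i j u) := by
  have hx : VanishesOff K (_root_.pdx^[j] u) := by
    induction j with
    | zero => exact hu
    | succ j ih => rw [Function.iterate_succ_apply']; exact ih.pdx hK
  unfold _root_.pd
  induction i with
  | zero => exact hx
  | succ i ih => rw [Function.iterate_succ_apply']; exact ih.pdt hK

lemma integral_dir_eq_zero {F : ℝ × ℝ → ℝ} (hF : ContDiff ℝ (⊤ : ℕ∞) F)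
    (hc : HasCompactSupport F) (e : ℝ × ℝ) : ∫ p, dir e F p = 0 := by
  have hi : MeasureTheory.Integrable (fun p => fderiv ℝ F p e) :=
    (hF.smooth_dir e).continuous.integrable_of_hasCompactSupport (hc.fderiv_apply ℝ e)
  have := integral_mul_fderiv_eq_neg_fderiv_mul_of_integrable (μ := MeasureTheory.volume)
    (f := fun _ : ℝ × ℝ => (1 : ℝ)) (g := F) (v := e) (by simp) (by simpa using hi)
    (by simpa using hF.continuous.integrable_of_hasCompactSupport hc)
    (fun _ _ => differentiableAt_const _) (fun p _ => hF.differentiable (by simp) p)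
  simpa [dir] using this

/-- A divergence of smooth compactly supported functions has zero integral. -/
lemma integral_divergence_eq_zero {K : Set (ℝ × ℝ)} (hK : IsCompact K)
    (hu : Smooth2 u) (hw : Smooth2 w) (hu0 : VanishesOff K u) (hw0 : VanishesOff K w) :
    ∫ p : ℝ × ℝ, (pdt u p.1 p.2 + pdx w p.1 p.2) = 0 := by
  have hcu : HasCompactSupport (fun p : ℝ × ℝ => u p.1 p.2) :=
    HasCompactSupport.intro hK fun p hp => hu0 p.1 p.2 hp
  have hcw : HasCompactSupport (fun p : ℝ × ℝ => w p.1 p.2) :=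
    HasCompactSupport.intro hK fun p hp => hw0 p.1 p.2 hp
  simp only [hu.pdt_eq, hw.pdx_eq]
  rw [MeasureTheory.integral_add, integral_dir_eq_zero hu hcu, integral_dir_eq_zero hw hcw,
    add_zero]
  · exact (ContDiff.smooth_dir hu _).continuous.integrable_of_hasCompactSupport (hcu.fderiv_apply ℝ _)
  · exact (ContDiff.smooth_dir hw _).continuous.integrable_of_hasCompactSupport (hcw.fderiv_apply ℝ _)

end Plane

section Coordinates

lemma ContDiff.hasDerivAt_comp_coords {F : ℝ × ℝ × ℝ × ℝ × ℝ → ℝ} (hF : ContDiff ℝ (⊤ : ℕ∞) F)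
    {t x u p q : ℝ → ℝ} {t' x' u' p' q' s : ℝ} (ht : HasDerivAt t t' s) (hx : HasDerivAt x x' s)
    (hu : HasDerivAt u u' s) (hp : HasDerivAt p p' s) (hq : HasDerivAt q q' s) :
    HasDerivAt (fun r => F (t r, x r, u r, p r, q r))
      (t' * dir (1, 0, 0, 0, 0) F (t s, x s, u s, p s, q s)
        + x' * dir (0, 1, 0, 0, 0) F (t s, x s, u s, p s, q s)
        + u' * dir (0, 0, 1, 0, 0) F (t s, x s, u s, p s, q s)
        + p' * dir (0, 0, 0, 1, 0) F (t s, x s, u s, p s, q s)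
        + q' * dir (0, 0, 0, 0, 1) F (t s, x s, u s, p s, q s)) s := by
  convert hF.hasDerivAt_comp_dir (ht.prodMk (hx.prodMk (hu.prodMk (hp.prodMk hq)))) using 1
  have h : ((t', x', u', p', q') : ℝ × ℝ × ℝ × ℝ × ℝ) = t' • (1, 0, 0, 0, 0) + x' • (0, 1, 0, 0, 0)
      + u' • (0, 0, 1, 0, 0) + p' • (0, 0, 0, 1, 0) + q' • (0, 0, 0, 0, 1) := by simp
  simp only [dir]
  rw [h]
  simp only [map_add, map_smul, smul_eq_mul]

end Coordinates

section Variation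

/-- The left-hand side of the generalized KdV equation. -/
def kdv (n : ℕ) (u : ℝ → ℝ → ℝ) (t x : ℝ) : ℝ :=
  pdt u t x + u t x ^ n * pdx u t x + pdx (pdx (pdx u)) t x

/-- The point `(t, x, u, u_x, u_xx)`. -/
def jetx (u : ℝ → ℝ → ℝ) (t x : ℝ) : ℝ × ℝ × ℝ × ℝ × ℝ :=
  (t, x, u t x, pdx u t x, pdx (pdx u) t x)

variable {n : ℕ} {u φ : ℝ → ℝ → ℝ}

lemma Smooth2.kdv (hu : Smooth2 u) (n : ℕ) : Smooth2 (kdv n u) :=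
  ContDiff.add (ContDiff.add hu.pdt (ContDiff.mul (ContDiff.pow hu n) hu.pdx)) hu.pdx.pdx.pdx

lemma Smooth2.comp_jetx {F : ℝ × ℝ × ℝ × ℝ × ℝ → ℝ} (hF : ContDiff ℝ (⊤ : ℕ∞) F)
    (hu : Smooth2 u) : Smooth2 (fun t x => F (jetx u t x)) :=
  hF.comp (contDiff_fst.prodMk (contDiff_snd.prodMk
    (ContDiff.prodMk hu (ContDiff.prodMk hu.pdx hu.pdx.pdx))))

/-- The linearization of `u ↦ G Λ`, where `G` is the generalized KdV operator. -/
def linearized (n : ℕ) (F : ℝ × ℝ × ℝ × ℝ × ℝ → ℝ) (u φ : ℝ → ℝ → ℝ) (t x : ℝ) : ℝ :=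
  (pdt φ t x + (n * u t x ^ (n - 1) * φ t x * pdx u t x + u t x ^ n * pdx φ t x)
      + pdx (pdx (pdx φ)) t x) * F (jetx u t x)
    + kdv n u t x * (φ t x * dir (0, 0, 1, 0, 0) F (jetx u t x)
      + pdx φ t x * dir (0, 0, 0, 1, 0) F (jetx u t x)
      + pdx (pdx φ) t x * dir (0, 0, 0, 0, 1) F (jetx u t x))

lemma hasDerivAt_linearized {F : ℝ × ℝ × ℝ × ℝ × ℝ → ℝ} (hF : ContDiff ℝ (⊤ : ℕ∞) F)
    (hu : Smooth2 u) (hφ : Smooth2 φ) (t x : ℝ) :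
    HasDerivAt (fun ε => kdv n (fun t x => u t x + ε * φ t x) t x
      * F (jetx (fun t x => u t x + ε * φ t x) t x)) (linearized n F u φ t x) 0 := by
  have aff : ∀ a b : ℝ, HasDerivAt (fun ε : ℝ => a + ε * b) b 0 := fun a b => by
    simpa using ((hasDerivAt_id (0 : ℝ)).mul_const b).const_add a
  simp only [kdv, jetx, pdt_add_mul hu hφ, pdx_add_mul hu hφ, pdx_add_mul hu.pdx hφ.pdx,
    pdx_add_mul hu.pdx.pdx hφ.pdx.pdx]
  refine HasDerivAt.congr_deriv ((((aff (pdt u t x) (pdt φ t x)).add (((aff (u t x) (φ t x)).pow n).mul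
    (aff (pdx u t x) (pdx φ t x)))).add
    (aff (pdx (pdx (pdx u)) t x) (pdx (pdx (pdx φ)) t x))).mul
    (hF.hasDerivAt_comp_coords (hasDerivAt_const 0 t) (hasDerivAt_const 0 x)
      (aff (u t x) (φ t x)) (aff (pdx u t x) (pdx φ t x))
      (aff (pdx (pdx u) t x) (pdx (pdx φ) t x)))) ?_
  simp [linearized, kdv, jetx]

lemma hasDerivAt_flux {Φ : ℝ × ℝ × (JetIdx 4 → ℝ) → ℝ} (hΦ : ContDiff ℝ (⊤ : ℕ∞) Φ)
    {α β : ℝ → ℝ} (hα : ContDiff ℝ (⊤ : ℕ∞) α) (hβ : ContDiff ℝ (⊤ : ℕ∞) β)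
    (hu : Smooth2 u) (hφ : Smooth2 φ) (s₀ : ℝ) :
    HasDerivAt
      (fun ε => deriv (fun s => Φ (α s, β s,
        jet 4 (fun t x => u t x + ε * φ t x) (α s) (β s))) s₀)
      (deriv (fun s => dir (0, 0, jet 4 φ (α s) (β s)) Φ
        (α s, β s, jet 4 u (α s) (β s))) s₀) 0 := by
  have hg : Smooth2 (fun ε s => Φ (α s, β s,
      jet 4 u (α s) (β s) + ε • jet 4 φ (α s) (β s))) := by
    have hs : ContDiff ℝ (⊤ : ℕ∞) (fun p : ℝ × ℝ => (α p.2, β p.2)) :=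
      (hα.comp contDiff_snd).prodMk (hβ.comp contDiff_snd)
    exact hΦ.comp ((hα.comp contDiff_snd).prodMk ((hβ.comp contDiff_snd).prodMk
      (((hu.jet 4).comp hs).add (contDiff_fst.smul ((hφ.jet 4).comp hs)))))
  have h := hg.pdx.hasDerivAt_pdt 0 s₀
  rw [hg.pdt_pdx] at h
  simp only [jet_add_mul hu hφ]
  refine HasDerivAt.congr_deriv h (Eq.symm ?_)
  refine congrArg (fun f => deriv f s₀) (funext fun s => ?_)
  have hγ : HasDerivAt (fun ε : ℝ => ((α s, β s, jet 4 u (α s) (β s)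
      + ε • jet 4 φ (α s) (β s)) : ℝ × ℝ × (JetIdx 4 → ℝ)))
      (0, 0, jet 4 φ (α s) (β s)) 0 := by
    refine (hasDerivAt_const _ _).prodMk ((hasDerivAt_const _ _).prodMk ?_)
    simpa using ((hasDerivAt_id (0 : ℝ)).smul_const
      (jet 4 φ (α s) (β s))).const_add (jet 4 u (α s) (β s))
  have := (hΦ.hasDerivAt_comp_dir hγ).deriv
  simp only [zero_smul, add_zero] at this
  exact this.symm

/-- The Euler operator applied to `G Λ`. -/
def eulerKdV (n : ℕ) (F : ℝ × ℝ × ℝ × ℝ × ℝ → ℝ) (u : ℝ → ℝ → ℝ) (t x : ℝ) : ℝ :=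
  -pdt (fun t x => F (jetx u t x)) t x - u t x ^ n * pdx (fun t x => F (jetx u t x)) t x
    - pdx (pdx (pdx fun t x => F (jetx u t x))) t x
    + kdv n u t x * dir (0, 0, 1, 0, 0) F (jetx u t x)
    - pdx (fun t x => kdv n u t x * dir (0, 0, 0, 1, 0) F (jetx u t x)) t x
    + pdx (pdx fun t x => kdv n u t x * dir (0, 0, 0, 0, 1) F (jetx u t x)) t x

lemma Smooth2.mul {f g : ℝ → ℝ → ℝ} (hf : Smooth2 f) (hg : Smooth2 g) :
    Smooth2 (fun t x => f t x * g t x) := ContDiff.mul hf hg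

lemma Smooth2.eulerKdV {F : ℝ × ℝ × ℝ × ℝ × ℝ → ℝ} (hF : ContDiff ℝ (⊤ : ℕ∞) F)
    (hu : Smooth2 u) (n : ℕ) : Smooth2 (eulerKdV n F u) := by
  have hl := Smooth2.comp_jetx hF hu
  have hU := Smooth2.comp_jetx (hF.smooth_dir (0, 0, 1, 0, 0)) hu
  have hP := (hu.kdv n).mul (Smooth2.comp_jetx (hF.smooth_dir (0, 0, 0, 1, 0)) hu)
  have hQ := (hu.kdv n).mul (Smooth2.comp_jetx (hF.smooth_dir (0, 0, 0, 0, 1)) hu)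
  exact ContDiff.add (ContDiff.sub (ContDiff.add (ContDiff.sub (ContDiff.sub
    (ContDiff.neg hl.pdt) (ContDiff.mul (ContDiff.pow hu n) hl.pdx)) hl.pdx.pdx.pdx)
    (ContDiff.mul (hu.kdv n) hU)) hP.pdx) hQ.pdx.pdx

/-- The flux remainder produced when integrating the linearization by parts. -/
def remainderFlux (n : ℕ) (u φ l P Q : ℝ → ℝ → ℝ) (t x : ℝ) : ℝ :=
  u t x ^ n * l t x * φ t x + (pdx (pdx φ) t x * l t x - pdx φ t x * pdx l t x
    + φ t x * pdx (pdx l) t x) + P t x * φ t x + (Q t x * pdx φ t x - pdx Q t x * φ t x)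

lemma linearized_eq {F : ℝ × ℝ × ℝ × ℝ × ℝ → ℝ} (hF : ContDiff ℝ (⊤ : ℕ∞) F)
    (hu : Smooth2 u) (hφ : Smooth2 φ) (t x : ℝ) :
    linearized n F u φ t x = φ t x * eulerKdV n F u t x
      + pdt (fun t x => φ t x * F (jetx u t x)) t x
      + pdx (remainderFlux n u φ (fun t x => F (jetx u t x))
        (fun t x => kdv n u t x * dir (0, 0, 0, 1, 0) F (jetx u t x))
        (fun t x => kdv n u t x * dir (0, 0, 0, 0, 1) F (jetx u t x))) t x := by
  have hl := Smooth2.comp_jetx hF hu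
  have hP := (hu.kdv n).mul (Smooth2.comp_jetx (hF.smooth_dir (0, 0, 0, 1, 0)) hu)
  have hQ := (hu.kdv n).mul (Smooth2.comp_jetx (hF.smooth_dir (0, 0, 0, 0, 1)) hu)
  have h₁ := ((hφ.hasDerivAt_pdt t x).mul (hl.hasDerivAt_pdt t x)).deriv
  have h₂ := ((((((hu.hasDerivAt_pdx t x).pow n).mul (hl.hasDerivAt_pdx t x)).mul
    (hφ.hasDerivAt_pdx t x)).add ((((hφ.pdx.pdx.hasDerivAt_pdx t x).mul
    (hl.hasDerivAt_pdx t x)).sub ((hφ.pdx.hasDerivAt_pdx t x).mul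
    (hl.pdx.hasDerivAt_pdx t x))).add ((hφ.hasDerivAt_pdx t x).mul
    (hl.pdx.pdx.hasDerivAt_pdx t x)))).add ((hP.hasDerivAt_pdx t x).mul
    (hφ.hasDerivAt_pdx t x))).add (((hQ.hasDerivAt_pdx t x).mul
    (hφ.pdx.hasDerivAt_pdx t x)).sub ((hQ.pdx.hasDerivAt_pdx t x).mul
    (hφ.hasDerivAt_pdx t x)))
  have e₁ : pdt (fun t x => φ t x * F (jetx u t x)) t x = _ := h₁
  have e₂ : pdx (remainderFlux n u φ (fun t x => F (jetx u t x))
        (fun t x => kdv n u t x * dir (0, 0, 0, 1, 0) F (jetx u t x))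
        (fun t x => kdv n u t x * dir (0, 0, 0, 0, 1) F (jetx u t x))) t x = _ := h₂.deriv
  rw [e₁, e₂]
  simp only [linearized, eulerKdV, Pi.mul_apply, Pi.pow_apply]
  ring

/-- The Euler operator annihilates `G Λ` when `Λ` is a multiplier. -/
theorem eulerKdV_eq_zero {Λ : ℝ → ℝ → ℝ → ℝ → ℝ → ℝ} (hΛ : Smooth5 Λ) (hM : IsMultiplierKdV n Λ)
    (hu : Smooth2 u) (t x : ℝ) :
    eulerKdV n (fun v => Λ v.1 v.2.1 v.2.2.1 v.2.2.2.1 v.2.2.2.2) u t x = 0 := by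
  set F : ℝ × ℝ × ℝ × ℝ × ℝ → ℝ := fun v => Λ v.1 v.2.1 v.2.2.1 v.2.2.2.1 v.2.2.2.2 with hFdef
  have hF : ContDiff ℝ (⊤ : ℕ∞) F := hΛ
  obtain ⟨Φt, Φx, hΦt, hΦx, hid⟩ := hM
  have hl := Smooth2.comp_jetx hF hu
  have hP := (hu.kdv n).mul (Smooth2.comp_jetx (hF.smooth_dir (0, 0, 0, 1, 0)) hu)
  have hQ := (hu.kdv n).mul (Smooth2.comp_jetx (hF.smooth_dir (0, 0, 0, 0, 1)) hu)
  have hE := Smooth2.eulerKdV hF hu n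
  have hcont : Continuous (fun p : ℝ × ℝ => eulerKdV n F u p.1 p.2) := ContDiff.continuous hE
  have key : ∀ g : ℝ × ℝ → ℝ, ContDiff ℝ ∞ g → HasCompactSupport g →
      ∫ p, g p • eulerKdV n F u p.1 p.2 = 0 := by
    intro g hg hgc
    set φ : ℝ → ℝ → ℝ := fun t x => g (t, x) with hφdef
    have hφ : Smooth2 φ := hg
    set a : ℝ → ℝ → ℝ := fun t x => dir (0, 0, jet 4 φ t x) Φt (t, x, jet 4 u t x) with ha
    set b : ℝ → ℝ → ℝ := fun t x => dir (0, 0, jet 4 φ t x) Φx (t, x, jet 4 u t x) with hb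
    have smooth_flux : ∀ Φ : ℝ × ℝ × (JetIdx 4 → ℝ) → ℝ, ContDiff ℝ (⊤ : ℕ∞) Φ →
        Smooth2 (fun t x => dir (0, 0, jet 4 φ t x) Φ (t, x, jet 4 u t x)) := fun Φ hΦ =>
      ((hΦ.fderiv_right (m := (⊤ : ℕ∞)) (by simp)).comp
        (contDiff_fst.prodMk (contDiff_snd.prodMk (hu.jet 4)))).clm_apply
        (contDiff_const.prodMk (contDiff_const.prodMk (hφ.jet 4)))
    have hlin : ∀ t x, linearized n F u φ t x = pdt a t x + pdx b t x := by
      intro t x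
      have h₁ := hasDerivAt_linearized (n := n) hF hu hφ t x
      have h₂ := (hasDerivAt_flux hΦt contDiff_id (contDiff_const (c := x)) hu hφ t).add
        (hasDerivAt_flux hΦx (contDiff_const (c := t)) contDiff_id hu hφ x)
      refine h₁.unique (h₂.congr_of_eventuallyEq (Filter.Eventually.of_forall fun ε => ?_))
      exact hid _ (hu.add_mul hφ ε) t x
    have hK : IsClosed (tsupport g) := isClosed_tsupport g
    have hφ0 : VanishesOff (tsupport g) φ := fun t x h => image_eq_zero_of_notMem_tsupport (f := g) h
    have hφx := hφ0.pdx hK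
    have hφxx := hφx.pdx hK
    have hjet : ∀ t x, (t, x) ∉ tsupport g → jet 4 φ t x = 0 := fun t x h =>
      funext fun q => hφ0.pd hK q.1.1 q.1.2 t x h
    set R := remainderFlux n u φ (fun t x => F (jetx u t x))
        (fun t x => kdv n u t x * dir (0, 0, 0, 1, 0) F (jetx u t x))
        (fun t x => kdv n u t x * dir (0, 0, 0, 0, 1) F (jetx u t x)) with hR
    have hRs : Smooth2 R :=
      ContDiff.add (ContDiff.add (ContDiff.add (ContDiff.mul (ContDiff.mul (ContDiff.pow hu n) hl)
        hφ) (ContDiff.add (ContDiff.sub (ContDiff.mul hφ.pdx.pdx hl) (ContDiff.mul hφ.pdx hl.pdx))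
        (ContDiff.mul hφ hl.pdx.pdx))) (ContDiff.mul hP hφ))
        (ContDiff.sub (ContDiff.mul hQ hφ.pdx) (ContDiff.mul hQ.pdx hφ))
    have has := smooth_flux Φt hΦt
    have hbs := smooth_flux Φx hΦx
    have hφl := hφ.mul hl
    have hdiv := integral_divergence_eq_zero
      (u := fun t x => a t x + (-1) * (φ t x * F (jetx u t x)))
      (w := fun t x => b t x + (-1) * R t x) hgc (has.add_mul hφl (-1)) (hbs.add_mul hRs (-1))
      (fun t x h => by
        have h0 : a t x = 0 := by
          simp only [ha, hjet t x h]; exact (fderiv ℝ Φt _).map_zero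
        simp [h0, hφ0 t x h])
      (fun t x h => by
        have h0 : b t x = 0 := by
          simp only [hb, hjet t x h]; exact (fderiv ℝ Φx _).map_zero
        simp [h0, hR, remainderFlux, hφ0 t x h, hφx t x h, hφxx t x h])
    rw [← hdiv]
    congr 1
    funext p
    rw [pdt_add_mul has hφl, pdx_add_mul hbs hRs]
    have h₁ := hlin p.1 p.2
    rw [linearized_eq hF hu hφ p.1 p.2] at h₁
    change φ p.1 p.2 * _ = _
    linarith
  have hae := ae_eq_zero_of_integral_contDiff_smul_eq_zero
    (hcont.locallyIntegrable (μ := MeasureTheory.volume)) key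
  exact congrFun ((hcont.ae_eq_iff_eq MeasureTheory.volume continuous_const).1 hae) (t, x)

end Variation

section Slice

variable {n : ℕ} {F G : ℝ × ℝ × ℝ × ℝ × ℝ → ℝ} {v w : ℝ → ℝ}

lemma ContDiff.smooth_deriv (hw : ContDiff ℝ (⊤ : ℕ∞) w) : ContDiff ℝ (⊤ : ℕ∞) (deriv w) :=
  (contDiff_infty_iff_deriv.1 hw).2

lemma ContDiff.hasDerivAt_top (hw : ContDiff ℝ (⊤ : ℕ∞) w) (x : ℝ) :
    HasDerivAt w (deriv w x) x :=
  (hw.differentiable (by simp) x).hasDerivAt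

/-- The point of the jet space given by a function `w` of `x` at time `t`. -/
def curveJet (t : ℝ) (w : ℝ → ℝ) (x : ℝ) : ℝ × ℝ × ℝ × ℝ × ℝ :=
  (t, x, w x, deriv w x, deriv (deriv w) x)

/-- The spatial part of the generalized KdV operator. -/
def kdvSpatial (n : ℕ) (w : ℝ → ℝ) (x : ℝ) : ℝ :=
  w x ^ n * deriv w x + deriv (deriv (deriv w)) x

lemma ContDiff.kdvSpatial (hw : ContDiff ℝ (⊤ : ℕ∞) w) (n : ℕ) :
    ContDiff ℝ (⊤ : ℕ∞) (kdvSpatial n w) :=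
  ((hw.pow n).mul hw.smooth_deriv).add hw.smooth_deriv.smooth_deriv.smooth_deriv

lemma ContDiff.comp_curveJet (hF : ContDiff ℝ (⊤ : ℕ∞) F) (hw : ContDiff ℝ (⊤ : ℕ∞) w) (t : ℝ) :
    ContDiff ℝ (⊤ : ℕ∞) (fun x => F (curveJet t w x)) :=
  hF.comp (contDiff_const.prodMk (contDiff_id.prodMk (hw.prodMk
    (hw.smooth_deriv.prodMk hw.smooth_deriv.smooth_deriv))))

/-- The Euler operator evaluated at `w(x) + (t - t₀) v(x)` on the line `t = t₀`. -/
lemma eulerKdV_slice (hF : ContDiff ℝ (⊤ : ℕ∞) F) (hv : ContDiff ℝ (⊤ : ℕ∞) v)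
    (hw : ContDiff ℝ (⊤ : ℕ∞) w) (t₀ x : ℝ) :
    eulerKdV n F (fun t x => w x + (t - t₀) * v x) t₀ x =
      -(dir (1, 0, 0, 0, 0) F (curveJet t₀ w x)
          + v x * dir (0, 0, 1, 0, 0) F (curveJet t₀ w x)
          + deriv v x * dir (0, 0, 0, 1, 0) F (curveJet t₀ w x)
          + deriv (deriv v) x * dir (0, 0, 0, 0, 1) F (curveJet t₀ w x))
        - w x ^ n * deriv (fun x => F (curveJet t₀ w x)) x
        - deriv (deriv (deriv fun x => F (curveJet t₀ w x))) x
        + (v x + kdvSpatial n w x) * dir (0, 0, 1, 0, 0) F (curveJet t₀ w x)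
        - deriv (fun x => (v x + kdvSpatial n w x) *
            dir (0, 0, 0, 1, 0) F (curveJet t₀ w x)) x
        + deriv (deriv fun x => (v x + kdvSpatial n w x) *
            dir (0, 0, 0, 0, 1) F (curveJet t₀ w x)) x := by
  set u : ℝ → ℝ → ℝ := fun t x => w x + (t - t₀) * v x with hu_def
  have hu : Smooth2 u := (hw.comp contDiff_snd).add
    ((contDiff_fst.sub contDiff_const).mul (hv.comp contDiff_snd))
  have hslice : ∀ f : ℝ → ℝ → ℝ, pdx f t₀ = deriv (f t₀) := fun f => rfl
  have hu₀ : u t₀ = w := funext fun y => by simp [u]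
  have hut : pdt u = fun _ x => v x := funext₂ fun t x => by
    exact (((((hasDerivAt_id t).sub_const t₀).mul_const (v x)).const_add (w x)).congr_deriv
      (one_mul _)).deriv
  have hutx : pdt (pdx u) = fun _ x => deriv v x := funext₂ fun t x => by
    rw [hu.pdt_pdx, hut]; rfl
  have hutxx : pdt (pdx (pdx u)) = fun _ x => deriv (deriv v) x := funext₂ fun t x => by
    rw [hu.pdx.pdt_pdx, hutx]; rfl
  have hjet : ∀ y, jetx u t₀ y = curveJet t₀ w y := fun y => by
    simp only [jetx, curveJet, hslice, hu₀]
  have hkdv : ∀ y, kdv n u t₀ y = v y + kdvSpatial n w y := fun y => by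
    simp only [kdv, kdvSpatial, hslice, hu₀, hut]; ring
  have hlt : pdt (fun t x => F (jetx u t x)) t₀ x = _ :=
    (hF.hasDerivAt_comp_coords (hasDerivAt_id t₀) (hasDerivAt_const t₀ x)
      (hu.hasDerivAt_pdt t₀ x) (hu.pdx.hasDerivAt_pdt t₀ x)
      (hu.pdx.pdx.hasDerivAt_pdt t₀ x)).deriv
  have hj : ((id t₀, x, u t₀ x, pdx u t₀ x, pdx (pdx u) t₀ x) : ℝ × ℝ × ℝ × ℝ × ℝ)
      = curveJet t₀ w x := hjet x
  simp only [hj, hut, hutx, hutxx] at hlt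
  simp only [eulerKdV, hlt, hslice, hjet, hkdv, hu₀]
  ring

variable (hE : ∀ u, Smooth2 u → ∀ t x, eulerKdV n F u t x = 0)

lemma deriv_deriv_mul {f g : ℝ → ℝ} (hf : ContDiff ℝ (⊤ : ℕ∞) f) (hg : ContDiff ℝ (⊤ : ℕ∞) g)
    (x : ℝ) : deriv (deriv fun y => f y * g y) x
      = deriv (deriv f) x * g x + 2 * (deriv f x * deriv g x) + f x * deriv (deriv g) x := by
  have h : deriv (fun y => f y * g y) = fun y => deriv f y * g y + f y * deriv g y :=
    funext fun y => ((hf.hasDerivAt_top y).mul (hg.hasDerivAt_top y)).deriv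
  rw [h]
  refine (HasDerivAt.congr_deriv (((hf.smooth_deriv.hasDerivAt_top x).mul
    (hg.hasDerivAt_top x)).add ((hf.hasDerivAt_top x).mul
    (hg.smooth_deriv.hasDerivAt_top x))) ?_).deriv
  ring

include hE in
lemma euler_expanded (hF : ContDiff ℝ (⊤ : ℕ∞) F) (hw : ContDiff ℝ (⊤ : ℕ∞) w) (t x c : ℝ) :
    -(dir (1, 0, 0, 0, 0) F (curveJet t w x) + c * dir (0, 0, 0, 1, 0) F (curveJet t w x))
        - w x ^ n * deriv (fun x => F (curveJet t w x)) x
        - deriv (deriv (deriv fun x => F (curveJet t w x))) x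
        + kdvSpatial n w x * dir (0, 0, 1, 0, 0) F (curveJet t w x)
        - ((c + deriv (kdvSpatial n w) x) * dir (0, 0, 0, 1, 0) F (curveJet t w x)
          + kdvSpatial n w x * deriv (fun x => dir (0, 0, 0, 1, 0) F (curveJet t w x)) x)
        + (deriv (deriv (kdvSpatial n w)) x * dir (0, 0, 0, 0, 1) F (curveJet t w x)
          + 2 * ((c + deriv (kdvSpatial n w) x)
            * deriv (fun x => dir (0, 0, 0, 0, 1) F (curveJet t w x)) x)
          + kdvSpatial n w x
            * deriv (deriv fun x => dir (0, 0, 0, 0, 1) F (curveJet t w x)) x) = 0 := by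
  set v : ℝ → ℝ := fun y => c * (y - x) with hv_def
  have hv : ContDiff ℝ (⊤ : ℕ∞) v := contDiff_const.mul (contDiff_id.sub contDiff_const)
  have hS := hw.kdvSpatial n
  have hP := (hF.smooth_dir (0, 0, 0, 1, 0)).comp_curveJet hw t
  have hQ := (hF.smooth_dir (0, 0, 0, 0, 1)).comp_curveJet hw t
  have hv1 : deriv v = fun _ => c := funext fun y => by
    exact ((((hasDerivAt_id y).sub_const x).const_mul c).congr_deriv (mul_one _)).deriv
  have hvS : ContDiff ℝ (⊤ : ℕ∞) (fun y => v y + kdvSpatial n w y) := hv.add hS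
  have hvS1 : deriv (fun y => v y + kdvSpatial n w y)
      = fun y => c + deriv (kdvSpatial n w) y := funext fun y => by
    have := ((hv.hasDerivAt_top y).add (hS.hasDerivAt_top y)).deriv
    rw [hv1] at this
    exact this
  have hvS2 : deriv (fun y => c + deriv (kdvSpatial n w) y) x
      = deriv (deriv (kdvSpatial n w)) x := deriv_const_add _
  have h1 : deriv (fun x => (v x + kdvSpatial n w x) *
      dir (0, 0, 0, 1, 0) F (curveJet t w x)) x = _ :=
    ((hvS.hasDerivAt_top x).mul (hP.hasDerivAt_top x)).deriv
  have hu : Smooth2 (fun s x => w x + (s - t) * v x) := (hw.comp contDiff_snd).add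
    ((contDiff_fst.sub contDiff_const).mul (hv.comp contDiff_snd))
  have h := hE _ hu t x
  rw [eulerKdV_slice hF hv hw, deriv_deriv_mul hvS hQ, h1, hvS1, hvS2, hv1] at h
  have hvx : v x = 0 := by simp [v]
  simp only [hvx, deriv_const, zero_add, zero_mul, add_zero] at h
  exact h

include hE in
lemma dir_p_eq_deriv_dir_q (hF : ContDiff ℝ (⊤ : ℕ∞) F) (hw : ContDiff ℝ (⊤ : ℕ∞) w) (t : ℝ) :
    deriv (fun x => dir (0, 0, 0, 0, 1) F (curveJet t w x))
      = fun x => dir (0, 0, 0, 1, 0) F (curveJet t w x) := funext fun x => by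
  have h₀ := euler_expanded hE hF hw t x 0
  have h₁ := euler_expanded hE hF hw t x 1
  linarith

include hE in
lemma euler_reduced (hF : ContDiff ℝ (⊤ : ℕ∞) F) (hw : ContDiff ℝ (⊤ : ℕ∞) w) (t x : ℝ) :
    -dir (1, 0, 0, 0, 0) F (curveJet t w x)
        - w x ^ n * deriv (fun x => F (curveJet t w x)) x
        - deriv (deriv (deriv fun x => F (curveJet t w x))) x
        + kdvSpatial n w x * dir (0, 0, 1, 0, 0) F (curveJet t w x)
        + deriv (kdvSpatial n w) x * dir (0, 0, 0, 1, 0) F (curveJet t w x)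
        + deriv (deriv (kdvSpatial n w)) x * dir (0, 0, 0, 0, 1) F (curveJet t w x) = 0 := by
  have h := euler_expanded hE hF hw t x 0
  rw [dir_p_eq_deriv_dir_q hE hF hw t] at h
  linarith

/-- The part of the total `x`-derivative that does not involve third derivatives. -/
def totalX (F : ℝ × ℝ × ℝ × ℝ × ℝ → ℝ) (v : ℝ × ℝ × ℝ × ℝ × ℝ) : ℝ :=
  dir (0, 1, 0, 0, 0) F v + v.2.2.2.1 * dir (0, 0, 1, 0, 0) F v
    + v.2.2.2.2 * dir (0, 0, 0, 1, 0) F v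

lemma ContDiff.totalX (hF : ContDiff ℝ (⊤ : ℕ∞) F) : ContDiff ℝ (⊤ : ℕ∞) (totalX F) := by
  have h1 := hF.smooth_dir (0, 1, 0, 0, 0)
  have h2 := hF.smooth_dir (0, 0, 1, 0, 0)
  have h3 := hF.smooth_dir (0, 0, 0, 1, 0)
  unfold _root_.totalX
  fun_prop

lemma hasDerivAt_curveJet (hG : ContDiff ℝ (⊤ : ℕ∞) G) (hw : ContDiff ℝ (⊤ : ℕ∞) w) (t x : ℝ) :
    HasDerivAt (fun x => G (curveJet t w x))
      (totalX G (curveJet t w x)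
        + dir (0, 0, 0, 0, 1) G (curveJet t w x) * deriv (deriv (deriv w)) x) x := by
  refine HasDerivAt.congr_deriv (hG.hasDerivAt_comp_coords (hasDerivAt_const x t)
    (hasDerivAt_id x) (hw.hasDerivAt_top x) (hw.smooth_deriv.hasDerivAt_top x)
    (hw.smooth_deriv.smooth_deriv.hasDerivAt_top x)) ?_
  simp only [totalX, curveJet]
  ring

/-- Third total derivative of `F` at a point where the third derivative of `w` vanishes. -/
lemma deriv3_curveJet (hF : ContDiff ℝ (⊤ : ℕ∞) F) (hw : ContDiff ℝ (⊤ : ℕ∞) w) (t x : ℝ)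
    (hpq : deriv (fun x => dir (0, 0, 0, 0, 1) F (curveJet t w x))
      = fun x => dir (0, 0, 0, 1, 0) F (curveJet t w x))
    (h3 : deriv (deriv (deriv w)) x = 0) :
    deriv (deriv (deriv fun x => F (curveJet t w x))) x
      = totalX (totalX (totalX F)) (curveJet t w x)
        + (dir (0, 0, 0, 0, 1) (totalX F) (curveJet t w x)
          + 2 * dir (0, 0, 0, 1, 0) F (curveJet t w x)) * deriv (deriv (deriv (deriv w))) x
        + dir (0, 0, 0, 0, 1) F (curveJet t w x)
          * deriv (deriv (deriv (deriv (deriv w)))) x := by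
  have hw3 := hw.smooth_deriv.smooth_deriv.smooth_deriv
  have hq := (hF.smooth_dir (0, 0, 0, 0, 1)).comp_curveJet hw t
  have hp := (hF.smooth_dir (0, 0, 0, 1, 0)).comp_curveJet hw t
  have hqX := (hF.totalX.smooth_dir (0, 0, 0, 0, 1)).comp_curveJet hw t
  have e1 : deriv (fun x => F (curveJet t w x)) = fun x => totalX F (curveJet t w x)
      + dir (0, 0, 0, 0, 1) F (curveJet t w x) * deriv (deriv (deriv w)) x :=
    funext fun y => (hasDerivAt_curveJet hF hw t y).deriv
  have e2 : deriv (fun x => totalX F (curveJet t w x)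
      + dir (0, 0, 0, 0, 1) F (curveJet t w x) * deriv (deriv (deriv w)) x) =
      fun x => totalX (totalX F) (curveJet t w x)
        + dir (0, 0, 0, 0, 1) (totalX F) (curveJet t w x) * deriv (deriv (deriv w)) x
        + (dir (0, 0, 0, 1, 0) F (curveJet t w x) * deriv (deriv (deriv w)) x
        + dir (0, 0, 0, 0, 1) F (curveJet t w x) * deriv (deriv (deriv (deriv w))) x) := by
    funext y
    have := ((hasDerivAt_curveJet hF.totalX hw t y).add
      ((hq.hasDerivAt_top y).mul (hw3.hasDerivAt_top y))).deriv
    rw [hpq] at this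
    exact this
  rw [e1, e2]
  refine (HasDerivAt.congr_deriv (((hasDerivAt_curveJet hF.totalX.totalX hw t x).add
    ((hqX.hasDerivAt_top x).mul (hw3.hasDerivAt_top x))).add
    (((hp.hasDerivAt_top x).mul (hw3.hasDerivAt_top x)).add
    ((hq.hasDerivAt_top x).mul (hw3.smooth_deriv.hasDerivAt_top x)))) ?_).deriv
  rw [hpq, h3]
  ring

lemma deriv_kdvSpatial (hw : ContDiff ℝ (⊤ : ℕ∞) w) (n : ℕ) :
    deriv (kdvSpatial n w) = fun x => n * w x ^ (n - 1) * deriv w x * deriv w x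
      + w x ^ n * deriv (deriv w) x + deriv (deriv (deriv (deriv w))) x := funext fun x =>
  ((((hw.hasDerivAt_top x).pow n).mul (hw.smooth_deriv.hasDerivAt_top x)).add
    (hw.smooth_deriv.smooth_deriv.smooth_deriv.hasDerivAt_top x)).deriv

lemma deriv2_kdvSpatial (hw : ContDiff ℝ (⊤ : ℕ∞) w) (n : ℕ) (x : ℝ) :
    deriv (deriv (kdvSpatial n w)) x = n * ((n - 1 : ℕ) * w x ^ (n - 1 - 1)) * deriv w x ^ 3
      + 3 * (n * w x ^ (n - 1) * deriv w x * deriv (deriv w) x)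
      + w x ^ n * deriv (deriv (deriv w)) x + deriv (deriv (deriv (deriv (deriv w)))) x := by
  rw [deriv_kdvSpatial hw]
  have h := hw.hasDerivAt_top x
  have h1 := hw.smooth_deriv.hasDerivAt_top x
  have h2 := hw.smooth_deriv.smooth_deriv.hasDerivAt_top x
  have h4 := hw.smooth_deriv.smooth_deriv.smooth_deriv.smooth_deriv.hasDerivAt_top x
  refine (HasDerivAt.congr_deriv ((((((h.pow (n - 1)).const_mul (n : ℝ)).mul h1).mul h1).add
    ((h.pow n).mul h2)).add h4) ?_).deriv
  simp only [Pi.pow_apply, Pi.mul_apply]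
  ring

/-- A polynomial with prescribed derivatives at `x`. -/
lemma exists_prescribed_jet (x u p q r s : ℝ) : ∃ w : ℝ → ℝ, ContDiff ℝ (⊤ : ℕ∞) w ∧ w x = u ∧
    deriv w x = p ∧ deriv (deriv w) x = q ∧ deriv (deriv (deriv w)) x = r ∧
    deriv (deriv (deriv (deriv w))) x = s ∧
    deriv (deriv (deriv (deriv (deriv w)))) x = 0 := by
  have poly : ∀ c₀ c₁ c₂ c₃ c₄ : ℝ, deriv (fun y => c₀ + c₁ * (y - x) + c₂ * (y - x) ^ 2
      + c₃ * (y - x) ^ 3 + c₄ * (y - x) ^ 4) = fun y => c₁ + 2 * c₂ * (y - x)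
      + 3 * c₃ * (y - x) ^ 2 + 4 * c₄ * (y - x) ^ 3 + 0 * (y - x) ^ 4 := by
    intro c₀ c₁ c₂ c₃ c₄
    funext y
    have h := (hasDerivAt_id y).sub_const x
    refine (HasDerivAt.congr_deriv (((((h.const_mul c₁).const_add c₀).add
      ((h.pow 2).const_mul c₂)).add ((h.pow 3).const_mul c₃)).add
      ((h.pow 4).const_mul c₄)) ?_).deriv
    simp only [id]
    push_cast
    ring
  refine ⟨fun y => u + p * (y - x) + q / 2 * (y - x) ^ 2 + r / 6 * (y - x) ^ 3
    + s / 24 * (y - x) ^ 4, by fun_prop, ?_, ?_, ?_, ?_, ?_, ?_⟩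
  all_goals simp only [poly, sub_self]; ring

end Slice

section Determining

variable {n : ℕ} {F G : ℝ × ℝ × ℝ × ℝ × ℝ → ℝ}

lemma hasDerivAt_slice_t (hG : ContDiff ℝ (⊤ : ℕ∞) G) (t x u p q : ℝ) :
    HasDerivAt (fun s => G (s, x, u, p, q)) (dir (1, 0, 0, 0, 0) G (t, x, u, p, q)) t := by
  simpa using hG.hasDerivAt_comp_coords (hasDerivAt_id t) (hasDerivAt_const t x)
    (hasDerivAt_const t u) (hasDerivAt_const t p) (hasDerivAt_const t q)

lemma hasDerivAt_slice_x (hG : ContDiff ℝ (⊤ : ℕ∞) G) (t x u p q : ℝ) :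
    HasDerivAt (fun s => G (t, s, u, p, q)) (dir (0, 1, 0, 0, 0) G (t, x, u, p, q)) x := by
  simpa using hG.hasDerivAt_comp_coords (hasDerivAt_const x t) (hasDerivAt_id x)
    (hasDerivAt_const x u) (hasDerivAt_const x p) (hasDerivAt_const x q)

lemma hasDerivAt_slice_u (hG : ContDiff ℝ (⊤ : ℕ∞) G) (t x u p q : ℝ) :
    HasDerivAt (fun s => G (t, x, s, p, q)) (dir (0, 0, 1, 0, 0) G (t, x, u, p, q)) u := by
  simpa using hG.hasDerivAt_comp_coords (hasDerivAt_const u t) (hasDerivAt_const u x)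
    (hasDerivAt_id u) (hasDerivAt_const u p) (hasDerivAt_const u q)

lemma hasDerivAt_slice_p (hG : ContDiff ℝ (⊤ : ℕ∞) G) (t x u p q : ℝ) :
    HasDerivAt (fun s => G (t, x, u, s, q)) (dir (0, 0, 0, 1, 0) G (t, x, u, p, q)) p := by
  simpa using hG.hasDerivAt_comp_coords (hasDerivAt_const p t) (hasDerivAt_const p x)
    (hasDerivAt_const p u) (hasDerivAt_id p) (hasDerivAt_const p q)

lemma hasDerivAt_slice_q (hG : ContDiff ℝ (⊤ : ℕ∞) G) (t x u p q : ℝ) :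
    HasDerivAt (fun s => G (t, x, u, p, s)) (dir (0, 0, 0, 0, 1) G (t, x, u, p, q)) q := by
  simpa using hG.hasDerivAt_comp_coords (hasDerivAt_const q t) (hasDerivAt_const q x)
    (hasDerivAt_const q u) (hasDerivAt_const q p) (hasDerivAt_id q)

lemma eq_of_hasDerivAt_of_eq_zero {f g f' : ℝ → ℝ} (hf : ∀ s, HasDerivAt f (f' s) s)
    (hg : ∀ s, HasDerivAt g (f' s) s) (h₀ : f 0 = g 0) (s : ℝ) : f s = g s := by
  have hd : ∀ r, HasDerivAt (fun r => f r - g r) 0 r := fun r =>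
    ((hf r).sub (hg r)).congr_deriv (sub_self _)
  have := is_const_of_deriv_eq_zero (fun r => (hd r).differentiableAt) (fun r => (hd r).deriv) s 0
  simp only [h₀, sub_self] at this
  linarith

lemma dir_zero_fun {V : Type*} [NormedAddCommGroup V] [NormedSpace ℝ V] (e : V) :
    dir e (fun _ : V => (0 : ℝ)) = fun _ => 0 := by
  funext v; simp [dir]

lemma totalX_zero : totalX (fun _ => 0) = fun _ => 0 := by
  funext v; simp [totalX, dir_zero_fun]

lemma dir_u_totalX (hF : ContDiff ℝ (⊤ : ℕ∞) F) :
    dir (0, 0, 1, 0, 0) (totalX F) = totalX (dir (0, 0, 1, 0, 0) F) := by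
  funext ⟨t, x, u, p, q⟩
  refine (hasDerivAt_slice_u hF.totalX t x u p q).unique (HasDerivAt.congr_deriv
    (((hasDerivAt_slice_u (hF.smooth_dir (0, 1, 0, 0, 0)) t x u p q).add
    ((hasDerivAt_slice_u (hF.smooth_dir (0, 0, 1, 0, 0)) t x u p q).const_mul p)).add
    ((hasDerivAt_slice_u (hF.smooth_dir (0, 0, 0, 1, 0)) t x u p q).const_mul q)) ?_)
  simp only [totalX, dir_comm hF (0, 0, 1, 0, 0)]

lemma dir_p_totalX (hF : ContDiff ℝ (⊤ : ℕ∞) F) :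
    dir (0, 0, 0, 1, 0) (totalX F)
      = fun v => totalX (dir (0, 0, 0, 1, 0) F) v + dir (0, 0, 1, 0, 0) F v := by
  funext ⟨t, x, u, p, q⟩
  refine (hasDerivAt_slice_p hF.totalX t x u p q).unique (HasDerivAt.congr_deriv
    (((hasDerivAt_slice_p (hF.smooth_dir (0, 1, 0, 0, 0)) t x u p q).add
    ((hasDerivAt_id p).mul (hasDerivAt_slice_p (hF.smooth_dir (0, 0, 1, 0, 0)) t x u p q))).add
    ((hasDerivAt_slice_p (hF.smooth_dir (0, 0, 0, 1, 0)) t x u p q).const_mul q)) ?_)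
  simp only [totalX, dir_comm hF (0, 0, 0, 1, 0), id]
  ring

lemma dir_q_totalX (hF : ContDiff ℝ (⊤ : ℕ∞) F) :
    dir (0, 0, 0, 0, 1) (totalX F)
      = fun v => totalX (dir (0, 0, 0, 0, 1) F) v + dir (0, 0, 0, 1, 0) F v := by
  funext ⟨t, x, u, p, q⟩
  refine (hasDerivAt_slice_q hF.totalX t x u p q).unique (HasDerivAt.congr_deriv
    (((hasDerivAt_slice_q (hF.smooth_dir (0, 1, 0, 0, 0)) t x u p q).add
    ((hasDerivAt_slice_q (hF.smooth_dir (0, 0, 1, 0, 0)) t x u p q).const_mul p)).add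
    ((hasDerivAt_id q).mul (hasDerivAt_slice_q (hF.smooth_dir (0, 0, 0, 1, 0)) t x u p q))) ?_)
  simp only [totalX, dir_comm hF (0, 0, 0, 0, 1), id]
  ring

lemma eq_of_dir_pq_eq_zero (hG : ContDiff ℝ (⊤ : ℕ∞) G)
    (hp : dir (0, 0, 0, 1, 0) G = fun _ => 0) (hq : dir (0, 0, 0, 0, 1) G = fun _ => 0)
    (t x u p q : ℝ) : G (t, x, u, p, q) = G (t, x, u, 0, 0) := by
  have h1 := eq_of_hasDerivAt_of_eq_zero (hasDerivAt_slice_q hG t x u p)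
    (g := fun _ => G (t, x, u, p, 0)) (fun s => by simpa [hq] using hasDerivAt_const s _) rfl q
  have h2 := eq_of_hasDerivAt_of_eq_zero (fun p => hasDerivAt_slice_p hG t x u p 0)
    (g := fun _ => G (t, x, u, 0, 0)) (fun s => by simpa [hp] using hasDerivAt_const s _) rfl p
  exact h1.trans h2

lemma eq_of_dir_xu_eq_zero (hG : ContDiff ℝ (⊤ : ℕ∞) G)
    (hx : dir (0, 1, 0, 0, 0) G = fun _ => 0) (hu : dir (0, 0, 1, 0, 0) G = fun _ => 0)
    (t x u p q : ℝ) : G (t, x, u, p, q) = G (t, 0, 0, p, q) := by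
  have h1 := eq_of_hasDerivAt_of_eq_zero (fun u => hasDerivAt_slice_u hG t x u p q)
    (g := fun _ => G (t, x, 0, p, q)) (fun s => by simpa [hu] using hasDerivAt_const s _) rfl u
  have h2 := eq_of_hasDerivAt_of_eq_zero (fun x => hasDerivAt_slice_x hG t x 0 p q)
    (g := fun _ => G (t, 0, 0, p, q)) (fun s => by simpa [hx] using hasDerivAt_const s _) rfl x
  exact h1.trans h2

variable (hE : ∀ u, Smooth2 u → ∀ t x, eulerKdV n F u t x = 0)

include hE in
lemma euler_pointwise (hF : ContDiff ℝ (⊤ : ℕ∞) F) (t x u p q r : ℝ) :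
    -dir (1, 0, 0, 0, 0) F (t, x, u, p, q) - u ^ n * totalX F (t, x, u, p, q)
      - totalX (totalX (totalX F)) (t, x, u, p, q)
      - (dir (0, 0, 0, 0, 1) (totalX F) (t, x, u, p, q)
        + 2 * dir (0, 0, 0, 1, 0) F (t, x, u, p, q)) * r
      + u ^ n * p * dir (0, 0, 1, 0, 0) F (t, x, u, p, q)
      + (n * u ^ (n - 1) * p * p + u ^ n * q + r) * dir (0, 0, 0, 1, 0) F (t, x, u, p, q)
      + (n * ((n - 1 : ℕ) * u ^ (n - 1 - 1)) * p ^ 3 + 3 * (n * u ^ (n - 1) * p * q))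
        * dir (0, 0, 0, 0, 1) F (t, x, u, p, q) = 0 := by
  obtain ⟨w, hw, h0, h1, h2, h3, h4, h5⟩ := exists_prescribed_jet x u p q 0 r
  have h := euler_reduced hE hF hw t x
  have hd := (hasDerivAt_curveJet hF hw t x).deriv
  rw [deriv3_curveJet hF hw t x (dir_p_eq_deriv_dir_q hE hF hw t) h3, hd, deriv2_kdvSpatial hw,
    deriv_kdvSpatial hw] at h
  simp only [kdvSpatial, curveJet, h0, h1, h2, h3, h4, h5] at h
  linear_combination h

include hE in
lemma dir_p_eq_totalX_dir_q (hF : ContDiff ℝ (⊤ : ℕ∞) F) (t x u p q r : ℝ) :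
    dir (0, 0, 0, 1, 0) F (t, x, u, p, q) = totalX (dir (0, 0, 0, 0, 1) F) (t, x, u, p, q)
      + dir (0, 0, 0, 0, 1) (dir (0, 0, 0, 0, 1) F) (t, x, u, p, q) * r := by
  obtain ⟨w, hw, h0, h1, h2, h3, -, -⟩ := exists_prescribed_jet x u p q r 0
  have h := congrFun (dir_p_eq_deriv_dir_q hE hF hw t) x
  rw [(hasDerivAt_curveJet (hF.smooth_dir (0, 0, 0, 0, 1)) hw t x).deriv] at h
  simpa only [curveJet, h0, h1, h2, h3] using h.symm

include hE in
lemma dir_q_dir_q_eq_zero (hF : ContDiff ℝ (⊤ : ℕ∞) F) :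
    dir (0, 0, 0, 0, 1) (dir (0, 0, 0, 0, 1) F) = fun _ => 0 := by
  funext ⟨t, x, u, p, q⟩
  linarith [dir_p_eq_totalX_dir_q hE hF t x u p q 0, dir_p_eq_totalX_dir_q hE hF t x u p q 1]

include hE in
lemma totalX_dir_q (hF : ContDiff ℝ (⊤ : ℕ∞) F) :
    totalX (dir (0, 0, 0, 0, 1) F) = dir (0, 0, 0, 1, 0) F := by
  funext ⟨t, x, u, p, q⟩
  linarith [dir_p_eq_totalX_dir_q hE hF t x u p q 0]

include hE in
lemma dir_p_eq_zero (hF : ContDiff ℝ (⊤ : ℕ∞) F) : dir (0, 0, 0, 1, 0) F = fun _ => 0 := by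
  funext ⟨t, x, u, p, q⟩
  have h0 := euler_pointwise hE hF t x u p q 0
  have h1 := euler_pointwise hE hF t x u p q 1
  simp only [dir_q_totalX hF, totalX_dir_q hE hF] at h0 h1
  linarith

include hE in
lemma dir_q_eq_time_function (hF : ContDiff ℝ (⊤ : ℕ∞) F) (t x u p q : ℝ) :
    dir (0, 0, 0, 0, 1) F (t, x, u, p, q) = dir (0, 0, 0, 0, 1) F (t, 0, 0, 0, 0) := by
  have hA := hF.smooth_dir (0, 0, 0, 0, 1)
  set A := dir (0, 0, 0, 0, 1) F with hAdef
  have hp : dir (0, 0, 0, 1, 0) A = fun _ => 0 := by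
    funext v; rw [hAdef, dir_comm hF, dir_p_eq_zero hE hF, dir_zero_fun]
  have hq : dir (0, 0, 0, 0, 1) A = fun _ => 0 := dir_q_dir_q_eq_zero hE hF
  have hpq : ∀ e t x u p q, dir e A (t, x, u, p, q) = dir e A (t, x, u, 0, 0) := fun e =>
    eq_of_dir_pq_eq_zero (hA.smooth_dir e)
      (by funext v; rw [dir_comm hA, hp, dir_zero_fun])
      (by funext v; rw [dir_comm hA, hq, dir_zero_fun])
  have hX : ∀ t x u p, dir (0, 1, 0, 0, 0) A (t, x, u, 0, 0)
      + p * dir (0, 0, 1, 0, 0) A (t, x, u, 0, 0) = 0 := fun t x u p => by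
    have h := congrFun ((totalX_dir_q hE hF).trans (dir_p_eq_zero hE hF)) (t, x, u, p, 0)
    rw [← hAdef] at h
    simp only [totalX, hp, hpq _ t x u p 0] at h
    linarith
  have hx : dir (0, 1, 0, 0, 0) A = fun _ => 0 := by
    funext ⟨t, x, u, p, q⟩
    rw [hpq]
    linarith [hX t x u 0]
  have hu : dir (0, 0, 1, 0, 0) A = fun _ => 0 := by
    funext ⟨t, x, u, p, q⟩
    rw [hpq]
    linarith [hX t x u 0, hX t x u 1]
  rw [eq_of_dir_pq_eq_zero hA hp hq, eq_of_dir_xu_eq_zero hA hx hu]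

include hE in
lemma determining_xu (hF : ContDiff ℝ (⊤ : ℕ∞) F) (t x u p : ℝ) :
    -deriv (fun s => dir (0, 0, 0, 0, 1) F (s, 0, 0, 0, 0)) t
      - 3 * (dir (0, 1, 0, 0, 0) (dir (0, 0, 1, 0, 0) F) (t, x, u, 0, 0)
        + p * dir (0, 0, 1, 0, 0) (dir (0, 0, 1, 0, 0) F) (t, x, u, 0, 0))
      + 3 * (n * u ^ (n - 1) * p) * dir (0, 0, 0, 0, 1) F (t, 0, 0, 0, 0) = 0 := by
  have hA := hF.smooth_dir (0, 0, 0, 0, 1)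
  have hU := hF.smooth_dir (0, 0, 1, 0, 0)
  have hp := dir_p_eq_zero hE hF
  have hAt := dir_q_eq_time_function hE hF
  have hXA : totalX (dir (0, 0, 0, 0, 1) F) = fun _ => 0 := (totalX_dir_q hE hF).trans hp
  have hq1 : dir (0, 0, 0, 0, 1) (totalX F) = fun _ => 0 := by
    simp [dir_q_totalX hF, hXA, hp]
  have hp1 : dir (0, 0, 0, 1, 0) (totalX F) = dir (0, 0, 1, 0, 0) F := by
    simp [dir_p_totalX hF, hp, totalX_zero]
  have hq2 : dir (0, 0, 0, 0, 1) (totalX (totalX F)) = dir (0, 0, 1, 0, 0) F := by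
    simp [dir_q_totalX hF.totalX, hq1, hp1, totalX_zero]
  have hp2 : dir (0, 0, 0, 1, 0) (totalX (totalX F))
      = fun v => 2 * totalX (dir (0, 0, 1, 0, 0) F) v := by
    funext v
    simp only [dir_p_totalX hF.totalX, hp1, dir_u_totalX hF]
    ring
  have hq3 : dir (0, 0, 0, 0, 1) (totalX (totalX (totalX F)))
      = fun v => 3 * totalX (dir (0, 0, 1, 0, 0) F) v := by
    funext v
    simp only [dir_q_totalX hF.totalX.totalX, hq2, hp2]
    ring
  have hUp : ∀ e, dir (0, 0, 0, 1, 0) (dir e F) = fun _ => 0 := fun e => by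
    funext v; rw [dir_comm hF, hp, dir_zero_fun]
  have hUq : dir (0, 0, 0, 0, 1) (dir (0, 0, 1, 0, 0) F) = fun _ => 0 := by
    funext ⟨t, x, u, p, q⟩
    rw [dir_comm hF]
    refine (hasDerivAt_slice_u hA t x u p q).unique ?_
    simp only [hAt]
    exact hasDerivAt_const _ _
  have hUpq : ∀ e, dir e (dir (0, 0, 1, 0, 0) F) (t, x, u, p, 0)
      = dir e (dir (0, 0, 1, 0, 0) F) (t, x, u, 0, 0) := fun e =>
    eq_of_dir_pq_eq_zero (hU.smooth_dir e)
      (by funext v; rw [dir_comm hU, hUp, dir_zero_fun])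
      (by funext v; rw [dir_comm hU, hUq, dir_zero_fun]) t x u p 0
  have hTq : dir (0, 0, 0, 0, 1) (dir (1, 0, 0, 0, 0) F) (t, x, u, p, 0)
      = deriv (fun s => dir (0, 0, 0, 0, 1) F (s, 0, 0, 0, 0)) t := by
    rw [dir_comm hF, ← (hasDerivAt_slice_t hA t x u p 0).deriv]
    simp only [hAt]
  have hM := fun q => euler_pointwise hE hF t x u p q 0
  simp only [hp, hAt, mul_zero, sub_zero, add_zero] at hM
  have hd := (((((hasDerivAt_slice_q (hF.smooth_dir (1, 0, 0, 0, 0)) t x u p 0).neg.sub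
    ((hasDerivAt_slice_q hF.totalX t x u p 0).const_mul (u ^ n))).sub
    (hasDerivAt_slice_q hF.totalX.totalX.totalX t x u p 0)).add
    ((hasDerivAt_slice_q hU t x u p 0).const_mul (u ^ n * p))).add
    (((((hasDerivAt_id (0 : ℝ)).const_mul (n * u ^ (n - 1) * p)).const_mul 3).const_add
      (n * ((n - 1 : ℕ) * u ^ (n - 1 - 1)) * p ^ 3)).mul_const
      (dir (0, 0, 0, 0, 1) F (t, 0, 0, 0, 0))))
  have hz := hd.unique ((hasDerivAt_const (0 : ℝ) (0 : ℝ)).congr_of_eventuallyEq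
    (Filter.Eventually.of_forall hM))
  simp only [hq1, hq3, hUq, hTq, totalX, hUpq, hUp] at hz
  linear_combination hz

lemma totalX_slice_eq (hG : ContDiff ℝ (⊤ : ℕ∞) G) {t x u g' : ℝ} {g : ℝ → ℝ}
    (h : ∀ s, G (t, s, u, 0, 0) = g s) (hg : HasDerivAt g g' x) :
    totalX G (t, x, u, 0, 0) = g' := by
  have h1 := hasDerivAt_slice_x hG t x u 0 0
  simp only [h] at h1
  simp [totalX, h1.unique hg]

include hE in
/-- Solving all determining equations except the last one. -/
lemma multiplier_form (hn : 0 < n) (hF : ContDiff ℝ (⊤ : ℕ∞) F) : ∃ (a k : ℝ → ℝ) (d : ℝ → ℝ → ℝ),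
    ContDiff ℝ (⊤ : ℕ∞) a ∧ ContDiff ℝ (⊤ : ℕ∞) k ∧ Smooth2 d ∧
    (∀ t x u p q, F (t, x, u, p, q)
      = d t x + (k t - deriv a t / 3 * x) * u + a t * (q + u ^ (n + 1) / (n + 1))) ∧
    ∀ t x u, pdt d t x + (deriv k t - deriv (deriv a) t / 3 * x) * u
      + deriv a t * (u ^ (n + 1) / (n + 1)) + u ^ n * (pdx d t x - deriv a t / 3 * u)
      + pdx (pdx (pdx d)) t x = 0 := by
  have hA := hF.smooth_dir (0, 0, 0, 0, 1)
  have hU := hF.smooth_dir (0, 0, 1, 0, 0)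
  have hp := dir_p_eq_zero hE hF
  have hAt := dir_q_eq_time_function hE hF
  have hxu := determining_xu hE hF
  set a : ℝ → ℝ := fun t => dir (0, 0, 0, 0, 1) F (t, 0, 0, 0, 0) with ha_def
  set k : ℝ → ℝ := fun t => dir (0, 0, 1, 0, 0) F (t, 0, 0, 0, 0) with hk_def
  set d : ℝ → ℝ → ℝ := fun t x => F (t, x, 0, 0, 0) with hd_def
  have ha : ContDiff ℝ (⊤ : ℕ∞) a := hA.comp (contDiff_id.prodMk contDiff_const)
  have hk : ContDiff ℝ (⊤ : ℕ∞) k := hU.comp (contDiff_id.prodMk contDiff_const)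
  have hd : Smooth2 d := hF.comp (contDiff_fst.prodMk (contDiff_snd.prodMk contDiff_const))
  have hpow : ∀ u : ℝ, HasDerivAt (fun u : ℝ => u ^ (n + 1) / ((n : ℝ) + 1)) (u ^ n) u := fun u =>
    ((hasDerivAt_pow (n + 1) u).div_const ((n : ℝ) + 1)).congr_deriv (by
      have : (n : ℝ) + 1 ≠ 0 := by positivity
      push_cast
      field_simp)
  have hc : ∀ t x, dir (0, 0, 1, 0, 0) F (t, x, 0, 0, 0) = k t - deriv a t / 3 * x := fun t x =>
    eq_of_hasDerivAt_of_eq_zero (fun x => hasDerivAt_slice_x hU t x 0 0 0)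
      (g := fun x => k t - deriv a t / 3 * x)
      (fun s => (((hasDerivAt_id s).const_mul (deriv a t / 3)).const_sub (k t)).congr_deriv
        (by linarith [hxu t s 0 0])) (by simp [k]) x
  have hu : ∀ t x u, dir (0, 0, 1, 0, 0) F (t, x, u, 0, 0)
      = (k t - deriv a t / 3 * x) + a t * u ^ n - a t * 0 ^ n := fun t x u =>
    eq_of_hasDerivAt_of_eq_zero (fun u => hasDerivAt_slice_u hU t x u 0 0)
      (g := fun u => (k t - deriv a t / 3 * x) + a t * u ^ n - a t * 0 ^ n)
      (fun s => ((((hasDerivAt_pow n s).const_mul (a t)).const_add _).sub_const _).congr_deriv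
        (by linarith [hxu t x s 0, hxu t x s 1])) (by simp [hc]) u
  simp only [zero_pow hn.ne', mul_zero, sub_zero] at hu
  have hb : ∀ t x u, F (t, x, u, 0, 0)
      = d t x + (k t - deriv a t / 3 * x) * u + a t * (u ^ (n + 1) / (n + 1)) := fun t x u =>
    eq_of_hasDerivAt_of_eq_zero (fun u => hasDerivAt_slice_u hF t x u 0 0)
      (g := fun u => d t x + (k t - deriv a t / 3 * x) * u + a t * (u ^ (n + 1) / (n + 1)))
      (fun s => ((((hasDerivAt_id s).const_mul _).const_add _).add
        ((hpow s).const_mul (a t))).congr_deriv (by rw [hu, mul_one])) (by simp [d]) u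
  refine ⟨a, k, d, ha, hk, hd, fun t x u p q => ?_, fun t x u => ?_⟩
  · have h1 := eq_of_hasDerivAt_of_eq_zero (hasDerivAt_slice_q hF t x u p)
      (g := fun q => F (t, x, u, p, 0) + a t * q)
      (fun s => (((hasDerivAt_id s).const_mul (a t)).const_add _).congr_deriv
        (by rw [hAt, mul_one])) (by simp) q
    have h2 := eq_of_hasDerivAt_of_eq_zero (fun p => hasDerivAt_slice_p hF t x u p 0)
      (g := fun _ => F (t, x, u, 0, 0)) (fun s => by simpa [hp] using hasDerivAt_const s _) rfl p
    rw [h1, h2, hb]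
    ring
  · have hT := hasDerivAt_slice_t hF t x u 0 0
    simp only [hb] at hT
    have hT' := hT.unique (((hd.hasDerivAt_pdt t x).add
      (((hk.hasDerivAt_top t).sub
        (((ha.smooth_deriv.hasDerivAt_top t).div_const 3).mul_const x)).mul_const u)).add
      ((ha.hasDerivAt_top t).mul_const (u ^ (n + 1) / ((n : ℝ) + 1))))
    have hX1 : ∀ s, totalX F (t, s, u, 0, 0) = pdx d t s - deriv a t / 3 * u := fun s =>
      totalX_slice_eq hF (hb t · u) ((((hd.hasDerivAt_pdx t s).add
        ((((hasDerivAt_id s).const_mul (deriv a t / 3)).const_sub (k t)).mul_const u)).add_const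
        _).congr_deriv (by ring))
    have hX2 : ∀ s, totalX (totalX F) (t, s, u, 0, 0) = pdx (pdx d) t s := fun s =>
      totalX_slice_eq hF.totalX hX1 ((hd.pdx.hasDerivAt_pdx t s).sub_const _)
    have hX3 : totalX (totalX (totalX F)) (t, x, u, 0, 0) = pdx (pdx (pdx d)) t x :=
      totalX_slice_eq hF.totalX.totalX hX2 (hd.pdx.pdx.hasDerivAt_pdx t x)
    have h := euler_pointwise hE hF t x u 0 0 0
    rw [hT', hX1, hX3] at h
    linear_combination -h

end Determining

section Solving

variable {n : ℕ} {a k : ℝ → ℝ} {d : ℝ → ℝ → ℝ}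

lemma Smooth2.eq_of_pdt_eq_zero {f : ℝ → ℝ → ℝ} (hf : Smooth2 f) (h : ∀ t x, _root_.pdt f t x = 0)
    (t x : ℝ) : f t x = f 0 x :=
  eq_of_hasDerivAt_of_eq_zero (hf.hasDerivAt_pdt · x) (g := fun _ => f 0 x)
    (fun s => (hasDerivAt_const s _).congr_deriv (h s x).symm) rfl t

lemma Smooth2.eq_of_pdx_eq {f : ℝ → ℝ → ℝ} (hf : Smooth2 f) {c : ℝ → ℝ}
    (h : ∀ t x, _root_.pdx f t x = c t) (t x : ℝ) : f t x = f t 0 + c t * x :=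
  eq_of_hasDerivAt_of_eq_zero (hf.hasDerivAt_pdx t) (g := fun x => f t 0 + c t * x)
    (fun s => (((hasDerivAt_id s).const_mul (c t)).const_add _).congr_deriv (by simp [h]))
    (by simp) x

lemma ContDiff.eq_of_deriv_eq_const {f : ℝ → ℝ} (hf : ContDiff ℝ (⊤ : ℕ∞) f) {c : ℝ}
    (h : ∀ t, deriv f t = c) (t : ℝ) : f t = f 0 + c * t :=
  eq_of_hasDerivAt_of_eq_zero hf.hasDerivAt_top (g := fun t => f 0 + c * t)
    (fun s => (((hasDerivAt_id s).const_mul c).const_add _).congr_deriv (by simp [h])) (by simp) t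

lemma pdx_eq_zero_of_forall_eq {f : ℝ → ℝ → ℝ} {c : ℝ → ℝ} (h : ∀ t x, f t x = c t) (t x : ℝ) :
    pdx f t x = 0 := by
  simp [pdx, h]

variable (ha : ContDiff ℝ (⊤ : ℕ∞) a) (hk : ContDiff ℝ (⊤ : ℕ∞) k) (hd : Smooth2 d)
  (hP : ∀ t x u, pdt d t x + (deriv k t - deriv (deriv a) t / 3 * x) * u
      + deriv a t * (u ^ (n + 1) / (n + 1)) + u ^ n * (pdx d t x - deriv a t / 3 * u)
      + pdx (pdx (pdx d)) t x = 0)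

include hP in
lemma determining_homogeneous (hn : 0 < n) (t x u : ℝ) :
    (deriv k t - deriv (deriv a) t / 3 * x) * u + pdx d t x * u ^ n
      + deriv a t * (1 / (n + 1) - 1 / 3) * u ^ (n + 1) = 0 := by
  have h0 := hP t x 0
  rw [zero_pow hn.ne', zero_pow n.succ_ne_zero] at h0
  linear_combination hP t x u - h0

include hP in
lemma pdt_add_pdx_eq_zero (hn : 0 < n) (t x : ℝ) : pdt d t x + pdx (pdx (pdx d)) t x = 0 := by
  have h0 := hP t x 0
  rw [zero_pow hn.ne', zero_pow n.succ_ne_zero] at h0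
  linear_combination h0

include ha hk hd in
lemma solve_one (hP : ∀ t x u, pdt d t x + (deriv k t - deriv (deriv a) t / 3 * x) * u
      + deriv a t * (u ^ (1 + 1) / ((1 : ℕ) + 1)) + u ^ 1 * (pdx d t x - deriv a t / 3 * u)
      + pdx (pdx (pdx d)) t x = 0) :
    ∃ κ : ℝ, (∀ t, a t = a 0) ∧ (∀ t, deriv a t = 0) ∧ (∀ t, k t = k 0 + κ * t) ∧
      ∀ t x, d t x = d 0 0 - κ * x := by
  have hH := determining_homogeneous hP one_pos
  have hD := pdt_add_pdx_eq_zero hP one_pos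
  have ha' : ∀ t, deriv a t = 0 := fun t => by
    have h1 := hH t 0 1
    have h2 := hH t 0 (-1)
    norm_num at h1 h2
    linarith
  have ha'' : deriv a = fun _ => 0 := funext ha'
  have hx : ∀ t x, pdx d t x = -deriv k t := fun t x => by
    have h1 := hH t x 1
    simp only [ha'', deriv_const] at h1
    linarith
  have hx2 := pdx_eq_zero_of_forall_eq hx
  have ht : ∀ t x, pdt d t x = 0 := fun t x => by
    linarith [hD t x, pdx_eq_zero_of_forall_eq hx2 t x]
  have hdt := hd.eq_of_pdt_eq_zero ht
  have hk' : ∀ t, deriv k t = deriv k 0 := fun t => by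
    have h1 := hx t 0
    have h2 := hx 0 0
    simp only [pdx, hdt t] at h1 h2
    linarith
  refine ⟨deriv k 0, fun t => ?_, ha', hk.eq_of_deriv_eq_const hk', fun t x => ?_⟩
  · simpa using ha.eq_of_deriv_eq_const ha' t
  · rw [hdt, hd.eq_of_pdx_eq hx]
    ring

include hk hd hP in
lemma solve_of_two_le (hn : 2 ≤ n) : (∀ t, deriv (deriv a) t = 0) ∧ (∀ t, k t = k 0) ∧
    (∀ t x, d t x = d 0 0) ∧ (3 ≤ n → ∀ t, deriv a t = 0) := by
  have hn0 : 0 < n := by lia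
  have hH := determining_homogeneous hP hn0
  have hD := pdt_add_pdx_eq_zero hP hn0
  have hABC : ∀ t x, deriv k t - deriv (deriv a) t / 3 * x = 0 ∧ pdx d t x = 0 ∧
      deriv a t * (1 / ((n : ℝ) + 1) - 1 / 3) = 0 := fun t x => by
    have h1 := hH t x 1
    have h2 := hH t x (-1)
    have h3 := hH t x 2
    have h4 : (4 : ℝ) ≤ 2 ^ n := by
      calc (4 : ℝ) = 2 ^ 2 := by norm_num
        _ ≤ 2 ^ n := pow_le_pow_right₀ (by norm_num) hn
    generalize deriv a t * (1 / ((n : ℝ) + 1) - 1 / 3) = C at *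
    generalize deriv k t - deriv (deriv a) t / 3 * x = A at *
    generalize pdx d t x = B at *
    simp only [one_pow, mul_one] at h1
    rw [pow_succ] at h2 h3
    rcases n.even_or_odd with he | ho
    · rw [he.neg_one_pow] at h2
      have hB : B = 0 := by linarith
      have hA : A = -C := by linarith
      have hC : C * (2 * (2 ^ n - 1)) = 0 := by rw [hB, hA] at h3; linear_combination h3
      have hC0 : C = 0 := by
        rcases mul_eq_zero.1 hC with h | h
        · exact h
        · linarith
      exact ⟨by rw [hA, hC0, neg_zero], hB, hC0⟩
    · rw [ho.neg_one_pow] at h2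
      have hC : C = 0 := by linarith
      have hA : A = -B := by linarith
      have hB : B * (2 ^ n - 2) = 0 := by rw [hC, hA] at h3; linear_combination h3
      have hB0 : B = 0 := by
        rcases mul_eq_zero.1 hB with h | h
        · exact h
        · linarith
      exact ⟨by rw [hA, hB0, neg_zero], hB0, hC⟩
  have hx : ∀ t x, pdx d t x = (fun _ => 0 : ℝ → ℝ) t := fun t x => (hABC t x).2.1
  have hx2 := pdx_eq_zero_of_forall_eq hx
  have ht : ∀ t x, pdt d t x = 0 := fun t x => by
    linarith [hD t x, pdx_eq_zero_of_forall_eq hx2 t x]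
  refine ⟨fun t => ?_, fun t => ?_, fun t x => ?_, fun h3 t => ?_⟩
  · linarith [(hABC t 0).1, (hABC t 3).1]
  · simpa using hk.eq_of_deriv_eq_const (c := 0) (fun t => by linarith [(hABC t 0).1]) t
  · rw [hd.eq_of_pdt_eq_zero ht, hd.eq_of_pdx_eq hx]
    ring
  · rcases mul_eq_zero.1 (hABC t 0).2.2 with h | h
    · exact h
    · have h4 : (3 : ℝ) ≤ n := by exact_mod_cast h3
      have : 1 / ((n : ℝ) + 1) < 1 / 3 := one_div_lt_one_div_of_lt (by norm_num) (by linarith)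
      linarith

end Solving

section Fluxes

variable {n : ℕ} {Λ M : ℝ → ℝ → ℝ → ℝ → ℝ → ℝ}

lemma Smooth2.differentiableAt_flux_left {u : ℝ → ℝ → ℝ} (hu : Smooth2 u)
    {Φ : ℝ × ℝ × (JetIdx 4 → ℝ) → ℝ} (hΦ : ContDiff ℝ (⊤ : ℕ∞) Φ) (t x : ℝ) :
    DifferentiableAt ℝ (fun s => Φ (s, x, _root_.jet 4 u s x)) t := by
  have h : Smooth2 fun t x => Φ (t, x, _root_.jet 4 u t x) :=
    hΦ.comp (contDiff_fst.prodMk (contDiff_snd.prodMk (hu.jet 4)))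
  exact (h.hasDerivAt_pdt t x).differentiableAt

lemma Smooth2.differentiableAt_flux_right {u : ℝ → ℝ → ℝ} (hu : Smooth2 u)
    {Φ : ℝ × ℝ × (JetIdx 4 → ℝ) → ℝ} (hΦ : ContDiff ℝ (⊤ : ℕ∞) Φ) (t x : ℝ) :
    DifferentiableAt ℝ (fun y => Φ (t, y, _root_.jet 4 u t y)) x := by
  have h : Smooth2 fun t x => Φ (t, x, _root_.jet 4 u t x) :=
    hΦ.comp (contDiff_fst.prodMk (contDiff_snd.prodMk (hu.jet 4)))
  exact (h.hasDerivAt_pdx t x).differentiableAt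

lemma IsMultiplierKdV.add (hΛ : IsMultiplierKdV n Λ) (hM : IsMultiplierKdV n M) :
    IsMultiplierKdV n (fun t x u p q => Λ t x u p q + M t x u p q) := by
  obtain ⟨Φt, Φx, ht, hx, h⟩ := hΛ
  obtain ⟨Ψt, Ψx, kt, kx, k⟩ := hM
  refine ⟨fun v => Φt v + Ψt v, fun v => Φx v + Ψx v, ht.add kt, hx.add kx, fun u hu t x => ?_⟩
  beta_reduce
  rw [deriv_fun_add (hu.differentiableAt_flux_left ht t x) (hu.differentiableAt_flux_left kt t x),
    deriv_fun_add (hu.differentiableAt_flux_right hx t x) (hu.differentiableAt_flux_right kx t x)]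
  linear_combination h u hu t x + k u hu t x

lemma IsMultiplierKdV.const_mul (hΛ : IsMultiplierKdV n Λ) (c : ℝ) :
    IsMultiplierKdV n (fun t x u p q => c * Λ t x u p q) := by
  obtain ⟨Φt, Φx, ht, hx, h⟩ := hΛ
  refine ⟨fun v => c * Φt v, fun v => c * Φx v, contDiff_const.mul ht, contDiff_const.mul hx,
    fun u hu t x => ?_⟩
  beta_reduce
  rw [deriv_const_mul _ (hu.differentiableAt_flux_left ht t x),
    deriv_const_mul _ (hu.differentiableAt_flux_right hx t x)]
  linear_combination c * h u hu t x

/-- Fluxes depending on `t`, `x`, `u`, `u_t`, `u_x`, `u_xx` only. -/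
lemma isMultiplierKdV_of_fluxes {T X : ℝ → ℝ → ℝ → ℝ → ℝ → ℝ → ℝ}
    (hT : ContDiff ℝ (⊤ : ℕ∞) fun v : ℝ × ℝ × ℝ × ℝ × ℝ × ℝ =>
      T v.1 v.2.1 v.2.2.1 v.2.2.2.1 v.2.2.2.2.1 v.2.2.2.2.2)
    (hX : ContDiff ℝ (⊤ : ℕ∞) fun v : ℝ × ℝ × ℝ × ℝ × ℝ × ℝ =>
      X v.1 v.2.1 v.2.2.1 v.2.2.2.1 v.2.2.2.2.1 v.2.2.2.2.2)
    (h : ∀ u, Smooth2 u → ∀ t x, ∃ T' X' : ℝ,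
      HasDerivAt (fun s => T s x (u s x) (pdt u s x) (pdx u s x) (pdx (pdx u) s x)) T' t ∧
      HasDerivAt (fun y => X t y (u t y) (pdt u t y) (pdx u t y) (pdx (pdx u) t y)) X' x ∧
      (pdt u t x + u t x ^ n * pdx u t x + pdx (pdx (pdx u)) t x) *
        Λ t x (u t x) (pdx u t x) (pdx (pdx u) t x) = T' + X') : IsMultiplierKdV n Λ := by
  let J : ℝ × ℝ × (JetIdx 4 → ℝ) → ℝ × ℝ × ℝ × ℝ × ℝ × ℝ := fun v =>
    (v.1, v.2.1, v.2.2 ⟨(0, 0), by decide⟩, v.2.2 ⟨(1, 0), by decide⟩, v.2.2 ⟨(0, 1), by decide⟩,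
      v.2.2 ⟨(0, 2), by decide⟩)
  have hJ : ContDiff ℝ (⊤ : ℕ∞) J := by
    have hj : ∀ i, ContDiff ℝ (⊤ : ℕ∞) fun v : ℝ × ℝ × (JetIdx 4 → ℝ) => v.2.2 i := fun i =>
      (contDiff_apply ℝ ℝ i).comp (contDiff_snd.comp contDiff_snd)
    exact contDiff_fst.prodMk ((contDiff_fst.comp contDiff_snd).prodMk ((hj _).prodMk
      ((hj _).prodMk ((hj _).prodMk (hj _)))))
  refine ⟨_, _, hT.comp hJ, hX.comp hJ, fun u hu t x => ?_⟩
  obtain ⟨T', X', h1, h2, h3⟩ := h u hu t x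
  exact h3.trans (congrArg₂ (· + ·) h1.deriv.symm h2.deriv.symm)

lemma hasDerivAt_pow_comp {f : ℝ → ℝ} {f' s : ℝ} (hf : HasDerivAt f f' s) (n : ℕ) :
    HasDerivAt (fun r => f r ^ (n + 1) / ((n : ℝ) + 1)) (f s ^ n * f') s :=
  ((hf.pow (n + 1)).div_const ((n : ℝ) + 1)).congr_deriv (by
    have : (n : ℝ) + 1 ≠ 0 := by positivity
    push_cast
    field_simp)

lemma isMultiplierKdV_one : IsMultiplierKdV n (fun _ _ _ _ _ => 1) :=
  isMultiplierKdV_of_fluxes (T := fun _ _ u _ _ _ => u)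
    (X := fun _ _ u _ _ q => u ^ (n + 1) / ((n : ℝ) + 1) + q) (by fun_prop) (by fun_prop)
    fun u hu t x => ⟨_, _, hu.hasDerivAt_pdt t x, (hasDerivAt_pow_comp (hu.hasDerivAt_pdx t x) n).add
      (hu.pdx.pdx.hasDerivAt_pdx t x), by ring⟩

lemma isMultiplierKdV_u : IsMultiplierKdV n (fun _ _ u _ _ => u) :=
  isMultiplierKdV_of_fluxes (T := fun _ _ u _ _ _ => u * u / 2)
    (X := fun _ _ u _ p q => u ^ (n + 1 + 1) / (((n + 1 : ℕ) : ℝ) + 1) + u * q - p * p / 2)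
    (by fun_prop) (by fun_prop) fun u hu t x => by
    have h0 := hu.hasDerivAt_pdt t x
    have h1 := hu.hasDerivAt_pdx t x
    have h2 := hu.pdx.hasDerivAt_pdx t x
    have h3 := hu.pdx.pdx.hasDerivAt_pdx t x
    exact ⟨_, _, (h0.mul h0).div_const 2, ((hasDerivAt_pow_comp h1 (n + 1)).add (h1.mul h3)).sub
      ((h2.mul h2).div_const 2), by ring⟩

lemma isMultiplierKdV_energy :
    IsMultiplierKdV n (fun _ _ u _ q => q + u ^ (n + 1) / ((n : ℝ) + 1)) :=
  isMultiplierKdV_of_fluxes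
    (T := fun _ _ u _ p _ => u ^ (n + 1 + 1) / (((n + 1 : ℕ) : ℝ) + 1) / ((n : ℝ) + 1) - p * p / 2)
    (X := fun _ _ u r p q => r * p
      + (q + u ^ (n + 1) / ((n : ℝ) + 1)) * (q + u ^ (n + 1) / ((n : ℝ) + 1)) / 2)
    (by fun_prop) (by fun_prop) fun u hu t x => by
    have h0 := hu.hasDerivAt_pdt t x
    have h0x := hu.pdx.hasDerivAt_pdt t x
    have h1 := hu.hasDerivAt_pdx t x
    have h1t := hu.pdt.hasDerivAt_pdx t x
    have h2 := hu.pdx.hasDerivAt_pdx t x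
    have h3 := (hu.pdx.pdx.hasDerivAt_pdx t x).add (hasDerivAt_pow_comp h1 n)
    refine ⟨_, _, ((hasDerivAt_pow_comp h0 (n + 1)).div_const _).sub ((h0x.mul h0x).div_const 2),
      (h1t.mul h2).add ((h3.mul h3).div_const 2), ?_⟩
    simp only [Pi.add_apply]
    rw [hu.pdt_pdx]
    ring

lemma isMultiplierKdV_galilean : IsMultiplierKdV 1 (fun t x u _ _ => t * u - x) :=
  isMultiplierKdV_of_fluxes (T := fun t x u _ _ _ => t * (u * u / 2) - x * u)
    (X := fun t x u _ p q => t * (u ^ (2 + 1) / ((2 : ℕ) + 1) + u * q - p * p / 2)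
      - x * (u * u / 2 + q) + p) (by fun_prop) (by fun_prop) fun u hu t x => by
    have h0 := hu.hasDerivAt_pdt t x
    have h1 := hu.hasDerivAt_pdx t x
    have h2 := hu.pdx.hasDerivAt_pdx t x
    have h3 := hu.pdx.pdx.hasDerivAt_pdx t x
    exact ⟨_, _, ((hasDerivAt_id t).mul ((h0.mul h0).div_const 2)).sub (h0.const_mul x),
      (((((hasDerivAt_pow_comp h1 2).add (h1.mul h3)).sub ((h2.mul h2).div_const 2)).const_mul
        t).sub ((hasDerivAt_id x).mul (((h1.mul h1).div_const 2).add h3))).add h2, by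
      simp
      ring⟩

lemma isMultiplierKdV_scaling :
    IsMultiplierKdV 2 (fun t x u _ q => t * (q + u ^ 3 / 3) - x * u / 3) :=
  isMultiplierKdV_of_fluxes
    (T := fun t x u _ p _ => t * (u ^ (3 + 1) / ((3 : ℕ) + 1) / 3 - p * p / 2) - x / 3 * (u * u / 2))
    (X := fun t x u r p q => t * (r * p
      + (q + u ^ (2 + 1) / ((2 : ℕ) + 1)) * (q + u ^ (2 + 1) / ((2 : ℕ) + 1)) / 2)
      - x / 3 * (u ^ (3 + 1) / ((3 : ℕ) + 1) + u * q - p * p / 2) + u * p / 3)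
    (by fun_prop) (by fun_prop) fun u hu t x => by
    have h0 := hu.hasDerivAt_pdt t x
    have h0x := hu.pdx.hasDerivAt_pdt t x
    have h1 := hu.hasDerivAt_pdx t x
    have h1t := hu.pdt.hasDerivAt_pdx t x
    have h2 := hu.pdx.hasDerivAt_pdx t x
    have h3 := hu.pdx.pdx.hasDerivAt_pdx t x
    have h4 := h3.add (hasDerivAt_pow_comp h1 2)
    refine ⟨_, _, ((hasDerivAt_id t).mul (((hasDerivAt_pow_comp h0 3).div_const 3).sub
        ((h0x.mul h0x).div_const 2))).sub (((h0.mul h0).div_const 2).const_mul (x / 3)),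
      ((((h1t.mul h2).add ((h4.mul h4).div_const 2)).const_mul t).sub
        (((hasDerivAt_id x).div_const 3).mul (((hasDerivAt_pow_comp h1 3).add (h1.mul h3)).sub
        ((h2.mul h2).div_const 2)))).add ((h1.mul h2).div_const 3), ?_⟩
    simp only [Pi.add_apply, Pi.sub_apply, Pi.mul_apply, id]
    rw [hu.pdt_pdx]
    push_cast
    ring

end Fluxes

/-- Classification of all conservation-law multipliers `Λ(t,x,u,u_x,u_xx)` of
the generalized KdV equation `u_t + uⁿ u_x + u_xxx = 0` for every `n > 0`. -/
theorem gKdV_multiplier_classification (n : ℕ) (hn : 0 < n)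
    (Λ : ℝ → ℝ → ℝ → ℝ → ℝ → ℝ) (hΛ : Smooth5 Λ) :
    IsMultiplierKdV n Λ ↔
      ((n = 1 ∧ ∃ c₁ c₂ c₃ c₄ : ℝ, ∀ t x u p q : ℝ,
          Λ t x u p q = c₁ + c₂ * u + c₃ * (q + u ^ 2 / 2) + c₄ * (t * u - x)) ∨
       (n = 2 ∧ ∃ c₁ c₂ c₃ c₄ : ℝ, ∀ t x u p q : ℝ,
          Λ t x u p q = c₁ + c₂ * u + c₃ * (q + u ^ 3 / 3)
            + c₄ * (t * (q + u ^ 3 / 3) - x * u / 3)) ∨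
       (3 ≤ n ∧ ∃ c₁ c₂ c₃ : ℝ, ∀ t x u p q : ℝ,
          Λ t x u p q = c₁ + c₂ * u + c₃ * (q + u ^ (n + 1) / ((n : ℝ) + 1)))) := by

  constructor
  · intro hM
    have hF : ContDiff ℝ (⊤ : ℕ∞) (fun v : ℝ × ℝ × ℝ × ℝ × ℝ =>
      Λ v.1 v.2.1 v.2.2.1 v.2.2.2.1 v.2.2.2.2) := hΛ
    obtain ⟨a, k, d, ha, hk, hd, hform, hP⟩ := multiplier_form
      (fun u hu t x => eulerKdV_eq_zero hΛ hM hu t x) hn hF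
    simp only at hform
    obtain rfl | h2 : n = 1 ∨ 2 ≤ n := by lia
    · obtain ⟨κ, hA, hA', hK, hD⟩ := solve_one ha hk hd hP
      refine .inl ⟨rfl, d 0 0, k 0, a 0, κ, fun t x u p q => ?_⟩
      rw [hform, hA, hA', hK, hD]
      push_cast
      ring
    · obtain ⟨hA'', hK, hD, hA'⟩ := solve_of_two_le hk hd hP h2
      obtain rfl | h3 : n = 2 ∨ 3 ≤ n := by lia
      · have hda := fun t => (ha.smooth_deriv.eq_of_deriv_eq_const hA'' t)
        simp only [zero_mul, add_zero] at hda
        refine .inr (.inl ⟨rfl, d 0 0, k 0, a 0, deriv a 0, fun t x u p q => ?_⟩)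
        rw [hform, ha.eq_of_deriv_eq_const hda, hda, hK, hD]
        push_cast
        ring
      · refine .inr (.inr ⟨h3, d 0 0, k 0, a 0, fun t x u p q => ?_⟩)
        rw [hform, ha.eq_of_deriv_eq_const (hA' h3), hA' h3, hK, hD]
        ring
  · have hbase : ∀ c₁ c₂ c₃ : ℝ, IsMultiplierKdV n
        (fun _ _ u _ q => c₁ * 1 + c₂ * u + c₃ * (q + u ^ (n + 1) / ((n : ℝ) + 1))) :=
      fun c₁ c₂ c₃ => ((isMultiplierKdV_one.const_mul c₁).add (isMultiplierKdV_u.const_mul c₂)).add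
        (isMultiplierKdV_energy.const_mul c₃)
    rintro (⟨rfl, c₁, c₂, c₃, c₄, h⟩ | ⟨rfl, c₁, c₂, c₃, c₄, h⟩ | ⟨-, c₁, c₂, c₃, h⟩)
    · convert (hbase c₁ c₂ c₃).add (isMultiplierKdV_galilean.const_mul c₄) using 1
      funext t x u p q
      rw [h]
      push_cast
      ring
    · convert (hbase c₁ c₂ c₃).add (isMultiplierKdV_scaling.const_mul c₄) using 1
      funext t x u p q
      rw [h]
      push_cast
      ring
    · convert hbase c₁ c₂ c₃ using 1
      funext t x u p q
      rw [h]
      ring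
end
end

section
/- Let c: ℝ → ℝ be smooth and positive, and assume that the function u ↦ c'(u)·c(u)^{-3/2} is not constant. Then a smooth function Λ(t,x,u,u_t,u_x) is a conservation-law multiplier for the wave equation u_tt = c(u)(c(u)u_x)_x if and only if Λ is a real linear combination of u_t, u_x, and t·u_t + x·u_x. -/
/-!
For generic wave speed c(u) (with c'·c^{-3/2} non-constant), the only first-order
conservation-law multipliers Λ(t,x,u,u_t,u_x) of u_tt = c(u)(c(u)u_x)_x are the
linear combinations of u_t, u_x and t·u_t + x·u_x.
-/

noncomputable section

/-- `Λ(t,x,u,u_t,u_x)` is a conservation-law multiplier for the nonlinear wave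
equation `u_tt = c(u)(c(u)u_x)_x = c(u)²u_xx + c(u)c'(u)u_x²`:  there are smooth
fluxes `Φᵗ, Φˣ`, depending on `t`, `x` and the partial derivatives of `u` of
total order at most `3`, such that
`(u_tt − c(u)²u_xx − c(u)c'(u)u_x²)·Λ = D_t Φᵗ + D_x Φˣ`
holds pointwise for every smooth `u : ℝ² → ℝ`. -/
def IsMultiplierWave (c : ℝ → ℝ) (Λ : ℝ → ℝ → ℝ → ℝ → ℝ → ℝ) : Prop :=
  ∃ Φt Φx : ℝ × ℝ × (JetIdx 3 → ℝ) → ℝ,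
    ContDiff ℝ (⊤ : ℕ∞) Φt ∧ ContDiff ℝ (⊤ : ℕ∞) Φx ∧
    ∀ u : ℝ → ℝ → ℝ, Smooth2 u → ∀ t x : ℝ,
      (pd 2 0 u t x - (c (u t x)) ^ 2 * pd 0 2 u t x
          - c (u t x) * deriv c (u t x) * (pd 0 1 u t x) ^ 2) *
          Λ t x (u t x) (pd 1 0 u t x) (pd 0 1 u t x)
        = deriv (fun s => Φt (s, x, jet 3 u s x)) t
          + deriv (fun y => Φx (t, y, jet 3 u t y)) x

open MeasureTheory Set Filter Topology

/-- The derivative of `f` in the direction `e`, as a function of the base point. -/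
def dirDeriv {E : Type*} [NormedAddCommGroup E] [NormedSpace ℝ E] (e : E) (f : E → ℝ) : E → ℝ :=
  fun p => fderiv ℝ f p e

/-- If a smooth family of functions supported in a fixed compact set has constant integral, then
the integral of its parameter derivative vanishes. -/
theorem integral_eq_zero_of_hasDerivAt_of_integral_eq_zero
    {E : Type*} [NormedAddCommGroup E] [MeasurableSpace E] [BorelSpace E]
    [SecondCountableTopology E]
    (μ : Measure E) [IsFiniteMeasureOnCompacts μ] {H H' : ℝ → E → ℝ}
    (hH : Continuous (fun q : ℝ × E => H q.1 q.2)) (hH' : Continuous (fun q : ℝ × E => H' q.1 q.2))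
    (hd : ∀ r p, HasDerivAt (fun s => H s p) (H' r p) r)
    {K : Set E} (hK : IsCompact K) (hsupp : ∀ r, ∀ p ∉ K, H r p = 0)
    (hint : ∀ r, ∫ p, H r p ∂μ = 0) : ∫ p, H' 0 p ∂μ = 0 := by
  have hsupp' : ∀ r, ∀ p ∉ K, H' r p = 0 := by
    intro r p hp
    have h := hd r p
    simp only [hsupp _ p hp] at h
    exact h.unique (hasDerivAt_const r (0 : ℝ))
  obtain ⟨M, hM⟩ := ((isCompact_Icc (a := (-1 : ℝ)) (b := 1)).prod hK).exists_bound_of_continuousOn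
    hH'.continuousOn
  have key := hasDerivAt_integral_of_dominated_loc_of_deriv_le (μ := μ) (F := H) (F' := H')
    (x₀ := (0 : ℝ)) (s := Icc (-1) 1) (bound := K.indicator fun _ => M)
    (Icc_mem_nhds (by norm_num) (by norm_num))
    (Eventually.of_forall fun r =>
      (hH.comp (Continuous.prodMk_right r)).aestronglyMeasurable)
    ((hH.comp (Continuous.prodMk_right (0 : ℝ))).integrable_of_hasCompactSupport
      (HasCompactSupport.intro hK (hsupp 0)))
    (hH'.comp (Continuous.prodMk_right (0 : ℝ))).aestronglyMeasurable
    (Eventually.of_forall fun p r hr => by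
      by_cases hp : p ∈ K
      · simpa [hp] using hM (r, p) ⟨hr, hp⟩
      · simp [hp, hsupp' r p hp])
    ((integrable_indicator_iff hK.measurableSet).2
      (integrableOn_const hK.measure_lt_top.ne))
    (Eventually.of_forall fun p r _ => hd r p)
  have h := key.2
  simp only [hint] at h
  exact h.unique (hasDerivAt_const (0 : ℝ) (0 : ℝ))

section DirDeriv

variable {E : Type*} [NormedAddCommGroup E] [NormedSpace ℝ E] {e e' : E} {f g : E → ℝ}

theorem ContDiff.dirDeriv (hf : ContDiff ℝ (⊤ : ℕ∞) f) (e : E) :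
    ContDiff ℝ (⊤ : ℕ∞) (dirDeriv e f) :=
  (hf.fderiv_right (m := (⊤ : ℕ∞)) (by simp)).clm_apply contDiff_const

theorem ContDiff.differentiable_of_top (hf : ContDiff ℝ (⊤ : ℕ∞) f) : Differentiable ℝ f :=
  hf.differentiable (by simp)

theorem ContDiff.hasDerivAt_of_top {h : ℝ → ℝ} (hh : ContDiff ℝ (⊤ : ℕ∞) h) (s : ℝ) :
    HasDerivAt h (deriv h s) s :=
  (hh.differentiable_of_top s).hasDerivAt

theorem dirDeriv_comm (hf : ContDiff ℝ (⊤ : ℕ∞) f) (e e' : E) :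
    dirDeriv e (dirDeriv e' f) = dirDeriv e' (dirDeriv e f) := by
  have hd : Differentiable ℝ (fderiv ℝ f) :=
    (hf.fderiv_right (m := (⊤ : ℕ∞)) (by simp)).differentiable (by simp)
  have key (a b : E) (p : E) :
      dirDeriv a (dirDeriv b f) p = fderiv ℝ (fderiv ℝ f) p a b := by
    unfold dirDeriv
    rw [fderiv_clm_apply (hd p) (differentiableAt_const _)]
    simp
  funext p
  rw [key, key]
  exact (hf.contDiffAt.isSymmSndFDerivAt
    (by simpa using WithTop.coe_le_coe.2 (le_top (a := (2 : ℕ∞))))) e e'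

theorem tsupport_dirDeriv_subset (e : E) (f : E → ℝ) : tsupport (dirDeriv e f) ⊆ tsupport f :=
  tsupport_fderiv_apply_subset ℝ e

theorem HasCompactSupport.dirDeriv (hf : HasCompactSupport f) (e : E) :
    HasCompactSupport (dirDeriv e f) :=
  hf.of_isClosed_subset (isClosed_tsupport _) (tsupport_dirDeriv_subset e f)

theorem dirDeriv_add_const_mul (hf : Differentiable ℝ f) (hg : Differentiable ℝ g)
    (e : E) (k : ℝ) :
    dirDeriv e (fun p => f p + k * g p) = fun p => dirDeriv e f p + k * dirDeriv e g p := by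
  funext p
  have h := (hf p).hasFDerivAt.add ((hg p).hasFDerivAt.const_mul k)
  have h' : fderiv ℝ (fun p => f p + k * g p) p = _ := h.fderiv
  simp [dirDeriv, h']

variable [FiniteDimensional ℝ E] [MeasurableSpace E] [BorelSpace E]
  (μ : Measure E) [μ.IsAddHaarMeasure]

theorem integral_dirDeriv_mul (hf : ContDiff ℝ (⊤ : ℕ∞) f) (hg : ContDiff ℝ (⊤ : ℕ∞) g)
    (hfs : HasCompactSupport f) (e : E) :
    ∫ p, dirDeriv e f p * g p ∂μ = -∫ p, f p * dirDeriv e g p ∂μ := by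
  have h := integral_mul_fderiv_eq_neg_fderiv_mul_of_integrable (μ := μ) (f := f) (g := g) (v := e)
    (((hf.dirDeriv e).continuous.mul hg.continuous).integrable_of_hasCompactSupport
      ((hfs.dirDeriv e).mul_right))
    ((hf.continuous.mul (hg.dirDeriv e).continuous).integrable_of_hasCompactSupport
      hfs.mul_right)
    ((hf.continuous.mul hg.continuous).integrable_of_hasCompactSupport hfs.mul_right)
    (fun p _ => hf.differentiable_of_top p) (fun p _ => hg.differentiable_of_top p)
  unfold dirDeriv
  rw [h, neg_neg]

theorem integral_dirDeriv_eq_zero (hf : ContDiff ℝ (⊤ : ℕ∞) f) (hfs : HasCompactSupport f)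
    (e : E) : ∫ p, dirDeriv e f p ∂μ = 0 := by
  have h := integral_dirDeriv_mul μ hf (contDiff_const (c := (1 : ℝ))) hfs e
  have h1 : dirDeriv e (fun _ : E => (1 : ℝ)) = fun _ => 0 := by
    funext p; simp [dirDeriv]
  simpa [h1] using h

theorem eq_zero_of_integral_contDiff_mul_eq_zero (hf : Continuous f)
    (h : ∀ φ : E → ℝ, ContDiff ℝ (⊤ : ℕ∞) φ → HasCompactSupport φ → ∫ p, φ p * f p ∂μ = 0) :
    f = 0 := by
  refine (Continuous.ae_eq_iff_eq μ hf continuous_const).1 ?_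
  exact ae_eq_zero_of_integral_contDiff_smul_eq_zero hf.locallyIntegrable
    (fun φ hφ hs => by simpa using h φ hφ hs)

end DirDeriv

/-- The partial derivative in `t` of a function on the `(t, x)`-plane. -/
abbrev tDeriv (f : ℝ × ℝ → ℝ) : ℝ × ℝ → ℝ := dirDeriv ((1 : ℝ), (0 : ℝ)) f

/-- The partial derivative in `x` of a function on the `(t, x)`-plane. -/
abbrev xDeriv (f : ℝ × ℝ → ℝ) : ℝ × ℝ → ℝ := dirDeriv ((0 : ℝ), (1 : ℝ)) f

section Plane

variable {f g : ℝ × ℝ → ℝ}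

theorem hasDerivAt_mk_left (x s : ℝ) : HasDerivAt (fun r : ℝ => (r, x)) ((1 : ℝ), (0 : ℝ)) s :=
  (hasDerivAt_id s).prodMk (hasDerivAt_const s x)

theorem hasDerivAt_mk_right (t s : ℝ) : HasDerivAt (fun r : ℝ => (t, r)) ((0 : ℝ), (1 : ℝ)) s :=
  (hasDerivAt_const s t).prodMk (hasDerivAt_id s)

theorem hasDerivAt_tDeriv (hf : Differentiable ℝ f) (t x : ℝ) :
    HasDerivAt (fun s => f (s, x)) (tDeriv f (t, x)) t :=
  (hf (t, x)).hasFDerivAt.comp_hasDerivAt t (hasDerivAt_mk_left x t)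

theorem hasDerivAt_xDeriv (hf : Differentiable ℝ f) (t x : ℝ) :
    HasDerivAt (fun y => f (t, y)) (xDeriv f (t, x)) x :=
  (hf (t, x)).hasFDerivAt.comp_hasDerivAt x (hasDerivAt_mk_right t x)

theorem tDeriv_eq_of_hasDerivAt (hf : Differentiable ℝ f) {t x d : ℝ}
    (h : HasDerivAt (fun s => f (s, x)) d t) : tDeriv f (t, x) = d :=
  (hasDerivAt_tDeriv hf t x).unique h

theorem xDeriv_eq_of_hasDerivAt (hf : Differentiable ℝ f) {t x d : ℝ}
    (h : HasDerivAt (fun y => f (t, y)) d x) : xDeriv f (t, x) = d :=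
  (hasDerivAt_xDeriv hf t x).unique h

/-- The mixed partial derivative `∂ₜⁱ∂ₓʲ f` of a function on the plane. -/
def mixedDeriv (i j : ℕ) (f : ℝ × ℝ → ℝ) : ℝ × ℝ → ℝ := tDeriv^[i] (xDeriv^[j] f)

theorem contDiff_iterate_dirDeriv (e : ℝ × ℝ) (n : ℕ) (hf : ContDiff ℝ (⊤ : ℕ∞) f) :
    ContDiff ℝ (⊤ : ℕ∞) ((dirDeriv e)^[n] f) := by
  induction n with
  | zero => exact hf
  | succ n ih => rw [Function.iterate_succ_apply']; exact ih.dirDeriv e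

theorem ContDiff.mixedDeriv (hf : ContDiff ℝ (⊤ : ℕ∞) f) (i j : ℕ) :
    ContDiff ℝ (⊤ : ℕ∞) (mixedDeriv i j f) :=
  contDiff_iterate_dirDeriv _ _ (contDiff_iterate_dirDeriv _ _ hf)

theorem iterate_dirDeriv_add_const_mul (e : ℝ × ℝ) (n : ℕ) (hf : ContDiff ℝ (⊤ : ℕ∞) f)
    (hg : ContDiff ℝ (⊤ : ℕ∞) g) (k : ℝ) :
    (dirDeriv e)^[n] (fun p => f p + k * g p) =
      fun p => (dirDeriv e)^[n] f p + k * (dirDeriv e)^[n] g p := by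
  induction n with
  | zero => rfl
  | succ n ih =>
    simp only [Function.iterate_succ_apply', ih]
    exact dirDeriv_add_const_mul (contDiff_iterate_dirDeriv e n hf).differentiable_of_top
      (contDiff_iterate_dirDeriv e n hg).differentiable_of_top e k

theorem mixedDeriv_add_const_mul (i j : ℕ) (hf : ContDiff ℝ (⊤ : ℕ∞) f)
    (hg : ContDiff ℝ (⊤ : ℕ∞) g) (k : ℝ) :
    mixedDeriv i j (fun p => f p + k * g p) =
      fun p => mixedDeriv i j f p + k * mixedDeriv i j g p := by
  unfold mixedDeriv
  rw [iterate_dirDeriv_add_const_mul _ j hf hg k]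
  exact iterate_dirDeriv_add_const_mul _ i (contDiff_iterate_dirDeriv _ j hf)
    (contDiff_iterate_dirDeriv _ j hg) k

theorem tsupport_iterate_dirDeriv_subset (e : ℝ × ℝ) (n : ℕ) (f : ℝ × ℝ → ℝ) :
    tsupport ((dirDeriv e)^[n] f) ⊆ tsupport f := by
  induction n with
  | zero => exact subset_rfl
  | succ n ih =>
    rw [Function.iterate_succ_apply']
    exact (tsupport_dirDeriv_subset e _).trans ih

theorem tsupport_mixedDeriv_subset (i j : ℕ) (f : ℝ × ℝ → ℝ) :
    tsupport (mixedDeriv i j f) ⊆ tsupport f :=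
  (tsupport_iterate_dirDeriv_subset _ i _).trans (tsupport_iterate_dirDeriv_subset _ j f)

theorem pd_eq_mixedDeriv (i j : ℕ) (hf : ContDiff ℝ (⊤ : ℕ∞) f) :
    pd i j (fun t x => f (t, x)) = fun t x => mixedDeriv i j f (t, x) := by
  have hx : pdx^[j] (fun t x => f (t, x)) = fun t x => xDeriv^[j] f (t, x) := by
    induction j with
    | zero => rfl
    | succ n ih =>
      rw [Function.iterate_succ_apply', ih, Function.iterate_succ_apply']
      funext t x
      exact (hasDerivAt_xDeriv
        (contDiff_iterate_dirDeriv _ n hf).differentiable_of_top t x).deriv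
  unfold pd mixedDeriv
  rw [hx]
  induction i with
  | zero => rfl
  | succ n ih =>
    rw [Function.iterate_succ_apply', ih, Function.iterate_succ_apply']
    funext t x
    exact (hasDerivAt_tDeriv (contDiff_iterate_dirDeriv _ n
      (contDiff_iterate_dirDeriv _ j hf)).differentiable_of_top t x).deriv

theorem contDiff_jet (n : ℕ) (hf : ContDiff ℝ (⊤ : ℕ∞) f) :
    ContDiff ℝ (⊤ : ℕ∞) (fun p : ℝ × ℝ => jet n (fun t x => f (t, x)) p.1 p.2) := by
  refine contDiff_pi.2 fun i => ?_
  unfold jet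
  simp only [pd_eq_mixedDeriv _ _ hf]
  exact hf.mixedDeriv _ _

theorem jet_add_const_mul_of_notMem_tsupport (n : ℕ) (hf : ContDiff ℝ (⊤ : ℕ∞) f)
    (hg : ContDiff ℝ (⊤ : ℕ∞) g) (k : ℝ) {p : ℝ × ℝ} (hp : p ∉ tsupport g) :
    jet n (fun t x => f (t, x) + k * g (t, x)) p.1 p.2 = jet n (fun t x => f (t, x)) p.1 p.2 := by
  funext i
  have h := pd_eq_mixedDeriv i.1.1 i.1.2
    (f := fun q => f q + k * g q) (hf.add (contDiff_const.mul hg))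
  have h0 : mixedDeriv i.1.1 i.1.2 g p = 0 :=
    image_eq_zero_of_notMem_tsupport fun h => hp (tsupport_mixedDeriv_subset _ _ _ h)
  unfold jet
  rw [h, mixedDeriv_add_const_mul _ _ hf hg k, pd_eq_mixedDeriv _ _ hf]
  simp [h0]

end Plane

/-- The product of the wave operator applied to `f` with the multiplier `L` evaluated on the
first-order jet of `f`. -/
def waveMul (c : ℝ → ℝ) (L : ℝ × ℝ × ℝ × ℝ × ℝ → ℝ) (f : ℝ × ℝ → ℝ) (p : ℝ × ℝ) : ℝ :=
  (tDeriv (tDeriv f) p - c (f p) ^ 2 * xDeriv (xDeriv f) p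
    - c (f p) * deriv c (f p) * xDeriv f p ^ 2) * L (p.1, p.2, f p, tDeriv f p, xDeriv f p)

/-- The uncurried form of a function of five variables. -/
def uncurry₅ (Λ : ℝ → ℝ → ℝ → ℝ → ℝ → ℝ) : ℝ × ℝ × ℝ × ℝ × ℝ → ℝ :=
  fun v => Λ v.1 v.2.1 v.2.2.1 v.2.2.2.1 v.2.2.2.2

theorem IsMultiplierWave.integral_waveMul_sub {c : ℝ → ℝ} {Λ : ℝ → ℝ → ℝ → ℝ → ℝ → ℝ}
    (hm : IsMultiplierWave c Λ) {f φ : ℝ × ℝ → ℝ} (hf : ContDiff ℝ (⊤ : ℕ∞) f)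
    (hφ : ContDiff ℝ (⊤ : ℕ∞) φ) (hφs : HasCompactSupport φ) (k : ℝ) :
    ∫ p, (waveMul c (uncurry₅ Λ) (fun q => f q + k * φ q) p - waveMul c (uncurry₅ Λ) f p) = 0 := by
  obtain ⟨Φt, Φx, ht, hx, H⟩ := hm
  set fl : (ℝ × ℝ × (JetIdx 3 → ℝ) → ℝ) → (ℝ × ℝ → ℝ) → ℝ × ℝ → ℝ :=
    fun Φ u p => Φ (p.1, p.2, jet 3 (fun t x => u (t, x)) p.1 p.2) with hfl
  have hsm : ∀ {Φ u}, ContDiff ℝ (⊤ : ℕ∞) Φ → ContDiff ℝ (⊤ : ℕ∞) u →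
      ContDiff ℝ (⊤ : ℕ∞) (fl Φ u) := fun hΦ hu =>
    hΦ.comp (contDiff_fst.prodMk (contDiff_snd.prodMk (contDiff_jet 3 hu)))
  have hW : ∀ u, ContDiff ℝ (⊤ : ℕ∞) u →
      ∀ p, waveMul c (uncurry₅ Λ) u p = tDeriv (fl Φt u) p + xDeriv (fl Φx u) p := by
    rintro u hu ⟨t, x⟩
    have h := H (fun t x => u (t, x)) hu t x
    rw [pd_eq_mixedDeriv _ _ hu, pd_eq_mixedDeriv _ _ hu, pd_eq_mixedDeriv _ _ hu,
      pd_eq_mixedDeriv _ _ hu] at h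
    rw [← (hasDerivAt_tDeriv (hsm ht hu).differentiable_of_top t x).deriv,
      ← (hasDerivAt_xDeriv (hsm hx hu).differentiable_of_top t x).deriv]
    exact h
  have hg : ContDiff ℝ (⊤ : ℕ∞) (fun q => f q + k * φ q) := hf.add (contDiff_const.mul hφ)
  have hdiff : ∀ {Φ}, ContDiff ℝ (⊤ : ℕ∞) Φ →
      ContDiff ℝ (⊤ : ℕ∞) (fun p => fl Φ (fun q => f q + k * φ q) p + (-1) * fl Φ f p) :=
    fun hΦ => (hsm hΦ hg).add (contDiff_const.mul (hsm hΦ hf))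
  have hcs : ∀ Φ,
      HasCompactSupport (fun p => fl Φ (fun q => f q + k * φ q) p + (-1) * fl Φ f p) := by
    refine fun Φ => HasCompactSupport.intro hφs fun p hp => ?_
    simp only [hfl]
    rw [jet_add_const_mul_of_notMem_tsupport 3 hf hφ k hp]
    ring
  have e1 : ∀ p, waveMul c (uncurry₅ Λ) (fun q => f q + k * φ q) p - waveMul c (uncurry₅ Λ) f p =
      tDeriv (fun p => fl Φt (fun q => f q + k * φ q) p + (-1) * fl Φt f p) p +
      xDeriv (fun p => fl Φx (fun q => f q + k * φ q) p + (-1) * fl Φx f p) p := by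
    intro p
    rw [hW _ hg, hW _ hf]
    unfold tDeriv xDeriv
    rw [dirDeriv_add_const_mul (hsm ht hg).differentiable_of_top (hsm ht hf).differentiable_of_top,
      dirDeriv_add_const_mul (hsm hx hg).differentiable_of_top (hsm hx hf).differentiable_of_top]
    ring
  simp only [e1]
  rw [integral_add
    (((hdiff ht).dirDeriv _).continuous.integrable_of_hasCompactSupport ((hcs Φt).dirDeriv _))
    (((hdiff hx).dirDeriv _).continuous.integrable_of_hasCompactSupport ((hcs Φx).dirDeriv _)),
    integral_dirDeriv_eq_zero _ (hdiff ht) (hcs Φt),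
    integral_dirDeriv_eq_zero _ (hdiff hx) (hcs Φx), add_zero]

section FiveVariables

/-- The partial derivative `∂/∂t` of a function of `(t, x, u, uₜ, uₓ)`. -/
abbrev dT (L : ℝ × ℝ × ℝ × ℝ × ℝ → ℝ) : ℝ × ℝ × ℝ × ℝ × ℝ → ℝ :=
  dirDeriv ((1 : ℝ), (0 : ℝ), (0 : ℝ), (0 : ℝ), (0 : ℝ)) L

/-- The partial derivative `∂/∂x` of a function of `(t, x, u, uₜ, uₓ)`. -/
abbrev dX (L : ℝ × ℝ × ℝ × ℝ × ℝ → ℝ) : ℝ × ℝ × ℝ × ℝ × ℝ → ℝ :=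
  dirDeriv ((0 : ℝ), (1 : ℝ), (0 : ℝ), (0 : ℝ), (0 : ℝ)) L

/-- The partial derivative `∂/∂u` of a function of `(t, x, u, uₜ, uₓ)`. -/
abbrev dU (L : ℝ × ℝ × ℝ × ℝ × ℝ → ℝ) : ℝ × ℝ × ℝ × ℝ × ℝ → ℝ :=
  dirDeriv ((0 : ℝ), (0 : ℝ), (1 : ℝ), (0 : ℝ), (0 : ℝ)) L

/-- The partial derivative `∂/∂uₜ` of a function of `(t, x, u, uₜ, uₓ)`. -/
abbrev dV (L : ℝ × ℝ × ℝ × ℝ × ℝ → ℝ) : ℝ × ℝ × ℝ × ℝ × ℝ → ℝ :=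
  dirDeriv ((0 : ℝ), (0 : ℝ), (0 : ℝ), (1 : ℝ), (0 : ℝ)) L

/-- The partial derivative `∂/∂uₓ` of a function of `(t, x, u, uₜ, uₓ)`. -/
abbrev dW (L : ℝ × ℝ × ℝ × ℝ × ℝ → ℝ) : ℝ × ℝ × ℝ × ℝ × ℝ → ℝ :=
  dirDeriv ((0 : ℝ), (0 : ℝ), (0 : ℝ), (0 : ℝ), (1 : ℝ)) L

theorem HasDerivAt.comp₅ {L : ℝ × ℝ × ℝ × ℝ × ℝ → ℝ} (hL : Differentiable ℝ L)
    {t x u v w : ℝ → ℝ} {t' x' u' v' w' s : ℝ} (ht : HasDerivAt t t' s) (hx : HasDerivAt x x' s)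
    (hu : HasDerivAt u u' s) (hv : HasDerivAt v v' s) (hw : HasDerivAt w w' s) :
    HasDerivAt (fun r => L (t r, x r, u r, v r, w r))
      (t' * dT L (t s, x s, u s, v s, w s) + x' * dX L (t s, x s, u s, v s, w s)
        + u' * dU L (t s, x s, u s, v s, w s) + v' * dV L (t s, x s, u s, v s, w s)
        + w' * dW L (t s, x s, u s, v s, w s)) s := by
  have h := (hL (t s, x s, u s, v s, w s)).hasFDerivAt.comp_hasDerivAt s
    (ht.prodMk (hx.prodMk (hu.prodMk (hv.prodMk hw))))
  refine h.congr_deriv ?_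
  have e : (t', x', u', v', w') = t' • ((1 : ℝ), (0 : ℝ), (0 : ℝ), (0 : ℝ), (0 : ℝ))
      + x' • ((0 : ℝ), (1 : ℝ), (0 : ℝ), (0 : ℝ), (0 : ℝ))
      + u' • ((0 : ℝ), (0 : ℝ), (1 : ℝ), (0 : ℝ), (0 : ℝ))
      + v' • ((0 : ℝ), (0 : ℝ), (0 : ℝ), (1 : ℝ), (0 : ℝ))
      + w' • ((0 : ℝ), (0 : ℝ), (0 : ℝ), (0 : ℝ), (1 : ℝ)) := by simp
  rw [e]
  simp only [map_add, map_smul, smul_eq_mul]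
  rfl

end FiveVariables

section FirstVariation

variable {c : ℝ → ℝ} {L : ℝ × ℝ × ℝ × ℝ × ℝ → ℝ}

/-- The first-order jet of `f`. -/
def jetOne (f : ℝ × ℝ → ℝ) (p : ℝ × ℝ) : ℝ × ℝ × ℝ × ℝ × ℝ :=
  (p.1, p.2, f p, tDeriv f p, xDeriv f p)

/-- The wave operator `u ↦ u_tt − c(u)²u_xx − c(u)c'(u)u_x²`. -/
def waveOp (c : ℝ → ℝ) (f : ℝ × ℝ → ℝ) (p : ℝ × ℝ) : ℝ :=
  tDeriv (tDeriv f) p - c (f p) ^ 2 * xDeriv (xDeriv f) p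
    - c (f p) * deriv c (f p) * xDeriv f p ^ 2

/-- The coefficient of `φ` in the first variation of `waveMul` in the direction `φ`. -/
def varCoeff (c : ℝ → ℝ) (L : ℝ × ℝ × ℝ × ℝ × ℝ → ℝ) (f : ℝ × ℝ → ℝ) (p : ℝ × ℝ) : ℝ :=
  (-(2 * c (f p) * deriv c (f p) * xDeriv (xDeriv f) p)
    - (deriv c (f p) ^ 2 + c (f p) * deriv (deriv c) (f p)) * xDeriv f p ^ 2) * L (jetOne f p)
  + waveOp c f p * dU L (jetOne f p)

/-- The coefficient of `∂ₜφ` in the first variation of `waveMul` in the direction `φ`. -/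
def varCoeffT (c : ℝ → ℝ) (L : ℝ × ℝ × ℝ × ℝ × ℝ → ℝ) (f : ℝ × ℝ → ℝ) (p : ℝ × ℝ) : ℝ :=
  waveOp c f p * dV L (jetOne f p)

/-- The coefficient of `∂ₓφ` in the first variation of `waveMul` in the direction `φ`. -/
def varCoeffX (c : ℝ → ℝ) (L : ℝ × ℝ × ℝ × ℝ × ℝ → ℝ) (f : ℝ × ℝ → ℝ) (p : ℝ × ℝ) : ℝ :=
  -(2 * c (f p) * deriv c (f p) * xDeriv f p) * L (jetOne f p)
  + waveOp c f p * dW L (jetOne f p)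

/-- The coefficient of `∂ₜ²φ` in the first variation of `waveMul` in the direction `φ`. -/
def varCoeffTT (L : ℝ × ℝ × ℝ × ℝ × ℝ → ℝ) (f : ℝ × ℝ → ℝ) (p : ℝ × ℝ) : ℝ :=
  L (jetOne f p)

/-- The coefficient of `∂ₓ²φ` in the first variation of `waveMul` in the direction `φ`. -/
def varCoeffXX (c : ℝ → ℝ) (L : ℝ × ℝ × ℝ × ℝ × ℝ → ℝ) (f : ℝ × ℝ → ℝ) (p : ℝ × ℝ) : ℝ :=
  -(c (f p) ^ 2) * L (jetOne f p)

/-- The first variation of `waveMul` at `f` in the direction `φ`. -/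
def waveVariation (c : ℝ → ℝ) (L : ℝ × ℝ × ℝ × ℝ × ℝ → ℝ) (f φ : ℝ × ℝ → ℝ) (p : ℝ × ℝ) : ℝ :=
  tDeriv (tDeriv φ) p * varCoeffTT L f p + xDeriv (xDeriv φ) p * varCoeffXX c L f p
    + xDeriv φ p * varCoeffX c L f p + tDeriv φ p * varCoeffT c L f p + φ p * varCoeff c L f p

variable {f φ : ℝ × ℝ → ℝ}

theorem dirDeriv_dirDeriv_add_const_mul (hf : ContDiff ℝ (⊤ : ℕ∞) f)
    (hφ : ContDiff ℝ (⊤ : ℕ∞) φ) (e e' : ℝ × ℝ) (k : ℝ) :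
    dirDeriv e (fun p => dirDeriv e' f p + k * dirDeriv e' φ p) =
      fun p => dirDeriv e (dirDeriv e' f) p + k * dirDeriv e (dirDeriv e' φ) p :=
  dirDeriv_add_const_mul (hf.dirDeriv e').differentiable_of_top
    (hφ.dirDeriv e').differentiable_of_top e k

theorem hasDerivAt_waveMul (hc : ContDiff ℝ (⊤ : ℕ∞) c) (hL : ContDiff ℝ (⊤ : ℕ∞) L)
    (hf : ContDiff ℝ (⊤ : ℕ∞) f) (hφ : ContDiff ℝ (⊤ : ℕ∞) φ) (p : ℝ × ℝ) (r : ℝ) :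
    HasDerivAt (fun k => waveMul c L (fun q => f q + k * φ q) p)
      (waveVariation c L (fun q => f q + r * φ q) φ p) r := by
  have hc' : ContDiff ℝ (⊤ : ℕ∞) (deriv c) := (contDiff_infty_iff_deriv.1 hc).2
  simp only [waveMul, waveVariation, varCoeffTT, varCoeffXX, varCoeffX, varCoeffT, varCoeff,
    waveOp, jetOne, tDeriv, xDeriv, dirDeriv_dirDeriv_add_const_mul hf hφ,
    dirDeriv_add_const_mul hf.differentiable_of_top hφ.differentiable_of_top]
  have lin : ∀ a b : ℝ, HasDerivAt (fun k : ℝ => a + k * b) b r := fun a b => by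
    simpa using ((hasDerivAt_id r).mul_const b).const_add a
  have h0 := (hc.hasDerivAt_of_top (f p + r * φ p)).comp r (lin (f p) (φ p))
  have h1 := (hc'.hasDerivAt_of_top (f p + r * φ p)).comp r (lin (f p) (φ p))
  have h2 := HasDerivAt.comp₅ hL.differentiable_of_top (hasDerivAt_const r p.1)
    (hasDerivAt_const r p.2) (lin (f p) (φ p)) (lin (tDeriv f p) (tDeriv φ p))
    (lin (xDeriv f p) (xDeriv φ p))
  refine ((((lin (tDeriv (tDeriv f) p) (tDeriv (tDeriv φ) p)).sub
    ((h0.pow 2).mul (lin (xDeriv (xDeriv f) p) (xDeriv (xDeriv φ) p)))).sub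
    ((h0.mul h1).mul ((lin (xDeriv f p) (xDeriv φ p)).pow 2))).mul h2).congr_deriv ?_
  simp only [Function.comp_apply, tDeriv, xDeriv, Pi.mul_apply, Pi.pow_apply, Pi.sub_apply]
  ring

theorem continuous_waveMul_waveVariation (hc : ContDiff ℝ (⊤ : ℕ∞) c)
    (hL : ContDiff ℝ (⊤ : ℕ∞) L) (hf : ContDiff ℝ (⊤ : ℕ∞) f) (hφ : ContDiff ℝ (⊤ : ℕ∞) φ) :
    Continuous (fun q : ℝ × (ℝ × ℝ) => waveMul c L (fun z => f z + q.1 * φ z) q.2) ∧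
    Continuous (fun q : ℝ × (ℝ × ℝ) => waveVariation c L (fun z => f z + q.1 * φ z) φ q.2) := by
  have hc' : ContDiff ℝ (⊤ : ℕ∞) (deriv c) := (contDiff_infty_iff_deriv.1 hc).2
  have hc'' : Continuous (deriv (deriv c)) := (contDiff_infty_iff_deriv.1 hc').2.continuous
  have := hc.continuous
  have := hc'.continuous
  have := hL.continuous
  have := fun e => (hL.dirDeriv e).continuous
  have := hf.continuous
  have := hφ.continuous
  have := fun e => (hf.dirDeriv e).continuous
  have := fun e => (hφ.dirDeriv e).continuous
  have := fun e e' => ((hf.dirDeriv e).dirDeriv e').continuous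
  have := fun e e' => ((hφ.dirDeriv e).dirDeriv e').continuous
  simp only [waveMul, waveVariation, varCoeffTT, varCoeffXX, varCoeffX, varCoeffT, varCoeff,
    waveOp, jetOne, tDeriv, xDeriv, dirDeriv_dirDeriv_add_const_mul hf hφ,
    dirDeriv_add_const_mul hf.differentiable_of_top hφ.differentiable_of_top]
  constructor <;> fun_prop

theorem contDiff_jetOne (hf : ContDiff ℝ (⊤ : ℕ∞) f) : ContDiff ℝ (⊤ : ℕ∞) (jetOne f) :=
  contDiff_fst.prodMk (contDiff_snd.prodMk (hf.prodMk ((hf.dirDeriv _).prodMk (hf.dirDeriv _))))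

theorem contDiff_waveOp (hc : ContDiff ℝ (⊤ : ℕ∞) c) (hf : ContDiff ℝ (⊤ : ℕ∞) f) :
    ContDiff ℝ (⊤ : ℕ∞) (waveOp c f) := by
  have hc' : ContDiff ℝ (⊤ : ℕ∞) (deriv c) := (contDiff_infty_iff_deriv.1 hc).2
  have h1 := fun e => hf.dirDeriv e
  have h2 := fun e e' => (hf.dirDeriv e').dirDeriv e
  unfold waveOp
  exact ((h2 _ _).sub (((hc.comp hf).pow 2).mul (h2 _ _))).sub
    (((hc.comp hf).mul (hc'.comp hf)).mul ((h1 _).pow 2))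

theorem contDiff_varCoeff (hc : ContDiff ℝ (⊤ : ℕ∞) c) (hL : ContDiff ℝ (⊤ : ℕ∞) L)
    (hf : ContDiff ℝ (⊤ : ℕ∞) f) :
    ContDiff ℝ (⊤ : ℕ∞) (varCoeff c L f) ∧ ContDiff ℝ (⊤ : ℕ∞) (varCoeffT c L f) ∧
    ContDiff ℝ (⊤ : ℕ∞) (varCoeffX c L f) ∧ ContDiff ℝ (⊤ : ℕ∞) (varCoeffTT L f) ∧
    ContDiff ℝ (⊤ : ℕ∞) (varCoeffXX c L f) := by
  have hc' : ContDiff ℝ (⊤ : ℕ∞) (deriv c) := (contDiff_infty_iff_deriv.1 hc).2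
  have hc'' : ContDiff ℝ (⊤ : ℕ∞) (deriv (deriv c)) := (contDiff_infty_iff_deriv.1 hc').2
  have k0 := hc.comp hf
  have k1 := hc'.comp hf
  have k2 := hc''.comp hf
  have h1 := fun e => hf.dirDeriv e
  have h2 := fun e e' => (hf.dirDeriv e').dirDeriv e
  have hJ := contDiff_jetOne hf
  have hLJ := hL.comp hJ
  have hLJ' := fun e => (hL.dirDeriv e).comp hJ
  have hF := contDiff_waveOp hc hf
  refine ⟨?_, hF.mul (hLJ' _), ?_, hLJ, (k0.pow 2).neg.mul hLJ⟩
  · exact (((((contDiff_const (c := (2 : ℝ))).mul k0).mul k1).mul (h2 _ _)).neg.sub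
      (((k1.pow 2).add (k0.mul k2)).mul ((h1 _).pow 2))).mul hLJ |>.add (hF.mul (hLJ' _))
  · exact ((((contDiff_const (c := (2 : ℝ))).mul k0).mul k1).mul (h1 _)).neg.mul hLJ
      |>.add (hF.mul (hLJ' _))

/-- The Euler–Lagrange expression of the density `waveMul c L`. -/
def waveEuler (c : ℝ → ℝ) (L : ℝ × ℝ × ℝ × ℝ × ℝ → ℝ) (f : ℝ × ℝ → ℝ) (p : ℝ × ℝ) : ℝ :=
  tDeriv (tDeriv (varCoeffTT L f)) p + xDeriv (xDeriv (varCoeffXX c L f)) p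
    - xDeriv (varCoeffX c L f) p - tDeriv (varCoeffT c L f) p + varCoeff c L f p

theorem integral_add_five {α : Type*} [MeasurableSpace α] {μ : Measure α}
    {f₁ f₂ f₃ f₄ f₅ : α → ℝ} (h₁ : Integrable f₁ μ) (h₂ : Integrable f₂ μ) (h₃ : Integrable f₃ μ)
    (h₄ : Integrable f₄ μ) (h₅ : Integrable f₅ μ) :
    ∫ a, (f₁ a + f₂ a + f₃ a + f₄ a + f₅ a) ∂μ =
      ∫ a, f₁ a ∂μ + ∫ a, f₂ a ∂μ + ∫ a, f₃ a ∂μ + ∫ a, f₄ a ∂μ + ∫ a, f₅ a ∂μ := by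
  have h₁₂ : Integrable (fun a => f₁ a + f₂ a) μ := h₁.add h₂
  have h₁₃ : Integrable (fun a => f₁ a + f₂ a + f₃ a) μ := h₁₂.add h₃
  have h₁₄ : Integrable (fun a => f₁ a + f₂ a + f₃ a + f₄ a) μ := h₁₃.add h₄
  rw [integral_add h₁₄ h₅, integral_add h₁₃ h₄, integral_add h₁₂ h₃, integral_add h₁ h₂]

theorem integral_waveVariation (hc : ContDiff ℝ (⊤ : ℕ∞) c) (hL : ContDiff ℝ (⊤ : ℕ∞) L)
    (hf : ContDiff ℝ (⊤ : ℕ∞) f) (hφ : ContDiff ℝ (⊤ : ℕ∞) φ) (hφs : HasCompactSupport φ) :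
    ∫ p, waveVariation c L f φ p = ∫ p, φ p * waveEuler c L f p := by
  obtain ⟨h0, hT, hX, hTT, hXX⟩ := contDiff_varCoeff hc hL hf
  have second : ∀ (e : ℝ × ℝ) {g : ℝ × ℝ → ℝ}, ContDiff ℝ (⊤ : ℕ∞) g →
      ∫ p, dirDeriv e (dirDeriv e φ) p * g p = ∫ p, φ p * dirDeriv e (dirDeriv e g) p := by
    intro e g hg
    rw [integral_dirDeriv_mul _ (hφ.dirDeriv e) hg (hφs.dirDeriv e),
      integral_dirDeriv_mul _ hφ (hg.dirDeriv e) hφs, neg_neg]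
  have int : ∀ {a b : ℝ × ℝ → ℝ}, ContDiff ℝ (⊤ : ℕ∞) a → HasCompactSupport a →
      ContDiff ℝ (⊤ : ℕ∞) b → Integrable (fun p => a p * b p) := fun ha hs hb =>
    (ha.continuous.mul hb.continuous).integrable_of_hasCompactSupport hs.mul_right
  have i1 := int ((hφ.dirDeriv (1, 0)).dirDeriv (1, 0)) ((hφs.dirDeriv _).dirDeriv _) hTT
  have i2 := int ((hφ.dirDeriv (0, 1)).dirDeriv (0, 1)) ((hφs.dirDeriv _).dirDeriv _) hXX
  have i3 := int (hφ.dirDeriv (0, 1)) (hφs.dirDeriv _) hX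
  have i4 := int (hφ.dirDeriv (1, 0)) (hφs.dirDeriv _) hT
  have i5 := int hφ hφs h0
  have j1 := int hφ hφs ((hTT.dirDeriv (1, 0)).dirDeriv (1, 0))
  have j2 := int hφ hφs ((hXX.dirDeriv (0, 1)).dirDeriv (0, 1))
  have j3 : Integrable (fun p => -(φ p * xDeriv (varCoeffX c L f) p)) :=
    (int hφ hφs (hX.dirDeriv (0, 1))).neg
  have j4 : Integrable (fun p => -(φ p * tDeriv (varCoeffT c L f) p)) :=
    (int hφ hφs (hT.dirDeriv (1, 0))).neg
  have e : ∀ p, φ p * waveEuler c L f p = φ p * tDeriv (tDeriv (varCoeffTT L f)) p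
      + φ p * xDeriv (xDeriv (varCoeffXX c L f)) p + -(φ p * xDeriv (varCoeffX c L f) p)
      + -(φ p * tDeriv (varCoeffT c L f) p) + φ p * varCoeff c L f p := fun p => by
    unfold waveEuler; ring
  simp only [e, waveVariation]
  rw [integral_add_five i1 i2 i3 i4 i5, integral_add_five j1 j2 j3 j4 i5,
    second _ hTT, second _ hXX, integral_dirDeriv_mul _ hφ hX hφs,
    integral_dirDeriv_mul _ hφ hT hφs, integral_neg, integral_neg]

theorem IsMultiplierWave.waveEuler_eq_zero {Λ : ℝ → ℝ → ℝ → ℝ → ℝ → ℝ}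
    (hm : IsMultiplierWave c Λ) (hc : ContDiff ℝ (⊤ : ℕ∞) c) (hΛ : Smooth5 Λ)
    (hf : ContDiff ℝ (⊤ : ℕ∞) f) : waveEuler c (uncurry₅ Λ) f = 0 := by
  have hL : ContDiff ℝ (⊤ : ℕ∞) (uncurry₅ Λ) := hΛ
  obtain ⟨h0, hT, hX, hTT, hXX⟩ := contDiff_varCoeff hc hL hf
  refine eq_zero_of_integral_contDiff_mul_eq_zero volume ?_ fun φ hφ hφs => ?_
  · exact (((((hTT.dirDeriv _).dirDeriv _).add ((hXX.dirDeriv _).dirDeriv _)).sub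
      (hX.dirDeriv _)).sub (hT.dirDeriv _)).add h0 |>.continuous
  · rw [← integral_waveVariation hc hL hf hφ hφs]
    obtain ⟨k1, k2⟩ := continuous_waveMul_waveVariation hc hL hf hφ
    have hz := integral_eq_zero_of_hasDerivAt_of_integral_eq_zero volume
      (H := fun k p =>
        waveMul c (uncurry₅ Λ) (fun q => f q + k * φ q) p - waveMul c (uncurry₅ Λ) f p)
      (H' := fun k p => waveVariation c (uncurry₅ Λ) (fun q => f q + k * φ q) φ p)
      (k1.sub (by simpa [Function.comp_def] using k1.comp (continuous_const.prodMk continuous_snd :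
        Continuous fun q : ℝ × (ℝ × ℝ) => ((0 : ℝ), q.2)))) k2
      (fun r p => (hasDerivAt_waveMul hc hL hf hφ p r).sub_const _) hφs ?_
      (fun k => hm.integral_waveMul_sub hf hφ hφs k)
    · simpa using hz
    · intro r p hp
      have e0 : φ p = 0 := image_eq_zero_of_notMem_tsupport hp
      have e1 : ∀ e, dirDeriv e φ p = 0 := fun e =>
        image_eq_zero_of_notMem_tsupport fun h => hp (tsupport_dirDeriv_subset e φ h)
      have e2 : ∀ e e', dirDeriv e (dirDeriv e' φ) p = 0 := fun e e' =>
        image_eq_zero_of_notMem_tsupport fun h =>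
          hp (tsupport_dirDeriv_subset e' φ (tsupport_dirDeriv_subset e _ h))
      simp [waveMul, tDeriv, xDeriv, dirDeriv_dirDeriv_add_const_mul hf hφ,
        dirDeriv_add_const_mul hf.differentiable_of_top hφ.differentiable_of_top, e0, e1, e2]

end FirstVariation

section DeterminingEquations

variable {c : ℝ → ℝ} {L G : ℝ × ℝ × ℝ × ℝ × ℝ → ℝ} {f : ℝ × ℝ → ℝ} {r s y : ℝ}

theorem hasDerivAt_comp_jetOne_left (hG : ContDiff ℝ (⊤ : ℕ∞) G) (hf : ContDiff ℝ (⊤ : ℕ∞) f)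
    (hr : tDeriv (tDeriv f) = fun _ => r) (hs : tDeriv (xDeriv f) = fun _ => s) (t x : ℝ) :
    HasDerivAt (fun τ => G (jetOne f (τ, x)))
      (dT G (jetOne f (t, x)) + tDeriv f (t, x) * dU G (jetOne f (t, x))
        + r * dV G (jetOne f (t, x)) + s * dW G (jetOne f (t, x))) t := by
  have hv := hasDerivAt_tDeriv (hf.dirDeriv (1, 0)).differentiable_of_top t x
  have hw := hasDerivAt_tDeriv (hf.dirDeriv (0, 1)).differentiable_of_top t x
  rw [hr] at hv
  rw [hs] at hw
  refine (HasDerivAt.comp₅ hG.differentiable_of_top (hasDerivAt_id t) (hasDerivAt_const t x)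
    (hasDerivAt_tDeriv hf.differentiable_of_top t x) hv hw).congr_deriv ?_
  simp only [jetOne, id]
  ring

theorem hasDerivAt_comp_jetOne_right (hG : ContDiff ℝ (⊤ : ℕ∞) G) (hf : ContDiff ℝ (⊤ : ℕ∞) f)
    (hs : xDeriv (tDeriv f) = fun _ => s) (hy : xDeriv (xDeriv f) = fun _ => y) (t x : ℝ) :
    HasDerivAt (fun ξ => G (jetOne f (t, ξ)))
      (dX G (jetOne f (t, x)) + xDeriv f (t, x) * dU G (jetOne f (t, x))
        + s * dV G (jetOne f (t, x)) + y * dW G (jetOne f (t, x))) x := by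
  have hv := hasDerivAt_xDeriv (hf.dirDeriv (1, 0)).differentiable_of_top t x
  have hw := hasDerivAt_xDeriv (hf.dirDeriv (0, 1)).differentiable_of_top t x
  rw [hs] at hv
  rw [hy] at hw
  refine (HasDerivAt.comp₅ hG.differentiable_of_top (hasDerivAt_const x t) (hasDerivAt_id x)
    (hasDerivAt_xDeriv hf.differentiable_of_top t x) hv hw).congr_deriv ?_
  simp only [jetOne, id]
  ring

/-- The Euler–Lagrange expression of `waveMul c L`, evaluated where the second derivatives of the
argument are locally constant. -/
theorem waveEuler_eq_of_second_derivs_const (hc : ContDiff ℝ (⊤ : ℕ∞) c)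
    (hL : ContDiff ℝ (⊤ : ℕ∞) L)
    (hf : ContDiff ℝ (⊤ : ℕ∞) f) (hr : tDeriv (tDeriv f) = fun _ => r)
    (hs : tDeriv (xDeriv f) = fun _ => s) (hy : xDeriv (xDeriv f) = fun _ => y)
    {t x u v w : ℝ} (hJ : jetOne f (t, x) = (t, x, u, v, w)) :
    waveEuler c L f (t, x) =
      (s ^ 2 - r * y) * (dW (dW L) (t, x, u, v, w) - c u ^ 2 * dV (dV L) (t, x, u, v, w))
      + r * (dT (dV L) (t, x, u, v, w) + v * dU (dV L) (t, x, u, v, w)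
          + 2 * dU L (t, x, u, v, w)
          - dX (dW L) (t, x, u, v, w) - w * dU (dW L) (t, x, u, v, w)
          + c u * deriv c u * w ^ 2 * dV (dV L) (t, x, u, v, w))
      + s * (2 * (dT (dW L) (t, x, u, v, w) + v * dU (dW L) (t, x, u, v, w)
          - c u ^ 2 * (dX (dV L) (t, x, u, v, w) + w * dU (dV L) (t, x, u, v, w))
          + c u * deriv c u * w ^ 2 * dV (dW L) (t, x, u, v, w)))
      + y * (c u ^ 2 * (dT (dV L) (t, x, u, v, w) + v * dU (dV L) (t, x, u, v, w)
          - 2 * dU L (t, x, u, v, w)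
          - dX (dW L) (t, x, u, v, w) - w * dU (dW L) (t, x, u, v, w))
          + 2 * (c u * deriv c u) *
            (v * dV L (t, x, u, v, w) + w * dW L (t, x, u, v, w) - L (t, x, u, v, w))
          + c u * deriv c u * w ^ 2 * dW (dW L) (t, x, u, v, w))
      + (dT (dT L) (t, x, u, v, w) + 2 * v * dT (dU L) (t, x, u, v, w) + v ^ 2 * dU (dU L) (t, x, u, v, w)
        - c u ^ 2 * (dX (dX L) (t, x, u, v, w) + 2 * w * dX (dU L) (t, x, u, v, w) + w ^ 2 * dU (dU L) (t, x, u, v, w))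
        - (deriv c u ^ 2 + c u * deriv (deriv c) u) * w ^ 2 * L (t, x, u, v, w)
        - 2 * (c u * deriv c u) * w * (dX L (t, x, u, v, w) + w * dU L (t, x, u, v, w))
        - c u * deriv c u * w ^ 2 * dU L (t, x, u, v, w) + (deriv c u ^ 2 + c u * deriv (deriv c) u) * v * w ^ 2 * dV L (t, x, u, v, w)
        + c u * deriv c u * w ^ 2 * (dT (dV L) (t, x, u, v, w) + v * dU (dV L) (t, x, u, v, w)) + (deriv c u ^ 2 + c u * deriv (deriv c) u) * w ^ 3 * dW L (t, x, u, v, w)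
        + c u * deriv c u * w ^ 2 * (dX (dW L) (t, x, u, v, w) + w * dU (dW L) (t, x, u, v, w))) := by
  have hc' : ContDiff ℝ (⊤ : ℕ∞) (deriv c) := (contDiff_infty_iff_deriv.1 hc).2
  have hs' : xDeriv (tDeriv f) = fun _ => s := (dirDeriv_comm hf _ _).trans hs
  obtain ⟨-, hT, hX, hTT, hXX⟩ := contDiff_varCoeff hc hL hf
  have hu : f (t, x) = u := congrArg (fun q => q.2.2.1) hJ
  have hv : tDeriv f (t, x) = v := congrArg (fun q => q.2.2.2.1) hJ
  have hw : xDeriv f (t, x) = w := congrArg (fun q => q.2.2.2.2) hJ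
  have left := fun (G : ℝ × ℝ × ℝ × ℝ × ℝ → ℝ) (hG : ContDiff ℝ (⊤ : ℕ∞) G) =>
    hasDerivAt_comp_jetOne_left hG hf hr hs
  have right := fun (G : ℝ × ℝ × ℝ × ℝ × ℝ → ℝ) (hG : ContDiff ℝ (⊤ : ℕ∞) G) =>
    hasDerivAt_comp_jetOne_right hG hf hs' hy
  have ft := hasDerivAt_tDeriv hf.differentiable_of_top
  have fx := hasDerivAt_xDeriv hf.differentiable_of_top
  have ftt := hasDerivAt_tDeriv (hf.dirDeriv (1, 0)).differentiable_of_top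
  have ftx := hasDerivAt_tDeriv (hf.dirDeriv (0, 1)).differentiable_of_top
  have fxx := hasDerivAt_xDeriv (hf.dirDeriv (0, 1)).differentiable_of_top
  simp only [hr] at ftt
  simp only [hs] at ftx
  simp only [hy] at fxx
  have cft : ∀ t x, HasDerivAt (fun τ => c (f (τ, x))) (deriv c (f (t, x)) * tDeriv f (t, x)) t :=
    fun t x => (hc.hasDerivAt_of_top (f (t, x))).comp t (ft t x)
  have cfx : ∀ t x, HasDerivAt (fun ξ => c (f (t, ξ))) (deriv c (f (t, x)) * xDeriv f (t, x)) x :=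
    fun t x => (hc.hasDerivAt_of_top (f (t, x))).comp x (fx t x)
  have c'ft : ∀ t x, HasDerivAt (fun τ => deriv c (f (τ, x)))
      (deriv (deriv c) (f (t, x)) * tDeriv f (t, x)) t :=
    fun t x => HasDerivAt.comp (h₂ := deriv c) t (hc'.hasDerivAt_of_top (f (t, x))) (ft t x)
  have c'fx : ∀ t x, HasDerivAt (fun ξ => deriv c (f (t, ξ)))
      (deriv (deriv c) (f (t, x)) * xDeriv f (t, x)) x :=
    fun t x => HasDerivAt.comp (h₂ := deriv c) x (hc'.hasDerivAt_of_top (f (t, x))) (fx t x)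
  have hFt := (((hasDerivAt_const t r).sub (((cft t x).pow 2).mul (hasDerivAt_const t y))).sub
      (((cft t x).mul (c'ft t x)).mul ((ftx t x).pow 2)))
  have hFx := (((hasDerivAt_const x r).sub (((cfx t x).pow 2).mul (hasDerivAt_const x y))).sub
      (((cfx t x).mul (c'fx t x)).mul ((fxx t x).pow 2)))
  have eTT : tDeriv (varCoeffTT L f) = fun p => dT L (jetOne f p)
      + tDeriv f p * dU L (jetOne f p) + r * dV L (jetOne f p) + s * dW L (jetOne f p) := by
    funext ⟨t, x⟩
    exact tDeriv_eq_of_hasDerivAt hTT.differentiable_of_top (left L hL t x)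
  have eTTT := (((left (dT L) (hL.dirDeriv _) t x).add
    ((ftt t x).mul (left (dU L) (hL.dirDeriv _) t x))).add
    ((left (dV L) (hL.dirDeriv _) t x).const_mul r)).add
    ((left (dW L) (hL.dirDeriv _) t x).const_mul s)
  have eTT' := tDeriv_eq_of_hasDerivAt (f := tDeriv (varCoeffTT L f))
    (hTT.dirDeriv _).differentiable_of_top (by rw [eTT]; exact eTTT)
  have eXX : xDeriv (varCoeffXX c L f) = fun p =>
      -(2 * c (f p) * (deriv c (f p) * xDeriv f p)) * L (jetOne f p)
      + -(c (f p) ^ 2) * (dX L (jetOne f p)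
        + xDeriv f p * dU L (jetOne f p) + s * dV L (jetOne f p) + y * dW L (jetOne f p)) := by
    funext ⟨t, x⟩
    refine xDeriv_eq_of_hasDerivAt hXX.differentiable_of_top
      ((((cfx t x).pow 2).neg.mul (right L hL t x)).congr_deriv ?_)
    simp
  have eXXX := ((((cfx t x).const_mul 2).mul ((c'fx t x).mul (fxx t x))).neg.mul
    (right L hL t x)).add (((cfx t x).pow 2).neg.mul
      ((((right (dX L) (hL.dirDeriv _) t x).add
        ((fxx t x).mul (right (dU L) (hL.dirDeriv _) t x))).add
        ((right (dV L) (hL.dirDeriv _) t x).const_mul s)).add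
        ((right (dW L) (hL.dirDeriv _) t x).const_mul y)))
  have eXX' := xDeriv_eq_of_hasDerivAt (f := xDeriv (varCoeffXX c L f))
    (hXX.dirDeriv _).differentiable_of_top (by rw [eXX]; exact eXXX)
  have eX := xDeriv_eq_of_hasDerivAt (f := varCoeffX c L f) hX.differentiable_of_top
    (t := t) (x := x) (by
      unfold varCoeffX waveOp
      rw [hr, hy]
      exact (((((cfx t x).const_mul 2).mul (c'fx t x)).mul (fxx t x)).neg.mul (right L hL t x)).add
        (hFx.mul (right (dW L) (hL.dirDeriv _) t x)))
  have eT := tDeriv_eq_of_hasDerivAt (f := varCoeffT c L f) hT.differentiable_of_top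
    (t := t) (x := x) (by
      unfold varCoeffT waveOp
      rw [hr, hy]
      exact hFt.mul (left (dV L) (hL.dirDeriv _) t x))
  unfold waveEuler
  rw [eTT', eXX', eX, eT]
  unfold varCoeff waveOp
  rw [hr, hy]
  simp only [hJ, hu, hv, hw, Pi.add_apply, Pi.mul_apply, Pi.pow_apply, Pi.sub_apply, Pi.neg_apply]
  simp only [dT, dX, dU, dV, dW,
    dirDeriv_comm hL (1, 0, 0, 0, 0) (0, 0, 1, 0, 0),
    dirDeriv_comm hL (0, 1, 0, 0, 0) (0, 0, 1, 0, 0),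
    dirDeriv_comm hL (0, 0, 0, 1, 0) (1, 0, 0, 0, 0),
    dirDeriv_comm hL (0, 0, 0, 1, 0) (0, 1, 0, 0, 0),
    dirDeriv_comm hL (0, 0, 0, 1, 0) (0, 0, 1, 0, 0),
    dirDeriv_comm hL (0, 0, 0, 0, 1) (1, 0, 0, 0, 0),
    dirDeriv_comm hL (0, 0, 0, 0, 1) (0, 1, 0, 0, 0),
    dirDeriv_comm hL (0, 0, 0, 0, 1) (0, 0, 1, 0, 0),
    dirDeriv_comm hL (0, 0, 0, 0, 1) (0, 0, 0, 1, 0)]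
  ring

theorem exists_contDiff_jetOne_eq (t x u v w r s y : ℝ) :
    ∃ f : ℝ × ℝ → ℝ, ContDiff ℝ (⊤ : ℕ∞) f ∧ jetOne f (t, x) = (t, x, u, v, w) ∧
      tDeriv (tDeriv f) = (fun _ => r) ∧ tDeriv (xDeriv f) = (fun _ => s) ∧
      xDeriv (xDeriv f) = fun _ => y := by
  set f : ℝ × ℝ → ℝ := fun p => u + v * (p.1 - t) + w * (p.2 - x) + r / 2 * (p.1 - t) ^ 2
    + s * ((p.1 - t) * (p.2 - x)) + y / 2 * (p.2 - x) ^ 2 with hfdef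
  have hf : ContDiff ℝ (⊤ : ℕ∞) f := by fun_prop
  have shift : ∀ a b : ℝ, HasDerivAt (fun z => z - a) 1 b := fun a b => (hasDerivAt_id b).sub_const a
  have ht : tDeriv f = fun p => v + r * (p.1 - t) + s * (p.2 - x) := by
    funext ⟨a, b⟩
    refine tDeriv_eq_of_hasDerivAt hf.differentiable_of_top
      (((((((shift t a).const_mul v).const_add u).add_const (w * (b - x))).add
        (((shift t a).pow 2).const_mul (r / 2))).add
        (((shift t a).mul_const (b - x)).const_mul s)).add_const (y / 2 * (b - x) ^ 2)
        |>.congr_deriv ?_)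
    push_cast
    ring
  have hx : xDeriv f = fun p => w + s * (p.1 - t) + y * (p.2 - x) := by
    funext ⟨a, b⟩
    refine xDeriv_eq_of_hasDerivAt hf.differentiable_of_top
      ((((((shift x b).const_mul w).const_add (u + v * (a - t))).add_const
        (r / 2 * (a - t) ^ 2)).add (((shift x b).const_mul (a - t)).const_mul s)).add
        (((shift x b).pow 2).const_mul (y / 2)) |>.congr_deriv ?_)
    push_cast
    ring
  refine ⟨f, hf, ?_, ?_, ?_, ?_⟩
  · have h0 : f (t, x) = u := by simp [hfdef]
    simp [jetOne, ht, hx, h0]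
  · funext ⟨a, b⟩
    refine tDeriv_eq_of_hasDerivAt (hf.dirDeriv _).differentiable_of_top ?_
    change HasDerivAt (fun z => tDeriv f (z, b)) r a
    rw [ht]
    exact ((((shift t a).const_mul r).const_add v).add_const (s * (b - x))).congr_deriv (by simp)
  · funext ⟨a, b⟩
    refine tDeriv_eq_of_hasDerivAt (hf.dirDeriv _).differentiable_of_top ?_
    change HasDerivAt (fun z => xDeriv f (z, b)) s a
    rw [hx]
    exact ((((shift t a).const_mul s).const_add w).add_const (y * (b - x))).congr_deriv (by simp)
  · funext ⟨a, b⟩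
    refine xDeriv_eq_of_hasDerivAt (hf.dirDeriv _).differentiable_of_top ?_
    change HasDerivAt (fun z => xDeriv f (a, z)) y b
    rw [hx]
    exact (((shift x b).const_mul y).const_add (w + s * (a - t))).congr_deriv (by simp)

/-- The determining equations satisfied by a multiplier. -/
structure IsDetermined (c : ℝ → ℝ) (L : ℝ × ℝ × ℝ × ℝ × ℝ → ℝ) : Prop where
  /-- The coefficient of `u_tx² - u_tt u_xx`. -/
  wave : ∀ t x u v w, dW (dW L) (t, x, u, v, w) = c u ^ 2 * dV (dV L) (t, x, u, v, w)
  /-- The coefficient of `u_xx`, reduced modulo the others. -/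
  euler : ∀ t x u v w, 2 * c u * dU L (t, x, u, v, w) =
    deriv c u * (v * dV L (t, x, u, v, w) + w * dW L (t, x, u, v, w) - L (t, x, u, v, w))
  /-- The coefficient of `u_tt`. -/
  tt : ∀ t x u v w, dT (dV L) (t, x, u, v, w) + v * dU (dV L) (t, x, u, v, w)
    + 2 * dU L (t, x, u, v, w) - dX (dW L) (t, x, u, v, w) - w * dU (dW L) (t, x, u, v, w)
    + c u * deriv c u * w ^ 2 * dV (dV L) (t, x, u, v, w) = 0
  /-- The coefficient of `u_tx`. -/
  tx : ∀ t x u v w, dT (dW L) (t, x, u, v, w) + v * dU (dW L) (t, x, u, v, w)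
    - c u ^ 2 * (dX (dV L) (t, x, u, v, w) + w * dU (dV L) (t, x, u, v, w))
    + c u * deriv c u * w ^ 2 * dV (dW L) (t, x, u, v, w) = 0

theorem isDetermined_of_waveEuler_eq_zero (hc : ContDiff ℝ (⊤ : ℕ∞) c) (hcpos : ∀ u, 0 < c u)
    (hL : ContDiff ℝ (⊤ : ℕ∞) L)
    (h : ∀ f, ContDiff ℝ (⊤ : ℕ∞) f → waveEuler c L f = 0) : IsDetermined c L := by
  choose f hf hJ hr hs hy using exists_contDiff_jetOne_eq
  have key := fun t x u v w r s y =>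
    (waveEuler_eq_of_second_derivs_const hc hL (hf t x u v w r s y) (hr t x u v w r s y)
      (hs t x u v w r s y) (hy t x u v w r s y) (hJ t x u v w r s y)).symm.trans
      (congrFun (h _ (hf t x u v w r s y)) (t, x))
  have hwave : ∀ t x u v w,
      dW (dW L) (t, x, u, v, w) = c u ^ 2 * dV (dV L) (t, x, u, v, w) := fun t x u v w => by
    have h0 := key t x u v w 0 0 0
    have h1 := key t x u v w 0 1 0
    have h2 := key t x u v w 0 (-1) 0
    simp only [Pi.zero_apply] at h0 h1 h2
    linear_combination (h1 + h2) / 2 - h0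
  have htt : ∀ t x u v w, dT (dV L) (t, x, u, v, w) + v * dU (dV L) (t, x, u, v, w)
      + 2 * dU L (t, x, u, v, w) - dX (dW L) (t, x, u, v, w) - w * dU (dW L) (t, x, u, v, w)
      + c u * deriv c u * w ^ 2 * dV (dV L) (t, x, u, v, w) = 0 := fun t x u v w => by
    have h0 := key t x u v w 0 0 0
    have h1 := key t x u v w 1 0 0
    simp only [Pi.zero_apply] at h0 h1
    linear_combination h1 - h0
  refine ⟨hwave, fun t x u v w => ?_, htt, fun t x u v w => ?_⟩
  · have h0 := key t x u v w 0 0 0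
    have h1 := key t x u v w 0 0 1
    simp only [Pi.zero_apply] at h0 h1
    refine mul_left_cancel₀ (mul_pos two_pos (hcpos u)).ne' ?_
    linear_combination c u ^ 2 * htt t x u v w - (h1 - h0)
      + c u * deriv c u * w ^ 2 * hwave t x u v w
  · have h1 := key t x u v w 0 1 0
    have h2 := key t x u v w 0 (-1) 0
    simp only [Pi.zero_apply] at h1 h2
    linear_combination (h1 - h2) / 4

end DeterminingEquations

section Lines

variable {L : ℝ × ℝ × ℝ × ℝ × ℝ → ℝ}

theorem hasDerivAt_dT (hL : Differentiable ℝ L) (t x u v w : ℝ) :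
    HasDerivAt (fun s => L (s, x, u, v, w)) (dT L (t, x, u, v, w)) t :=
  (HasDerivAt.comp₅ hL (hasDerivAt_id t) (hasDerivAt_const t x) (hasDerivAt_const t u)
    (hasDerivAt_const t v) (hasDerivAt_const t w)).congr_deriv (by simp)

theorem hasDerivAt_dX (hL : Differentiable ℝ L) (t x u v w : ℝ) :
    HasDerivAt (fun s => L (t, s, u, v, w)) (dX L (t, x, u, v, w)) x :=
  (HasDerivAt.comp₅ hL (hasDerivAt_const x t) (hasDerivAt_id x) (hasDerivAt_const x u)
    (hasDerivAt_const x v) (hasDerivAt_const x w)).congr_deriv (by simp)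

theorem hasDerivAt_dU (hL : Differentiable ℝ L) (t x u v w : ℝ) :
    HasDerivAt (fun s => L (t, x, s, v, w)) (dU L (t, x, u, v, w)) u :=
  (HasDerivAt.comp₅ hL (hasDerivAt_const u t) (hasDerivAt_const u x) (hasDerivAt_id u)
    (hasDerivAt_const u v) (hasDerivAt_const u w)).congr_deriv (by simp)

theorem hasDerivAt_dV (hL : Differentiable ℝ L) (t x u v w : ℝ) :
    HasDerivAt (fun s => L (t, x, u, s, w)) (dV L (t, x, u, v, w)) v :=
  (HasDerivAt.comp₅ hL (hasDerivAt_const v t) (hasDerivAt_const v x) (hasDerivAt_const v u)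
    (hasDerivAt_id v) (hasDerivAt_const v w)).congr_deriv (by simp)

theorem hasDerivAt_dW (hL : Differentiable ℝ L) (t x u v w : ℝ) :
    HasDerivAt (fun s => L (t, x, u, v, s)) (dW L (t, x, u, v, w)) w :=
  (HasDerivAt.comp₅ hL (hasDerivAt_const w t) (hasDerivAt_const w x) (hasDerivAt_const w u)
    (hasDerivAt_const w v) (hasDerivAt_id w)).congr_deriv (by simp)

end Lines

theorem eq_of_hasDerivAt_zero {h : ℝ → ℝ} (hh : ∀ s, HasDerivAt h 0 s) (a b : ℝ) : h a = h b :=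
  is_const_of_deriv_eq_zero (fun s => (hh s).differentiableAt) (fun s => (hh s).deriv) a b

theorem eq_add_mul_of_hasDerivAt_const {h : ℝ → ℝ} {d : ℝ} (hh : ∀ s, HasDerivAt h d s) (s : ℝ) :
    h s = h 0 + s * d := by
  have := eq_of_hasDerivAt_zero (h := fun s => h s - s * d)
    (fun s => ((hh s).sub ((hasDerivAt_id s).mul_const d)).congr_deriv (by simp)) s 0
  simp only [zero_mul, sub_zero] at this
  linarith

section Speed

variable {c : ℝ → ℝ}

theorem deriv_eq_two_mul_sqrt_mul_deriv (hc : ContDiff ℝ (⊤ : ℕ∞) c) (hcpos : ∀ u, 0 < c u)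
    (u : ℝ) : deriv c u = 2 * √(c u) * deriv (fun z => √(c z)) u := by
  rw [((hc.hasDerivAt_of_top u).sqrt (hcpos u).ne').deriv]
  have := (Real.sqrt_pos.2 (hcpos u)).ne'
  field_simp

theorem not_exists_deriv_sqrt_eq (hc : ContDiff ℝ (⊤ : ℕ∞) c) (hcpos : ∀ u, 0 < c u)
    (hnc : ¬ ∃ k : ℝ, ∀ u : ℝ, deriv c u * (c u) ^ (-(3 : ℝ) / 2) = k) (k : ℝ) :
    ∃ u, deriv (fun z => √(c z)) u ≠ k * √(c u) ^ 2 := by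
  by_contra! h
  refine hnc ⟨2 * k, fun u => ?_⟩
  have hq := Real.sqrt_pos.2 (hcpos u)
  have e : c u ^ (-(3 : ℝ) / 2) = (√(c u) ^ 3)⁻¹ := by
    rw [Real.sqrt_eq_rpow, ← Real.rpow_natCast, ← Real.rpow_mul (hcpos u).le,
      ← Real.rpow_neg (hcpos u).le]
    norm_num
  rw [e, deriv_eq_two_mul_sqrt_mul_deriv hc hcpos, h]
  field_simp

theorem exists_ne_of_deriv_sqrt_ne_zero {u : ℝ} (h : deriv (fun z => √(c z)) u ≠ 0) (u₀ : ℝ) :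
    ∃ u, c u ≠ c u₀ := by
  by_contra! h'
  exact h (by simp [h'])

variable {L : ℝ × ℝ × ℝ × ℝ × ℝ → ℝ}

theorem IsDetermined.sqrt_mul_eq (hD : IsDetermined c L) (hc : ContDiff ℝ (⊤ : ℕ∞) c)
    (hcpos : ∀ u, 0 < c u) (hL : ContDiff ℝ (⊤ : ℕ∞) L) (t x u u' a b : ℝ) :
    √(c u) * L (t, x, u, a / √(c u), b / √(c u)) =
      √(c u') * L (t, x, u', a / √(c u'), b / √(c u')) := by
  refine eq_of_hasDerivAt_zero
    (h := fun u => √(c u) * L (t, x, u, a / √(c u), b / √(c u))) (fun z => ?_) u u'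
  have hq := (Real.sqrt_pos.2 (hcpos z)).ne'
  have hqd : HasDerivAt (fun z => √(c z)) (deriv (fun z => √(c z)) z) z :=
    ((hc.hasDerivAt_of_top z).sqrt (hcpos z).ne').differentiableAt.hasDerivAt
  have hE := hD.euler t x z (a / √(c z)) (b / √(c z))
  rw [deriv_eq_two_mul_sqrt_mul_deriv hc hcpos] at hE
  refine (hqd.mul (HasDerivAt.comp₅ hL.differentiable_of_top (hasDerivAt_const z t)
    (hasDerivAt_const z x) (hasDerivAt_id z) ((hasDerivAt_const z a).div hqd hq)
    ((hasDerivAt_const z b).div hqd hq))).congr_deriv ?_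
  nth_rewrite 1 [← Real.sq_sqrt (hcpos z).le] at hE
  simp only [id, Pi.div_apply]
  generalize deriv (fun z => √(c z)) z = q' at *
  refine mul_left_cancel₀ (mul_ne_zero two_ne_zero hq) ?_
  field_simp at hE ⊢
  linear_combination hE

theorem IsDetermined.dV_eq (hD : IsDetermined c L) (hc : ContDiff ℝ (⊤ : ℕ∞) c)
    (hcpos : ∀ u, 0 < c u) (hL : ContDiff ℝ (⊤ : ℕ∞) L) (t x u u' a b : ℝ) :
    dV L (t, x, u, a / √(c u), b / √(c u)) = dV L (t, x, u', a / √(c u'), b / √(c u')) := by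
  have hd : ∀ z, HasDerivAt (fun s => √(c z) * L (t, x, z, s / √(c z), b / √(c z)))
      (dV L (t, x, z, a / √(c z), b / √(c z))) a := fun z => by
    have hq := (Real.sqrt_pos.2 (hcpos z)).ne'
    refine (((HasDerivAt.comp (h₂ := fun s => L (t, x, z, s, b / √(c z))) a
      (hasDerivAt_dV hL.differentiable_of_top t x z _ _)
      ((hasDerivAt_id a).div_const √(c z)))).const_mul √(c z)).congr_deriv ?_
    simp only [id]
    field_simp
  refine (hd u).unique ?_
  simp only [fun s => hD.sqrt_mul_eq hc hcpos hL t x u u' s b]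
  exact hd u'

theorem IsDetermined.dW_eq (hD : IsDetermined c L) (hc : ContDiff ℝ (⊤ : ℕ∞) c)
    (hcpos : ∀ u, 0 < c u) (hL : ContDiff ℝ (⊤ : ℕ∞) L) (t x u u' a b : ℝ) :
    dW L (t, x, u, a / √(c u), b / √(c u)) = dW L (t, x, u', a / √(c u'), b / √(c u')) := by
  have hd : ∀ z, HasDerivAt (fun s => √(c z) * L (t, x, z, a / √(c z), s / √(c z)))
      (dW L (t, x, z, a / √(c z), b / √(c z))) b := fun z => by
    have hq := (Real.sqrt_pos.2 (hcpos z)).ne'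
    refine (((HasDerivAt.comp (h₂ := fun s => L (t, x, z, a / √(c z), s)) b
      (hasDerivAt_dW hL.differentiable_of_top t x z _ _)
      ((hasDerivAt_id b).div_const √(c z)))).const_mul √(c z)).congr_deriv ?_
    simp only [id]
    field_simp
  refine (hd u).unique ?_
  simp only [fun s => hD.sqrt_mul_eq hc hcpos hL t x u u' a s]
  exact hd u'

theorem IsDetermined.dV_dV_div_eq (hD : IsDetermined c L) (hc : ContDiff ℝ (⊤ : ℕ∞) c)
    (hcpos : ∀ u, 0 < c u) (hL : ContDiff ℝ (⊤ : ℕ∞) L) (t x u u' a b : ℝ) :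
    dV (dV L) (t, x, u, a / √(c u), b / √(c u)) / √(c u) =
      dV (dV L) (t, x, u', a / √(c u'), b / √(c u')) / √(c u') := by
  have hd : ∀ z, HasDerivAt (fun s => dV L (t, x, z, s / √(c z), b / √(c z)))
      (dV (dV L) (t, x, z, a / √(c z), b / √(c z)) / √(c z)) a := fun z =>
    (HasDerivAt.comp (h₂ := fun s => dV L (t, x, z, s, b / √(c z))) a
      (hasDerivAt_dV (hL.dirDeriv _).differentiable_of_top t x z _ _)
      ((hasDerivAt_id a).div_const √(c z))).congr_deriv (by simp [div_eq_mul_inv])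
  refine (hd u).unique ?_
  simp only [fun s => hD.dV_eq hc hcpos hL t x u u' s b]
  exact hd u'

theorem IsDetermined.dW_dW_div_eq (hD : IsDetermined c L) (hc : ContDiff ℝ (⊤ : ℕ∞) c)
    (hcpos : ∀ u, 0 < c u) (hL : ContDiff ℝ (⊤ : ℕ∞) L) (t x u u' a b : ℝ) :
    dW (dW L) (t, x, u, a / √(c u), b / √(c u)) / √(c u) =
      dW (dW L) (t, x, u', a / √(c u'), b / √(c u')) / √(c u') := by
  have hd : ∀ z, HasDerivAt (fun s => dW L (t, x, z, a / √(c z), s / √(c z)))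
      (dW (dW L) (t, x, z, a / √(c z), b / √(c z)) / √(c z)) b := fun z =>
    (HasDerivAt.comp (h₂ := fun s => dW L (t, x, z, a / √(c z), s)) b
      (hasDerivAt_dW (hL.dirDeriv _).differentiable_of_top t x z _ _)
      ((hasDerivAt_id b).div_const √(c z))).congr_deriv (by simp [div_eq_mul_inv])
  refine (hd u).unique ?_
  simp only [fun s => hD.dW_eq hc hcpos hL t x u u' a s]
  exact hd u'

theorem IsDetermined.dV_dV_eq_zero (hD : IsDetermined c L) (hc : ContDiff ℝ (⊤ : ℕ∞) c)
    (hcpos : ∀ u, 0 < c u) (hL : ContDiff ℝ (⊤ : ℕ∞) L) (hne : ∀ u₀, ∃ u, c u ≠ c u₀) :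
    dV (dV L) = 0 := by
  funext ⟨t, x, u, v, w⟩
  obtain ⟨u', hu'⟩ := hne u
  have hq := (Real.sqrt_pos.2 (hcpos u)).ne'
  have h1 := hD.dV_dV_div_eq hc hcpos hL t x u u' (v * √(c u)) (w * √(c u))
  have h2 := hD.dW_dW_div_eq hc hcpos hL t x u u' (v * √(c u)) (w * √(c u))
  rw [hD.wave, hD.wave] at h2
  have h3 : (c u ^ 2 - c u' ^ 2) *
      (dV (dV L) (t, x, u, v * √(c u) / √(c u), w * √(c u) / √(c u)) / √(c u)) = 0 := by
    linear_combination h2 - c u' ^ 2 * h1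
  rw [mul_div_cancel_right₀ _ hq, mul_div_cancel_right₀ _ hq] at h3
  rcases mul_eq_zero.1 h3 with h | h
  · exact absurd ((pow_left_inj₀ (hcpos u).le (hcpos u').le two_ne_zero).1 (sub_eq_zero.1 h)).symm
      hu'
  · exact (div_eq_zero_iff.1 h).resolve_right hq

/-- A solution of the determining equations is affine in `uₜ` and in `uₓ`, with a prescribed
dependence on `u`. -/
theorem IsDetermined.exists_eq (hD : IsDetermined c L) (hc : ContDiff ℝ (⊤ : ℕ∞) c)
    (hcpos : ∀ u, 0 < c u) (hL : ContDiff ℝ (⊤ : ℕ∞) L) (hne : ∀ u₀, ∃ u, c u ≠ c u₀) :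
    ∃ α β γ δ : ℝ × ℝ → ℝ, ContDiff ℝ (⊤ : ℕ∞) β ∧ ContDiff ℝ (⊤ : ℕ∞) γ ∧
      ContDiff ℝ (⊤ : ℕ∞) δ ∧ ∀ t x u v w, L (t, x, u, v, w) =
        α (t, x) / √(c u) + β (t, x) * v + γ (t, x) * w + δ (t, x) * √(c u) * (v * w) := by
  have hvv := hD.dV_dV_eq_zero hc hcpos hL hne
  have hww : dW (dW L) = 0 := by
    funext ⟨t, x, u, v, w⟩
    rw [hD.wave, hvv]
    simp
  have hvw : dW (dW (dV L)) = 0 := by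
    have : dV (0 : ℝ × ℝ × ℝ × ℝ × ℝ → ℝ) = 0 := by funext p; simp [dirDeriv]
    exact (congrArg dW (dirDeriv_comm hL _ _)).trans
      ((dirDeriv_comm (hL.dirDeriv _) _ _).trans ((congrArg dV hww).trans this))
  have hline : ContDiff ℝ (⊤ : ℕ∞) (fun p : ℝ × ℝ => (p.1, p.2, (0 : ℝ), (0 : ℝ), (0 : ℝ))) := by
    fun_prop
  have q0 := (Real.sqrt_pos.2 (hcpos 0)).ne'
  refine ⟨fun p => √(c 0) * L (p.1, p.2, 0, 0, 0), fun p => dV L (p.1, p.2, 0, 0, 0),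
    fun p => dW L (p.1, p.2, 0, 0, 0), fun p => (√(c 0))⁻¹ * dW (dV L) (p.1, p.2, 0, 0, 0),
    (hL.dirDeriv _).comp hline, (hL.dirDeriv _).comp hline,
    contDiff_const.mul (((hL.dirDeriv _).dirDeriv _).comp hline), fun t x u v w => ?_⟩
  have affine : ∀ {G : ℝ × ℝ × ℝ × ℝ × ℝ → ℝ}, ContDiff ℝ (⊤ : ℕ∞) G → dW (dW G) = 0 →
      ∀ b, G (t, x, 0, 0, b) = G (t, x, 0, 0, 0) + b * dW G (t, x, 0, 0, 0) := by
    intro G hG h b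
    refine eq_add_mul_of_hasDerivAt_const (h := fun b => G (t, x, 0, 0, b)) (fun s => ?_) b
    rw [eq_of_hasDerivAt_zero (h := fun b => dW G (t, x, 0, 0, b)) (fun s => by
      simpa [h] using hasDerivAt_dW (hG.dirDeriv (0, 0, 0, 0, 1)).differentiable_of_top t x 0 0 s)
      0 s]
    exact hasDerivAt_dW hG.differentiable_of_top t x 0 0 s
  have affine' : ∀ a b, L (t, x, 0, a, b) = L (t, x, 0, 0, b) + a * dV L (t, x, 0, 0, b) := by
    intro a b
    refine eq_add_mul_of_hasDerivAt_const (h := fun a => L (t, x, 0, a, b)) (fun s => ?_) a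
    rw [eq_of_hasDerivAt_zero (h := fun a => dV L (t, x, 0, a, b)) (fun s => by
      simpa [hvv] using hasDerivAt_dV (hL.dirDeriv (0, 0, 0, 1, 0)).differentiable_of_top t x 0 s b)
      0 s]
    exact hasDerivAt_dV hL.differentiable_of_top t x 0 s b
  have hq := (Real.sqrt_pos.2 (hcpos u)).ne'
  have h := hD.sqrt_mul_eq hc hcpos hL t x u 0 (v * √(c u)) (w * √(c u))
  rw [mul_div_cancel_right₀ _ hq, mul_div_cancel_right₀ _ hq, affine', affine hL hww,
    affine (G := dV L) (hL.dirDeriv _) hvw] at h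
  field_simp at h ⊢
  linear_combination h

/-- For a generic wave speed, the solutions of the determining equations are spanned by
`uₜ`, `uₓ` and `t uₜ + x uₓ`. -/
theorem IsDetermined.exists_eq_of_generic (hD : IsDetermined c L) (hc : ContDiff ℝ (⊤ : ℕ∞) c)
    (hcpos : ∀ u, 0 < c u)
    (hnc : ¬ ∃ k : ℝ, ∀ u : ℝ, deriv c u * (c u) ^ (-(3 : ℝ) / 2) = k)
    (hL : ContDiff ℝ (⊤ : ℕ∞) L) :
    ∃ a b d : ℝ, ∀ t x u v w, L (t, x, u, v, w) = a * v + b * w + d * (t * v + x * w) := by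
  have hgen := not_exists_deriv_sqrt_eq hc hcpos hnc
  obtain ⟨u₁, hu₁⟩ := hgen 0
  rw [zero_mul] at hu₁
  obtain ⟨α, β, γ, δ, hβ, hγ, hδ, hform⟩ :=
    hD.exists_eq hc hcpos hL (exists_ne_of_deriv_sqrt_ne_zero hu₁)
  have hqpos := fun u => Real.sqrt_pos.2 (hcpos u)
  have hqd : ∀ u, HasDerivAt (fun z => √(c z)) (deriv (fun z => √(c z)) u) u := fun u =>
    ((hc.hasDerivAt_of_top u).sqrt (hcpos u).ne').differentiableAt.hasDerivAt
  have Ld := hL.differentiable_of_top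
  have Ld' := fun e => (hL.dirDeriv e).differentiable_of_top
  have tβ := hasDerivAt_tDeriv hβ.differentiable_of_top
  have xβ := hasDerivAt_xDeriv hβ.differentiable_of_top
  have tγ := hasDerivAt_tDeriv hγ.differentiable_of_top
  have xγ := hasDerivAt_xDeriv hγ.differentiable_of_top
  have tδ := hasDerivAt_tDeriv hδ.differentiable_of_top
  have xδ := hasDerivAt_xDeriv hδ.differentiable_of_top
  have lin : ∀ k m s : ℝ, HasDerivAt (fun z => k + m * z) m s := fun k m s => by
    simpa using ((hasDerivAt_id s).const_mul m).const_add k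
  have eV : ∀ t x u v w, dV L (t, x, u, v, w) = β (t, x) + δ (t, x) * √(c u) * w :=
    fun t x u v w => by
      refine (hasDerivAt_dV Ld t x u v w).unique ((lin (α (t, x) / √(c u) + γ (t, x) * w)
        (β (t, x) + δ (t, x) * √(c u) * w) v).congr_of_eventuallyEq (.of_forall fun z => ?_))
      simp only [hform]
      ring
  have eW : ∀ t x u v w, dW L (t, x, u, v, w) = γ (t, x) + δ (t, x) * √(c u) * v :=
    fun t x u v w => by
      refine (hasDerivAt_dW Ld t x u v w).unique ((lin (α (t, x) / √(c u) + β (t, x) * v)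
        (γ (t, x) + δ (t, x) * √(c u) * v) w).congr_of_eventuallyEq (.of_forall fun z => ?_))
      simp only [hform]
      ring
  have eU : ∀ t x u v w, dU L (t, x, u, v, w) =
      -(α (t, x) * deriv (fun z => √(c z)) u / √(c u) ^ 2)
        + δ (t, x) * deriv (fun z => √(c z)) u * (v * w) := fun t x u v w => by
    refine (hasDerivAt_dU Ld t x u v w).unique ?_
    simp only [hform]
    refine ((((hasDerivAt_const u (α (t, x))).div (hqd u) (hqpos u).ne').add_const
      (β (t, x) * v)).add_const (γ (t, x) * w)).add
      (((hqd u).const_mul (δ (t, x))).mul_const (v * w)) |>.congr_deriv ?_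
    ring
  have eTV : ∀ t x u v w, dT (dV L) (t, x, u, v, w) =
      tDeriv β (t, x) + tDeriv δ (t, x) * √(c u) * w := fun t x u v w => by
    refine (hasDerivAt_dT (Ld' _) t x u v w).unique ?_
    simp only [eV]
    exact (tβ t x).add (((tδ t x).mul_const _).mul_const _)
  have eXV : ∀ t x u v w, dX (dV L) (t, x, u, v, w) =
      xDeriv β (t, x) + xDeriv δ (t, x) * √(c u) * w := fun t x u v w => by
    refine (hasDerivAt_dX (Ld' _) t x u v w).unique ?_
    simp only [eV]
    exact (xβ t x).add (((xδ t x).mul_const _).mul_const _)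
  have eTW : ∀ t x u v w, dT (dW L) (t, x, u, v, w) =
      tDeriv γ (t, x) + tDeriv δ (t, x) * √(c u) * v := fun t x u v w => by
    refine (hasDerivAt_dT (Ld' _) t x u v w).unique ?_
    simp only [eW]
    exact (tγ t x).add (((tδ t x).mul_const _).mul_const _)
  have eXW : ∀ t x u v w, dX (dW L) (t, x, u, v, w) =
      xDeriv γ (t, x) + xDeriv δ (t, x) * √(c u) * v := fun t x u v w => by
    refine (hasDerivAt_dX (Ld' _) t x u v w).unique ?_
    simp only [eW]
    exact (xγ t x).add (((xδ t x).mul_const _).mul_const _)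
  have eUV : ∀ t x u v w, dU (dV L) (t, x, u, v, w) =
      δ (t, x) * deriv (fun z => √(c z)) u * w := fun t x u v w => by
    refine (hasDerivAt_dU (Ld' _) t x u v w).unique ?_
    simp only [eV]
    exact (((hqd u).const_mul _).mul_const _).const_add _
  have eUW : ∀ t x u v w, dU (dW L) (t, x, u, v, w) =
      δ (t, x) * deriv (fun z => √(c z)) u * v := fun t x u v w => by
    refine (hasDerivAt_dU (Ld' _) t x u v w).unique ?_
    simp only [eW]
    exact (((hqd u).const_mul _).mul_const _).const_add _
  have hvv := hD.dV_dV_eq_zero hc hcpos hL (exists_ne_of_deriv_sqrt_ne_zero hu₁)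
  have htt := hD.tt
  have htx := hD.tx
  simp only [eTV, eXW, eUV, eUW, eU, hvv, Pi.zero_apply] at htt
  simp only [eTW, eXV] at htx
  have hα : ∀ t x, α (t, x) = 0 := by
    intro t x
    by_contra h
    obtain ⟨u, hu⟩ := hgen ((tDeriv β (t, x) - xDeriv γ (t, x)) / (2 * α (t, x)))
    have h0 := htt t x u 0 0
    have := (hqpos u).ne'
    refine hu ?_
    field_simp at h0 ⊢
    linear_combination -h0
  have hβγ : tDeriv β = xDeriv γ := by
    funext ⟨t, x⟩
    have h0 := htt t x 0 0 0
    rw [hα] at h0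
    linear_combination h0
  have hδ : ∀ t x, δ (t, x) = 0 := by
    intro t x
    have h1 := htt t x u₁ 1 1
    have h2 := htt t x u₁ (-1) (-1)
    rw [hα, hβγ] at h1 h2
    exact (mul_eq_zero.1 (by linear_combination (h1 + h2) / 4 :
      δ (t, x) * deriv (fun z => √(c z)) u₁ = 0)).resolve_right hu₁
  have hxβ : xDeriv β = 0 := by
    funext ⟨t, x⟩
    obtain ⟨u₂, hu₂⟩ := exists_ne_of_deriv_sqrt_ne_zero hu₁ 0
    have h1 := htx t x 0 0 0
    have h2 := htx t x u₂ 0 0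
    refine (mul_eq_zero.1 (by linear_combination h1 - h2 :
      (c u₂ ^ 2 - c 0 ^ 2) * xDeriv β (t, x) = 0)).resolve_left fun h => hu₂ ?_
    exact (pow_left_inj₀ (hcpos u₂).le (hcpos 0).le two_ne_zero).1 (sub_eq_zero.1 h)
  have htγ : tDeriv γ = 0 := by
    funext ⟨t, x⟩
    have h1 := htx t x 0 0 0
    rw [hxβ] at h1
    simpa using h1
  have hzero : ∀ e : ℝ × ℝ, dirDeriv e (0 : ℝ × ℝ → ℝ) = 0 := fun e => by
    funext p; simp [dirDeriv]
  have hd : ∀ t x, tDeriv β (t, x) = tDeriv β (0, 0) := by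
    intro t x
    have hbd := (hβ.dirDeriv (1, 0)).differentiable_of_top
    have ex : xDeriv (tDeriv β) = 0 :=
      (dirDeriv_comm hβ _ _).trans ((congrArg tDeriv hxβ).trans (hzero _))
    have et : tDeriv (tDeriv β) = 0 :=
      (congrArg tDeriv hβγ).trans
        ((dirDeriv_comm hγ _ _).trans ((congrArg xDeriv htγ).trans (hzero _)))
    rw [eq_of_hasDerivAt_zero (h := fun x => tDeriv β (t, x)) (fun s => by
      simpa [ex] using hasDerivAt_xDeriv hbd t s) x 0]
    exact eq_of_hasDerivAt_zero (h := fun t => tDeriv β (t, 0)) (fun s => by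
      simpa [et] using hasDerivAt_tDeriv hbd s 0) t 0
  refine ⟨β (0, 0), γ (0, 0), tDeriv β (0, 0), fun t x u v w => ?_⟩
  have b1 : β (t, x) = β (t, 0) :=
    eq_of_hasDerivAt_zero (h := fun x => β (t, x)) (fun s => by simpa [hxβ] using xβ t s) x 0
  have b2 : β (t, 0) = β (0, 0) + t * tDeriv β (0, 0) :=
    eq_add_mul_of_hasDerivAt_const (h := fun t => β (t, 0)) (fun s => hd s 0 ▸ tβ s 0) t
  have c1 : γ (t, x) = γ (0, x) :=
    eq_of_hasDerivAt_zero (h := fun t => γ (t, x)) (fun s => by simpa [htγ] using tγ s x) t 0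
  have c2 : γ (0, x) = γ (0, 0) + x * tDeriv β (0, 0) :=
    eq_add_mul_of_hasDerivAt_const (h := fun x => γ (0, x))
      (fun s => by rw [← hd 0 s, hβγ]; exact xγ 0 s) x
  rw [hform, hα, hδ, b1, b2, c1, c2]
  ring

end Speed

/-- The linear combinations of `uₜ`, `uₓ` and `t uₜ + x uₓ` are multipliers. -/
theorem isMultiplierWave_linear {c : ℝ → ℝ} (hc : ContDiff ℝ (⊤ : ℕ∞) c) (a b d : ℝ) :
    IsMultiplierWave c fun t x _ v w => a * v + b * w + d * (t * v + x * w) := by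
  let i₀ : JetIdx 3 := ⟨(0, 0), by decide⟩
  let iₜ : JetIdx 3 := ⟨(1, 0), by decide⟩
  let iₓ : JetIdx 3 := ⟨(0, 1), by decide⟩
  refine ⟨fun q => (a + d * q.1) * ((q.2.2 iₜ ^ 2 + c (q.2.2 i₀) ^ 2 * q.2.2 iₓ ^ 2) / 2)
      + (b + d * q.2.1) * (q.2.2 iₜ * q.2.2 iₓ),
    fun q => -((a + d * q.1) * (c (q.2.2 i₀) ^ 2 * (q.2.2 iₜ * q.2.2 iₓ)))
      - (b + d * q.2.1) * ((q.2.2 iₜ ^ 2 + c (q.2.2 i₀) ^ 2 * q.2.2 iₓ ^ 2) / 2),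
    by fun_prop, by fun_prop, fun u hu t x => ?_⟩
  set f : ℝ × ℝ → ℝ := fun p => u p.1 p.2 with hfdef
  have hf : ContDiff ℝ (⊤ : ℕ∞) f := hu
  have e : ∀ i j t x, pd i j u t x = mixedDeriv i j f (t, x) := fun i j t x =>
    congrFun (congrFun (pd_eq_mixedDeriv i j hf) t) x
  have ft := hasDerivAt_tDeriv hf.differentiable_of_top t x
  have fx := hasDerivAt_xDeriv hf.differentiable_of_top t x
  have ftt := hasDerivAt_tDeriv (hf.dirDeriv (1, 0)).differentiable_of_top t x
  have ftx := hasDerivAt_tDeriv (hf.dirDeriv (0, 1)).differentiable_of_top t x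
  have fxt := hasDerivAt_xDeriv (hf.dirDeriv (1, 0)).differentiable_of_top t x
  have fxx := hasDerivAt_xDeriv (hf.dirDeriv (0, 1)).differentiable_of_top t x
  have cft : HasDerivAt (fun s => c (f (s, x))) (deriv c (f (t, x)) * tDeriv f (t, x)) t :=
    (hc.hasDerivAt_of_top (f (t, x))).comp t ft
  have cfx : HasDerivAt (fun s => c (f (t, s))) (deriv c (f (t, x)) * xDeriv f (t, x)) x :=
    (hc.hasDerivAt_of_top (f (t, x))).comp x fx
  have lin : ∀ k s : ℝ, HasDerivAt (fun z => k + d * z) d s := fun k s => by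
    simpa using ((hasDerivAt_id s).const_mul d).const_add k
  have j₀ : ∀ t x, jet 3 u t x i₀ = f (t, x) := fun t x => rfl
  have jₜ : ∀ t x, jet 3 u t x iₜ = tDeriv f (t, x) := e 1 0
  have jₓ : ∀ t x, jet 3 u t x iₓ = xDeriv f (t, x) := e 0 1
  have h1 := ((lin a t).mul ((ftt.pow 2).add ((cft.pow 2).mul (ftx.pow 2)) |>.div_const 2)).add
    ((ftt.mul ftx).const_mul (b + d * x))
  have h2 := (((cfx.pow 2).mul (fxt.mul fxx)).const_mul (a + d * t)).neg.sub
    ((lin b x).mul ((fxt.pow 2).add ((cfx.pow 2).mul (fxx.pow 2)) |>.div_const 2))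
  simp only [j₀, jₜ, jₓ, e]
  have hcomm : xDeriv (tDeriv f) (t, x) = tDeriv (xDeriv f) (t, x) :=
    congrFun (dirDeriv_comm hf _ _) _
  refine Eq.trans ?_ (congrArg₂ (· + ·) h1.deriv h2.deriv).symm
  simp only [mixedDeriv, Function.iterate_succ, Function.iterate_zero, Function.comp_apply, id,
    Pi.mul_apply, Pi.add_apply, Pi.pow_apply, hcomm]
  change (_ - c (f (t, x)) ^ 2 * _ - c (f (t, x)) * deriv c (f (t, x)) * _) * _ = _
  push_cast
  ring

/-- For a smooth positive wave speed `c` with `c'·c^{-3/2}` non-constant, a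
smooth `Λ(t,x,u,u_t,u_x)` is a conservation-law multiplier of
`u_tt = c(u)(c(u)u_x)_x` iff it is a linear combination of `u_t`, `u_x`
and `t·u_t + x·u_x`. -/
theorem wave_generic_multiplier_classification
    (c : ℝ → ℝ) (hc : ContDiff ℝ (⊤ : ℕ∞) c) (hcpos : ∀ u : ℝ, 0 < c u)
    (hnc : ¬ ∃ k : ℝ, ∀ u : ℝ, deriv c u * (c u) ^ (-(3 : ℝ) / 2) = k)
    (Λ : ℝ → ℝ → ℝ → ℝ → ℝ → ℝ) (hΛ : Smooth5 Λ) :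
    IsMultiplierWave c Λ ↔
      ∃ a b d : ℝ, ∀ t x u v w : ℝ,
        Λ t x u v w = a * v + b * w + d * (t * v + x * w) := by
  have hL : ContDiff ℝ (⊤ : ℕ∞) (uncurry₅ Λ) := hΛ
  constructor
  · intro hm
    obtain ⟨a, b, d, h⟩ := (isDetermined_of_waveEuler_eq_zero hc hcpos hL fun _ hf =>
      hm.waveEuler_eq_zero hc hΛ hf).exists_eq_of_generic hc hcpos hnc hL
    exact ⟨a, b, d, h⟩
  · rintro ⟨a, b, d, h⟩
    obtain rfl : Λ = fun t x _ v w => a * v + b * w + d * (t * v + x * w) := by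
      funext t x u v w
      exact h t x u v w
    exact isMultiplierWave_linear hc a b d
end
end
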